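/- For every β ∈ [2,∞) there exist c_β > 0, C_β > 0 and λ₀ ∈ (0,1/2) such that for all λ ∈ (0,λ₀), all integers N ≥ 2 and every p₀ ∈ {0,…,N}: letting 𝒜(p₀) ⊂ Λ^N×Λ^N be the event that the configuration has exactly p₀ isolated dipoles, log ℙ_{N,β}^λ(𝒜(p₀)) ≤ −c_β N (1 − p₀/N)² + C_β (N ω_λ + log N). -/

import Mathlib

open MeasureTheory Real
open scoped ENNReal NNReal BigOperators Classical

noncomputable section

/-- The plane `ℝ²`. -/
abbrev E2 := EuclideanSpace ℝ (Fin 2)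

/-- The logarithmic Coulomb kernel `g(x) = -log |x|`. -/
def gfun (x : E2) : ℝ := -Real.log ‖x‖

/-- The uniform probability measure on the closed ball `B(z, lam)` (smeared charge). -/
def udisc (z : E2) (lam : ℝ) : MeasureTheory.Measure E2 :=
  (MeasureTheory.volume (Metric.closedBall z lam))⁻¹ •
    MeasureTheory.volume.restrict (Metric.closedBall z lam)

/-- The smeared interaction `g_lam(z) = ∬ g(x-y) dδ_0^{(lam)}(x) dδ_z^{(lam)}(y)`. -/
def gsm (lam : ℝ) (z : E2) : ℝ :=
  ∫ x, (∫ y, gfun (x - y) ∂(udisc z lam)) ∂(udisc 0 lam)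

/-- `κ = g_1(0)`. -/
def kappa : ℝ := gsm 1 0

/-- The (renormalized) energy `F_lam(X_N, Y_N)`. -/
def Flam (N : ℕ) (lam : ℝ) (X Y : Fin N → E2) : ℝ :=
  (1/2) * (∑ i : Fin N, ∑ j : Fin N,
      (gsm lam (X i - X j) + gsm lam (Y i - Y j) - 2 * gsm lam (X i - Y j)))
    - N * (-Real.log lam + kappa)

/-- The box `Λ = [0, √N]²`. -/
def LamBox (N : ℕ) : Set E2 := {x | ∀ i, x i ∈ Set.Icc (0:ℝ) (Real.sqrt N)}

/-- The configuration space `Λ^N × Λ^N`. -/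
def confSet (N : ℕ) : Set ((Fin N → E2) × (Fin N → E2)) :=
  {P | (∀ i, P.1 i ∈ LamBox N) ∧ (∀ i, P.2 i ∈ LamBox N)}

/-- The partition function `Z_{N,β}^{lam}`. -/
def Zpart (N : ℕ) (β lam : ℝ) : ℝ :=
  ∫ P in confSet N, Real.exp (-β * Flam N lam P.1 P.2)

/-- `g_1` evaluated at (any) point of norm `r` (it is radial). -/
def g1rad (r : ℝ) : ℝ := gsm 1 (EuclideanSpace.single (0 : Fin 2) r)

/-- The constant `𝒵_β`. -/
def Zbeta (β : ℝ) : ℝ :=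
  if β = 2 then 2 * Real.pi
  else 2 * Real.pi * ∫ r in Set.Ioi (0:ℝ), Real.exp (β * g1rad r) * r

/-- The error rate `ω_lam` (with `M₀ = 36`). -/
def omegaL (β lam : ℝ) : ℝ :=
  if β = 2 then |Real.log lam| ^ (-(1:ℝ)/(5+36))
  else if β < 4 then lam ^ ((2*(β-2))/(12-β+36))
  else if β = 4 then (lam * |Real.log lam|) ^ ((1:ℝ)/(2+36))
  else lam ^ ((1:ℝ)/(2+36))

/-- Nearest-neighbor index: the unique `j ≠ i` minimizing `|z_i - z_j|` when it exists
(this is the case almost everywhere), and `i` otherwise. -/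
def phi1 {ι : Type} [Fintype ι] (z : ι → E2) (i : ι) : ι :=
  if h : ∃! j, j ≠ i ∧ ∀ k, k ≠ i → dist (z i) (z j) ≤ dist (z i) (z k) then h.choose else i

/-- The charge `d_i`: `+1` for the `x`-indices and `-1` for the `y`-indices. -/
def charge {N : ℕ} : Fin N ⊕ Fin N → ℝ := Sum.elim (fun _ => 1) (fun _ => -1)

/-- The combined configuration `(z_1, …, z_{2N}) = (x_1, …, x_N, y_1, …, y_N)`. -/
def zconf {N : ℕ} (X Y : Fin N → E2) : Fin N ⊕ Fin N → E2 := Sum.elim X Y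

/-- The reduced nearest-neighbor dipole energy `F̃_lam`. -/
def Ftil (N : ℕ) (lam : ℝ) (X Y : Fin N → E2) : ℝ :=
  -(1/2) * ∑ i : Fin N ⊕ Fin N,
    (if phi1 (zconf X Y) (phi1 (zconf X Y) i) = i ∧
        charge i * charge (phi1 (zconf X Y) i) = -1
     then gsm lam (zconf X Y i - zconf X Y (phi1 (zconf X Y) i)) else 0)

/-- The Gibbs measure `ℙ_{N,β}^{lam}` on `Λ^N × Λ^N`. -/
def Gibbs (N : ℕ) (β lam : ℝ) : MeasureTheory.Measure ((Fin N → E2) × (Fin N → E2)) :=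
  (ENNReal.ofReal (Zpart N β lam))⁻¹ •
    ((MeasureTheory.volume.restrict (confSet N)).withDensity
      (fun P => ENNReal.ofReal (Real.exp (-β * Flam N lam P.1 P.2))))

/-- `i` and `j` form an isolated (neutral) dipole: they are mutual nearest neighbors of
opposite charge, and no other point has its nearest neighbor among them. -/
def isIsolatedDipolePair {N : ℕ} (z : Fin N ⊕ Fin N → E2) (i j : Fin N ⊕ Fin N) : Prop :=
  phi1 z i = j ∧ phi1 z j = i ∧ charge i * charge j = -1 ∧
    ∀ k, k ≠ i → k ≠ j → phi1 z k ≠ i ∧ phi1 z k ≠ j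

/-- The number of isolated dipoles of a configuration (each unordered dipole is counted
once; ordered pairs are counted twice, whence the division by `2`). -/
def numIsolatedDipoles {N : ℕ} (z : Fin N ⊕ Fin N → E2) : ℕ :=
  Nat.card {q : (Fin N ⊕ Fin N) × (Fin N ⊕ Fin N) // isIsolatedDipolePair z q.1 q.2} / 2

/-- The normalised overlap area of two discs of radius `s`. -/
def lensK (s : ℝ) (x y : E2) : ℝ :=
  volume.real (Metric.closedBall x s ∩ Metric.closedBall y s) /
    volume.real (Metric.closedBall (0 : E2) s)

lemma volume_real_closedBall_E2 (x : E2) {s : ℝ} (hs : 0 ≤ s) :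
    volume.real (Metric.closedBall x s) = s ^ 2 * π := by
  rw [measureReal_def, EuclideanSpace.volume_closedBall_fin_two, ENNReal.toReal_mul,
    ENNReal.toReal_pow, ENNReal.toReal_ofReal hs]
  simp [pi_pos.le]

lemma lensK_nonneg (s : ℝ) (x y : E2) : 0 ≤ lensK s x y := by
  unfold lensK; positivity

lemma lensK_comm (s : ℝ) (x y : E2) : lensK s x y = lensK s y x := by
  unfold lensK; rw [Set.inter_comm]

lemma lensK_le_one {s : ℝ} (hs : 0 < s) (x y : E2) : lensK s x y ≤ 1 := by
  unfold lensK
  rw [div_le_one (by rw [volume_real_closedBall_E2 _ hs.le]; positivity),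
    volume_real_closedBall_E2 0 hs.le, ← volume_real_closedBall_E2 x hs.le]
  exact measureReal_mono Set.inter_subset_left (measure_closedBall_lt_top).ne

lemma lensK_eq_zero {s : ℝ} {x y : E2} (h : 2 * s < dist x y) : lensK s x y = 0 := by
  have : Metric.closedBall x s ∩ Metric.closedBall y s = ∅ := by
    rw [← Set.disjoint_iff_inter_eq_empty]
    exact Metric.closedBall_disjoint_closedBall (by linarith)
  simp [lensK, this]

lemma one_sub_lensK_le {s : ℝ} (hs : 0 < s) (x y : E2) :
    1 - lensK s x y ≤ 2 * dist x y / s := by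
  rcases le_or_gt s (dist x y) with h | h
  · have h1 := lensK_nonneg s x y
    have : 1 ≤ dist x y / s := by rwa [one_le_div hs]
    rw [mul_div_assoc]; linarith
  · have hsub : Metric.closedBall x (s - dist x y) ⊆
        Metric.closedBall x s ∩ Metric.closedBall y s := by
      apply Set.subset_inter
      · exact Metric.closedBall_subset_closedBall (by linarith [dist_nonneg (x := x) (y := y)])
      · exact Metric.closedBall_subset_closedBall' (by linarith)
    have h2 := measureReal_mono (μ := volume) hsub
      ((measure_mono Set.inter_subset_left).trans_lt measure_closedBall_lt_top).ne
    rw [volume_real_closedBall_E2 _ (by linarith)] at h2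
    have h3 : ((s - dist x y) ^ 2 * π) / (s ^ 2 * π) ≤ lensK s x y := by
      unfold lensK
      rw [volume_real_closedBall_E2 0 hs.le]
      gcongr
    have h4 : ((s - dist x y) ^ 2 * π) / (s ^ 2 * π) =
        1 - 2 * dist x y / s + (dist x y / s) ^ 2 := by
      field_simp; ring
    nlinarith [sq_nonneg (dist x y / s)]

lemma lensK_translate (s : ℝ) (x y a : E2) : lensK s (x + a) (y + a) = lensK s x y := by
  unfold lensK
  congr 1
  have : (fun w : E2 => w + a) ⁻¹' (Metric.closedBall (x + a) s ∩ Metric.closedBall (y + a) s) =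
      Metric.closedBall x s ∩ Metric.closedBall y s := by
    ext w; simp
  rw [← this, measureReal_def, measureReal_def, measure_preimage_add_right]

lemma lensK_rotate (s : ℝ) {u v : E2} (h : ‖u‖ = ‖v‖) : lensK s 0 u = lensK s 0 v := by
  obtain ⟨U, hU⟩ : ∃ U : E2 ≃ₗᵢ[ℝ] E2, U u = v := ⟨_, Submodule.reflection_sub h⟩
  unfold lensK
  congr 1
  have : U ⁻¹' (Metric.closedBall 0 s ∩ Metric.closedBall v s) =
      Metric.closedBall 0 s ∩ Metric.closedBall u s := by
    ext w; simp [← hU]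
  rw [← this, measureReal_def, measureReal_def, U.measurePreserving.measure_preimage]
  exact (measurableSet_closedBall.inter measurableSet_closedBall).nullMeasurableSet

open scoped Pointwise in
lemma lensK_smul {s : ℝ} (hs : 0 < s) (u : E2) : lensK s 0 (s • u) = lensK 1 0 u := by
  unfold lensK
  have h : Metric.closedBall (0 : E2) s ∩ Metric.closedBall (s • u) s =
      s • (Metric.closedBall (0 : E2) 1 ∩ Metric.closedBall u 1) := by
    rw [Set.smul_set_inter₀ hs.ne', smul_closedBall' hs.ne', smul_closedBall' hs.ne']
    simp [abs_of_pos hs]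
  rw [h, measureReal_def, Measure.addHaar_smul, volume_real_closedBall_E2 _ hs.le,
    volume_real_closedBall_E2 _ zero_le_one, ENNReal.toReal_mul, measureReal_def]
  simp only [finrank_euclideanSpace, Fintype.card_fin]
  rw [ENNReal.toReal_ofReal (abs_nonneg _), abs_of_pos (by positivity)]
  field_simp

/-- The radial profile of `lensK`. -/
def lensProfile (t : ℝ) : ℝ := lensK 1 0 (EuclideanSpace.single (0 : Fin 2) t)

lemma lensK_eq_profile {s : ℝ} (hs : 0 < s) (x y : E2) :
    lensK s x y = lensProfile (dist x y / s) := by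
  have h1 : lensK s x y = lensK s 0 (y - x) := by
    rw [← lensK_translate s 0 (y - x) x]; simp
  have h2 : y - x = s • (s⁻¹ • (y - x)) := by rw [smul_smul, mul_inv_cancel₀ hs.ne', one_smul]
  rw [h1, h2, lensK_smul hs]
  apply lensK_rotate
  rw [norm_smul, PiLp.norm_single, dist_eq_norm, ← norm_sub_rev y x, norm_inv,
    Real.norm_of_nonneg hs.le, Real.norm_of_nonneg (by positivity)]
  ring

lemma measurable_lens_volume : Measurable (fun p : ℝ × E2 × E2 =>
    volume (Metric.closedBall p.2.1 p.1 ∩ Metric.closedBall p.2.2 p.1)) := by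
  have hS : MeasurableSet {q : (ℝ × E2 × E2) × E2 |
      dist q.2 q.1.2.1 ≤ q.1.1 ∧ dist q.2 q.1.2.2 ≤ q.1.1} := by
    have h1 : IsClosed {q : (ℝ × E2 × E2) × E2 | dist q.2 q.1.2.1 ≤ q.1.1} :=
      isClosed_le (by fun_prop) (by fun_prop)
    have h2 : IsClosed {q : (ℝ × E2 × E2) × E2 | dist q.2 q.1.2.2 ≤ q.1.1} :=
      isClosed_le (by fun_prop) (by fun_prop)
    exact (h1.inter h2).measurableSet
  exact measurable_measure_prodMk_left (ν := (volume : Measure E2)) hS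

lemma measurable_lensK : Measurable (fun p : ℝ × E2 × E2 => lensK p.1 p.2.1 p.2.2) := by
  unfold lensK
  apply Measurable.div
  · exact measurable_lens_volume.ennreal_toReal
  · have : Measurable (fun s : ℝ => volume (Metric.closedBall (0 : E2) s)) := by
      have h := measurable_lens_volume.comp
        (measurable_id.prodMk (measurable_const (a := ((0 : E2), (0 : E2)))))
      simpa [Function.comp_def] using h
    exact (this.ennreal_toReal).comp measurable_fst

lemma continuous_single_E2 :
    Continuous (fun t : ℝ => (EuclideanSpace.single (0 : Fin 2) t : E2)) := by
  have h : (fun t : ℝ => (EuclideanSpace.single (0 : Fin 2) t : E2)) =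
      fun t => t • (EuclideanSpace.single (0 : Fin 2) (1 : ℝ) : E2) := by
    ext t i
    by_cases hi : i = 0 <;> simp [hi]
  rw [h]
  exact continuous_id.smul continuous_const

lemma measurable_lensProfile : Measurable lensProfile := by
  have h : Measurable (fun t : ℝ =>
      ((1 : ℝ), (0 : E2), (EuclideanSpace.single (0 : Fin 2) t : E2))) :=
    measurable_const.prodMk (measurable_const.prodMk continuous_single_E2.measurable)
  have h2 := measurable_lensK.comp h
  exact h2

lemma lensProfile_nonneg (t : ℝ) : 0 ≤ lensProfile t := lensK_nonneg _ _ _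

lemma lensProfile_le_one (t : ℝ) : lensProfile t ≤ 1 := lensK_le_one one_pos _ _

lemma dist_zero_single (t : ℝ) :
    dist (0 : E2) (EuclideanSpace.single (0 : Fin 2) t) = |t| := by
  rw [dist_zero_left, PiLp.norm_single, Real.norm_eq_abs]

lemma lensProfile_eq_zero {t : ℝ} (ht : 2 < t) : lensProfile t = 0 := by
  apply lensK_eq_zero
  rw [dist_zero_single, abs_of_pos (by linarith)]; linarith

lemma one_sub_lensProfile_le {t : ℝ} (ht : 0 ≤ t) : 1 - lensProfile t ≤ 2 * t := by
  have := one_sub_lensK_le one_pos (0 : E2) (EuclideanSpace.single (0 : Fin 2) t)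
  rw [dist_zero_single, abs_of_nonneg ht, div_one] at this
  exact this

/-- The cut-off `1[s > 1]`. -/
def stepOne (s : ℝ) : ℝ := if 1 < s then 1 else 0

lemma measurable_stepOne : Measurable stepOne :=
  Measurable.ite measurableSet_Ioi measurable_const measurable_const

lemma stepOne_sub_eq_of_le {r : ℝ} (hr : 0 < r) (h1 : r ≤ 1) (t : ℝ) :
    (stepOne t - stepOne (r * t)) / t = (Set.Ioc 1 (1 / r)).indicator (fun t => t⁻¹) t := by
  unfold stepOne
  simp only [Set.indicator_apply, Set.mem_Ioc, le_div_iff₀ hr]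
  by_cases h2 : 1 < t
  · by_cases h3 : 1 < r * t
    · have : ¬ (t * r ≤ 1) := by rw [mul_comm]; linarith
      simp [h2, h3, this]
    · have : t * r ≤ 1 := by rw [mul_comm]; linarith
      simp [h2, h3, this]
  · have h3 : ¬ 1 < r * t := by nlinarith
    simp [h2, h3]

lemma stepOne_sub_eq_of_ge {r : ℝ} (h1 : 1 ≤ r) (t : ℝ) :
    (stepOne t - stepOne (r * t)) / t = (Set.Ioc (1 / r) 1).indicator (fun t => -t⁻¹) t := by
  have hr : 0 < r := by linarith
  unfold stepOne
  simp only [Set.indicator_apply, Set.mem_Ioc, div_lt_iff₀ hr]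
  by_cases h2 : 1 < r * t
  · have h3 : 1 < t * r := by rwa [mul_comm]
    by_cases h4 : 1 < t
    · simp [h2, h3, h4]
    · simp [h2, h3, h4, not_lt.1 h4, neg_div]
  · have h3 : ¬ 1 < t * r := by rwa [mul_comm]
    have h4 : ¬ 1 < t := by intro h; apply h2; nlinarith
    simp [h2, h3, h4]

lemma stepOne_sub_integrable {r : ℝ} (hr : 0 < r) :
    Integrable (fun t => (stepOne t - stepOne (r * t)) / t) := by
  have hi : ∀ a b : ℝ, 0 < a → 0 < b → IntegrableOn (fun t : ℝ => t⁻¹) (Set.Ioc a b) := by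
    intro a b ha hb
    have := intervalIntegrable_inv_iff (a := a) (b := b) |>.2
      (Or.inr (Set.notMem_uIcc_of_lt ha hb))
    exact this.1
  rcases le_total r 1 with h | h
  · rw [funext (stepOne_sub_eq_of_le hr h), integrable_indicator_iff measurableSet_Ioc]
    exact hi _ _ one_pos (by positivity)
  · rw [funext (stepOne_sub_eq_of_ge h), integrable_indicator_iff measurableSet_Ioc]
    exact (hi _ _ (by positivity) one_pos).neg

lemma stepOne_sub_integral {r : ℝ} (hr : 0 < r) :
    ∫ t in Set.Ioi (0 : ℝ), (stepOne t - stepOne (r * t)) / t = -Real.log r := by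
  rcases le_total r 1 with h | h
  · rw [funext (stepOne_sub_eq_of_le hr h), setIntegral_indicator measurableSet_Ioc]
    have : Set.Ioi (0 : ℝ) ∩ Set.Ioc 1 (1 / r) = Set.Ioc 1 (1 / r) :=
      Set.inter_eq_right.2 fun t ht => by simp only [Set.mem_Ioi]; linarith [ht.1]
    rw [this, ← intervalIntegral.integral_of_le (by rwa [one_le_div hr]),
      integral_inv_of_pos one_pos (by positivity)]
    simp
  · rw [funext (stepOne_sub_eq_of_ge h), setIntegral_indicator measurableSet_Ioc]
    have hr1 : 0 < 1 / r := by positivity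
    have : Set.Ioi (0 : ℝ) ∩ Set.Ioc (1 / r) 1 = Set.Ioc (1 / r) 1 :=
      Set.inter_eq_right.2 fun t ht => by simp only [Set.mem_Ioi]; linarith [ht.1]
    rw [this, integral_neg, ← intervalIntegral.integral_of_le (by rwa [div_le_one hr]),
      integral_inv_of_pos hr1 one_pos]
    simp

/-- Radial profile of the finite-range decomposition of the logarithm. -/
def logProfile (s : ℝ) : ℝ := (lensProfile (1 / s) - stepOne s) / s

lemma measurable_logProfile : Measurable logProfile := by
  unfold logProfile
  exact ((measurable_lensProfile.comp (measurable_const.div measurable_id)).sub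
    measurable_stepOne).div measurable_id

lemma integrableOn_inv_sq_Ioi {a : ℝ} (ha : 0 < a) (c : ℝ) :
    IntegrableOn (fun s : ℝ => c / s ^ 2) (Set.Ioi a) := by
  have h : IntegrableOn (fun s : ℝ => c * s ^ (-2 : ℝ)) (Set.Ioi a) :=
    (integrableOn_Ioi_rpow_of_lt (show (-2 : ℝ) < -1 by norm_num) ha).const_mul c
  refine IntegrableOn.congr_fun h (fun s hs => ?_) measurableSet_Ioi
  have hs' : 0 < s := lt_trans ha hs
  rw [Real.rpow_neg hs'.le, div_eq_mul_inv]
  norm_cast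

lemma logProfile_integrableOn : IntegrableOn logProfile (Set.Ioi 0) := by
  have h0 : IntegrableOn logProfile (Set.Ioc 0 (1 / 4)) := by
    refine IntegrableOn.congr_fun (f := fun _ => (0 : ℝ)) (by simp) ?_ measurableSet_Ioc
    intro s hs
    have hs0 : 0 < s := hs.1
    have h1 : lensProfile (1 / s) = 0 := lensProfile_eq_zero (by
      rw [lt_div_iff₀ hs0]; linarith [hs.2])
    have h2 : ¬ 1 < s := by linarith [hs.2]
    simp only [logProfile, h1, stepOne, h2, if_false, sub_zero, zero_div]
  have h1 : IntegrableOn logProfile (Set.Ioc (1 / 4) 1) := by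
    refine Integrable.mono' (g := fun _ => (4 : ℝ)) (by simp)
      measurable_logProfile.aestronglyMeasurable ?_
    refine (ae_restrict_iff' measurableSet_Ioc).2 (Filter.Eventually.of_forall fun s hs => ?_)
    have hs0 : 0 < s := by linarith [hs.1]
    have h2 : ¬ 1 < s := by linarith [hs.2]
    simp only [logProfile, stepOne, h2, if_false, sub_zero]
    rw [Real.norm_of_nonneg (div_nonneg (lensProfile_nonneg _) hs0.le), div_le_iff₀ hs0]
    linarith [lensProfile_le_one (1 / s), hs.1]
  have h2 : IntegrableOn logProfile (Set.Ioi 1) := by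
    refine Integrable.mono' (g := fun s : ℝ => 2 / s ^ 2) (integrableOn_inv_sq_Ioi one_pos 2)
      measurable_logProfile.aestronglyMeasurable ?_
    refine (ae_restrict_iff' measurableSet_Ioi).2 (Filter.Eventually.of_forall fun s hs => ?_)
    have hs1 : 1 < s := hs
    have hs0 : 0 < s := by linarith
    simp only [logProfile, stepOne, hs1, if_true]
    rw [norm_div, Real.norm_of_nonneg hs0.le, Real.norm_eq_abs, abs_sub_comm,
      abs_of_nonneg (by linarith [lensProfile_le_one (1 / s)]), div_le_div_iff₀ hs0 (by positivity)]
    have := one_sub_lensProfile_le (t := 1 / s) (by positivity)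
    calc (1 - lensProfile (1 / s)) * s ^ 2 ≤ (2 * (1 / s)) * s ^ 2 := by gcongr
      _ = 2 * s := by field_simp
  have h3 : Set.Ioi (0 : ℝ) = (Set.Ioc 0 (1 / 4) ∪ Set.Ioc (1 / 4) 1) ∪ Set.Ioi 1 := by
    rw [Set.Ioc_union_Ioc_eq_Ioc (by norm_num) (by norm_num),
      Set.Ioc_union_Ioi_eq_Ioi (by norm_num)]
  rw [h3]
  exact (h0.union h1).union h2

/-- The additive constant in the finite-range decomposition of `-log`. -/
def c0 : ℝ := -∫ s in Set.Ioi (0 : ℝ), logProfile s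

lemma neg_log_eq_integral {r : ℝ} (hr : 0 < r) :
    -Real.log r = c0 + ∫ s in Set.Ioi (0 : ℝ), (lensProfile (r / s) - stepOne s) / s := by
  have h := integral_comp_mul_left_Ioi
    (fun s : ℝ => (lensProfile (r / s) - stepOne s) / s) 0 hr
  rw [mul_zero, smul_eq_mul] at h
  have h2 : ∫ s in Set.Ioi (0 : ℝ), (lensProfile (r / s) - stepOne s) / s =
      ∫ t in Set.Ioi (0 : ℝ), (logProfile t + (stepOne t - stepOne (r * t)) / t) := by
    have h3 := congrArg (fun x => r * x) h
    simp only [mul_inv_cancel_left₀ hr.ne'] at h3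
    rw [← h3, ← integral_const_mul]
    refine setIntegral_congr_fun measurableSet_Ioi fun t ht => ?_
    have ht' : 0 < t := ht
    have : r / (r * t) = 1 / t := by field_simp
    simp only [this, logProfile]
    field_simp
    ring
  rw [h2, integral_add logProfile_integrableOn (stepOne_sub_integrable hr).integrableOn,
    stepOne_sub_integral hr, c0]
  ring

lemma volume_closedBall_E2_ne_zero (z : E2) {r : ℝ} (hr : 0 < r) :
    volume (Metric.closedBall z r) ≠ 0 :=
  (Metric.measure_closedBall_pos volume z hr).ne'

lemma isProbabilityMeasure_udisc {lam : ℝ} (hl : 0 < lam) (z : E2) :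
    IsProbabilityMeasure (udisc z lam) := by
  constructor
  simp only [udisc, Measure.smul_apply, Measure.restrict_apply MeasurableSet.univ, Set.univ_inter,
    smul_eq_mul]
  exact ENNReal.inv_mul_cancel (volume_closedBall_E2_ne_zero z hl) measure_closedBall_lt_top.ne

lemma ae_mem_udisc (z : E2) (lam : ℝ) : ∀ᵐ x ∂(udisc z lam), x ∈ Metric.closedBall z lam := by
  unfold udisc
  apply Measure.ae_smul_measure
  exact ae_restrict_mem measurableSet_closedBall

lemma udisc_absolutelyContinuous (z : E2) (lam : ℝ) : udisc z lam ≪ volume := by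
  unfold udisc
  exact Measure.AbsolutelyContinuous.smul_left Measure.restrict_le_self.absolutelyContinuous _

lemma udisc_real_closedBall_le {lam : ℝ} (hl : 0 < lam) (z x : E2) {r : ℝ} (hr : 0 ≤ r) :
    (udisc z lam).real (Metric.closedBall x r) ≤ r ^ 2 / lam ^ 2 := by
  have h1 : (udisc z lam).real (Metric.closedBall x r) ≤
      (volume.real (Metric.closedBall z lam))⁻¹ * volume.real (Metric.closedBall x r) := by
    simp only [udisc, measureReal_def, Measure.smul_apply, smul_eq_mul, ENNReal.toReal_mul,
      ENNReal.toReal_inv]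
    gcongr
    · exact measure_closedBall_lt_top.ne
    · exact Measure.restrict_le_self
  rw [volume_real_closedBall_E2 _ hl.le, volume_real_closedBall_E2 _ hr] at h1
  refine h1.trans (le_of_eq ?_)
  field_simp

lemma integral_udisc_translate (z : E2) (lam : ℝ) (a : E2) (f : E2 → ℝ) :
    ∫ x, f x ∂(udisc (z + a) lam) = ∫ x, f (x + a) ∂(udisc z lam) := by
  unfold udisc
  rw [integral_smul_measure, integral_smul_measure]
  have h1 : volume (Metric.closedBall (z + a) lam) = volume (Metric.closedBall z lam) := by
    rw [EuclideanSpace.volume_closedBall_fin_two, EuclideanSpace.volume_closedBall_fin_two]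
  rw [h1]
  congr 1
  have h2 := (measurePreserving_add_right (volume : Measure E2) a).setIntegral_preimage_emb
    (MeasurableEquiv.addRight a).measurableEmbedding f (Metric.closedBall (z + a) lam)
  rw [← h2]
  congr 2
  ext w; simp

/-- The kernel `lensK` averaged over two discs of radius `lam`. -/
def smK (lam s : ℝ) (a b : E2) : ℝ :=
  ∫ p, lensK s p.1 p.2 ∂((udisc a lam).prod (udisc b lam))

section smK
variable {lam : ℝ} (hl : 0 < lam)
include hl

lemma integrable_lensK_udisc {s : ℝ} (hs : 0 < s) (a b : E2) :
    Integrable (fun p : E2 × E2 => lensK s p.1 p.2) ((udisc a lam).prod (udisc b lam)) := by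
  have := isProbabilityMeasure_udisc hl a
  have := isProbabilityMeasure_udisc hl b
  refine Integrable.mono' (integrable_const 1)
    (measurable_lensK.comp (measurable_const.prodMk measurable_id)).aestronglyMeasurable
    (Filter.Eventually.of_forall fun p => ?_)
  rw [Real.norm_of_nonneg (lensK_nonneg _ _ _)]
  exact lensK_le_one hs _ _

omit hl in
lemma smK_nonneg (s : ℝ) (a b : E2) : 0 ≤ smK lam s a b :=
  integral_nonneg fun _ => lensK_nonneg _ _ _

lemma smK_le_one {s : ℝ} (hs : 0 < s) (a b : E2) : smK lam s a b ≤ 1 := by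
  have := isProbabilityMeasure_udisc hl a
  have := isProbabilityMeasure_udisc hl b
  calc smK lam s a b ≤ ∫ _, (1 : ℝ) ∂((udisc a lam).prod (udisc b lam)) :=
        integral_mono (integrable_lensK_udisc hl hs a b) (integrable_const 1)
          fun p => lensK_le_one hs _ _
    _ = 1 := by simp

lemma smK_comm (s : ℝ) (a b : E2) : smK lam s a b = smK lam s b a := by
  have := isProbabilityMeasure_udisc hl a
  have := isProbabilityMeasure_udisc hl b
  unfold smK
  rw [← integral_prod_swap]
  exact integral_congr_ae (Filter.Eventually.of_forall fun p => lensK_comm _ _ _)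

lemma ae_mem_udisc_prod (a b : E2) : ∀ᵐ p ∂((udisc a lam).prod (udisc b lam)),
    dist p.1 a ≤ lam ∧ dist p.2 b ≤ lam := by
  have := isProbabilityMeasure_udisc hl a
  have := isProbabilityMeasure_udisc hl b
  filter_upwards [Measure.quasiMeasurePreserving_fst.ae (ae_mem_udisc a lam),
    Measure.quasiMeasurePreserving_snd.ae (ae_mem_udisc b lam)] with p h1 h2
  exact ⟨h1, h2⟩

omit hl in
lemma dist_abs_sub_le {a b x y : E2} (h1 : dist x a ≤ lam) (h2 : dist y b ≤ lam) :
    dist a b - 2 * lam ≤ dist x y ∧ dist x y ≤ dist a b + 2 * lam := by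
  have h3 := dist_triangle4 a x y b
  have h4 := dist_triangle4 x a b y
  rw [dist_comm a x] at h3
  rw [dist_comm b y] at h4
  constructor <;> linarith

lemma smK_eq_zero {s : ℝ} {a b : E2} (h : 2 * s + 2 * lam < dist a b) : smK lam s a b = 0 := by
  unfold smK
  rw [integral_eq_zero_of_ae]
  filter_upwards [ae_mem_udisc_prod hl a b] with p hp
  exact lensK_eq_zero (by linarith [(dist_abs_sub_le hp.1 hp.2).1])

lemma one_sub_smK_le {s : ℝ} (hs : 0 < s) (a b : E2) :
    1 - smK lam s a b ≤ 2 * (dist a b + 2 * lam) / s := by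
  have := isProbabilityMeasure_udisc hl a
  have := isProbabilityMeasure_udisc hl b
  have h1 : 1 - smK lam s a b =
      ∫ p, (1 - lensK s p.1 p.2) ∂((udisc a lam).prod (udisc b lam)) := by
    rw [integral_sub (integrable_const 1) (integrable_lensK_udisc hl hs a b)]
    simp [smK]
  rw [h1]
  calc _ ≤ ∫ _, 2 * (dist a b + 2 * lam) / s ∂((udisc a lam).prod (udisc b lam)) := by
        refine integral_mono_ae ((integrable_const 1).sub (integrable_lensK_udisc hl hs a b))
          (integrable_const _) ?_
        filter_upwards [ae_mem_udisc_prod hl a b] with p hp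
        refine (one_sub_lensK_le hs _ _).trans ?_
        have := (dist_abs_sub_le hp.1 hp.2).2
        gcongr
    _ = _ := by simp

lemma smK_le {s : ℝ} (hs : 0 < s) (a b : E2) : smK lam s a b ≤ 4 * s ^ 2 / lam ^ 2 := by
  have := isProbabilityMeasure_udisc hl a
  have := isProbabilityMeasure_udisc hl b
  unfold smK
  rw [integral_prod _ (integrable_lensK_udisc hl hs a b)]
  have h1 : ∀ x, ∫ y, lensK s x y ∂(udisc b lam) ≤ 4 * s ^ 2 / lam ^ 2 := by
    intro x
    calc ∫ y, lensK s x y ∂(udisc b lam)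
        ≤ ∫ y, (Metric.closedBall x (2 * s)).indicator (fun _ => (1 : ℝ)) y ∂(udisc b lam) := by
          refine integral_mono_of_nonneg (Filter.Eventually.of_forall fun y => lensK_nonneg _ _ _)
            ((integrable_const 1).indicator measurableSet_closedBall)
            (Filter.Eventually.of_forall fun y => ?_)
          by_cases hy : y ∈ Metric.closedBall x (2 * s)
          · simp only [Set.indicator_of_mem hy]; exact lensK_le_one hs _ _
          · simp only [Set.indicator_of_notMem hy]
            rw [Metric.mem_closedBall, not_le, dist_comm] at hy
            exact (lensK_eq_zero hy).le
      _ = (udisc b lam).real (Metric.closedBall x (2 * s)) := by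
          rw [integral_indicator measurableSet_closedBall]; simp
      _ ≤ _ := by
          refine (udisc_real_closedBall_le hl b x (by positivity)).trans (le_of_eq ?_)
          ring
  calc _ ≤ ∫ _, 4 * s ^ 2 / lam ^ 2 ∂(udisc a lam) :=
        integral_mono (integrable_lensK_udisc hl hs a b).integral_prod_left (integrable_const _) h1
    _ = _ := by simp

lemma smK_translate (s : ℝ) (a b u : E2) : smK lam s (a + u) (b + u) = smK lam s a b := by
  rcases le_or_gt s 0 with hs | hs
  · have h0 : ∀ x y : E2, lensK s x y = 0 := by
      intro x y
      unfold lensK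
      have : volume.real (Metric.closedBall (0 : E2) s) = 0 := by
        rw [measureReal_def, EuclideanSpace.volume_closedBall_fin_two, ENNReal.ofReal_of_nonpos hs]
        simp
      rw [this, div_zero]
    simp [smK, h0]
  have := isProbabilityMeasure_udisc hl a
  have := isProbabilityMeasure_udisc hl b
  have := isProbabilityMeasure_udisc hl (a + u)
  have := isProbabilityMeasure_udisc hl (b + u)
  unfold smK
  rw [integral_prod _ (integrable_lensK_udisc hl hs _ _),
    integral_prod _ (integrable_lensK_udisc hl hs _ _), integral_udisc_translate]
  congr 1
  ext x
  rw [integral_udisc_translate]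
  simp only [lensK_translate]

omit hl in
lemma measurableSet_lens (s : ℝ) :
    MeasurableSet {q : (E2 × E2) × E2 | dist q.2 q.1.1 ≤ s ∧ dist q.2 q.1.2 ≤ s} := by
  have h1 : IsClosed {q : (E2 × E2) × E2 | dist q.2 q.1.1 ≤ s} :=
    isClosed_le (by fun_prop) (by fun_prop)
  have h2 : IsClosed {q : (E2 × E2) × E2 | dist q.2 q.1.2 ≤ s} :=
    isClosed_le (by fun_prop) (by fun_prop)
  exact (h1.inter h2).measurableSet

omit hl in
lemma lintegral_lens_eq (ν₁ ν₂ : Measure E2) [IsProbabilityMeasure ν₁] [IsProbabilityMeasure ν₂]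
    (s : ℝ) :
    ∫⁻ p, volume (Metric.closedBall p.1 s ∩ Metric.closedBall p.2 s) ∂(ν₁.prod ν₂) =
      ∫⁻ w, ν₁ (Metric.closedBall w s) * ν₂ (Metric.closedBall w s) := by
  have e1 := Measure.prod_apply (μ := ν₁.prod ν₂) (ν := (volume : Measure E2))
    (measurableSet_lens s)
  have e2 := Measure.prod_apply_symm (μ := ν₁.prod ν₂) (ν := (volume : Measure E2))
    (measurableSet_lens s)
  have e3 : ∫⁻ p, volume (Metric.closedBall p.1 s ∩ Metric.closedBall p.2 s) ∂(ν₁.prod ν₂) =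
      ∫⁻ p, volume (Prod.mk p ⁻¹' {q : (E2 × E2) × E2 | dist q.2 q.1.1 ≤ s ∧ dist q.2 q.1.2 ≤ s})
        ∂(ν₁.prod ν₂) := rfl
  rw [e3, ← e1, e2]
  refine lintegral_congr fun w => ?_
  rw [← Measure.prod_prod]
  congr 1
  ext p
  simp only [Set.mem_preimage, Set.mem_ofPred_eq, Set.mem_prod, Metric.mem_closedBall,
    dist_comm w]

omit hl in
lemma measurable_closedBall_mul (ν₁ ν₂ : Measure E2) [IsProbabilityMeasure ν₁]
    [IsProbabilityMeasure ν₂] (s : ℝ) :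
    Measurable fun w : E2 => ν₁ (Metric.closedBall w s) * ν₂ (Metric.closedBall w s) := by
  have hm : MeasurableSet {q : E2 × E2 | dist q.2 q.1 ≤ s} :=
    (isClosed_le (by fun_prop) (by fun_prop)).measurableSet
  exact (measurable_measure_prodMk_left (ν := ν₁) hm).mul
    (measurable_measure_prodMk_left (ν := ν₂) hm)

omit hl in
lemma lintegral_lens_ne_top (ν₁ ν₂ : Measure E2) [IsProbabilityMeasure ν₁]
    [IsProbabilityMeasure ν₂] (s : ℝ) :
    ∫⁻ p, volume (Metric.closedBall p.1 s ∩ Metric.closedBall p.2 s) ∂(ν₁.prod ν₂) ≠ ⊤ := by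
  have hle : ∫⁻ p, volume (Metric.closedBall p.1 s ∩ Metric.closedBall p.2 s) ∂(ν₁.prod ν₂) ≤
      ∫⁻ _, volume (Metric.closedBall (0 : E2) s) ∂(ν₁.prod ν₂) := by
    refine lintegral_mono fun p => (measure_mono Set.inter_subset_left).trans (le_of_eq ?_)
    rw [EuclideanSpace.volume_closedBall_fin_two, EuclideanSpace.volume_closedBall_fin_two]
  rw [lintegral_const, measure_univ, mul_one] at hle
  exact (hle.trans_lt measure_closedBall_lt_top).ne

lemma integrable_udisc_mul (s : ℝ) (a b : E2) :
    Integrable (fun w => (udisc a lam).real (Metric.closedBall w s) *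
      (udisc b lam).real (Metric.closedBall w s)) := by
  have := isProbabilityMeasure_udisc hl a
  have := isProbabilityMeasure_udisc hl b
  have h := lintegral_lens_ne_top (udisc a lam) (udisc b lam) s
  rw [lintegral_lens_eq] at h
  have h2 := integrable_toReal_of_lintegral_ne_top
    (measurable_closedBall_mul (udisc a lam) (udisc b lam) s).aemeasurable h
  refine h2.congr (Filter.Eventually.of_forall fun w => ?_)
  simp only [ENNReal.toReal_mul, measureReal_def]

/-- `smK` as an overlap integral. -/
lemma smK_eq_integral (s : ℝ) (a b : E2) :
    smK lam s a b = (∫ w, (udisc a lam).real (Metric.closedBall w s) *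
      (udisc b lam).real (Metric.closedBall w s)) / volume.real (Metric.closedBall (0 : E2) s) := by
  have := isProbabilityMeasure_udisc hl a
  have := isProbabilityMeasure_udisc hl b
  have h3 : ∫ w, (udisc a lam).real (Metric.closedBall w s) *
      (udisc b lam).real (Metric.closedBall w s) =
      (∫⁻ w, udisc a lam (Metric.closedBall w s) *
        udisc b lam (Metric.closedBall w s)).toReal := by
    rw [← integral_toReal (measurable_closedBall_mul (udisc a lam) (udisc b lam) s).aemeasurable]
    · simp only [ENNReal.toReal_mul, measureReal_def]
    · exact Filter.Eventually.of_forall fun w =>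
        ENNReal.mul_lt_top (measure_lt_top _ _) (measure_lt_top _ _)
  have hm1 : Measurable fun p : E2 × E2 =>
      volume (Metric.closedBall p.1 s ∩ Metric.closedBall p.2 s) :=
    measurable_measure_prodMk_left (measurableSet_lens s)
  rw [h3, ← lintegral_lens_eq, ← integral_toReal hm1.aemeasurable]
  · unfold smK
    rw [← integral_div]
    rfl
  · exact Filter.Eventually.of_forall fun p =>
      (measure_mono Set.inter_subset_left).trans_lt measure_closedBall_lt_top

/-- Positive definiteness. -/
lemma smK_posDef (s : ℝ) {ι : Type} (t : Finset ι) (d : ι → ℝ) (z : ι → E2) :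
    0 ≤ ∑ v ∈ t, ∑ w ∈ t, d v * d w * smK lam s (z v) (z w) := by
  have h : ∑ v ∈ t, ∑ w ∈ t, d v * d w * smK lam s (z v) (z w) =
      (∫ x, (∑ v ∈ t, d v * (udisc (z v) lam).real (Metric.closedBall x s)) ^ 2) /
        volume.real (Metric.closedBall (0 : E2) s) := by
    have : ∀ x, (∑ v ∈ t, d v * (udisc (z v) lam).real (Metric.closedBall x s)) ^ 2 =
        ∑ v ∈ t, ∑ w ∈ t, d v * d w * ((udisc (z v) lam).real (Metric.closedBall x s) *
          (udisc (z w) lam).real (Metric.closedBall x s)) := by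
      intro x
      rw [sq, Finset.sum_mul_sum]
      refine Finset.sum_congr rfl fun v _ => Finset.sum_congr rfl fun w _ => by ring
    simp only [this]
    rw [integral_finsetSum _ fun v _ => integrable_finsetSum _ fun w _ =>
      ((integrable_udisc_mul hl s (z v) (z w)).const_mul _), Finset.sum_div]
    refine Finset.sum_congr rfl fun v _ => ?_
    rw [integral_finsetSum _ fun w _ =>
      ((integrable_udisc_mul hl s (z v) (z w)).const_mul _), Finset.sum_div]
    refine Finset.sum_congr rfl fun w _ => ?_
    rw [integral_const_mul, smK_eq_integral hl s (z v) (z w), mul_div_assoc]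
  rw [h]
  positivity

end smK

lemma log_kernel_eq_integral {x y : E2} (h : x ≠ y) :
    gfun (x - y) = c0 + ∫ s in Set.Ioi (0 : ℝ), (lensK s x y - stepOne s) / s := by
  have h2 : 0 < dist x y := dist_pos.2 h
  rw [gfun, ← dist_eq_norm, neg_log_eq_integral h2]
  congr 1
  refine setIntegral_congr_fun measurableSet_Ioi fun s hs => ?_
  simp only [lensK_eq_profile (show 0 < s from hs)]

/-- The integrand of the finite-range decomposition, as a function of points and scale. -/
def scaleIntegrand (q : (E2 × E2) × ℝ) : ℝ := (lensK q.2 q.1.1 q.1.2 - stepOne q.2) / q.2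

lemma measurable_scaleIntegrand : Measurable scaleIntegrand := by
  have h0 : Measurable fun q : (E2 × E2) × ℝ => (q.2, q.1) := measurable_snd.prodMk measurable_fst
  have h1 := measurable_lensK.comp h0
  exact (h1.sub (measurable_stepOne.comp measurable_snd)).div measurable_snd

section rep
variable {lam : ℝ} (hl : 0 < lam)
include hl

lemma integral_abs_scaleIntegrand {s : ℝ} (hs : 0 < s) (a b : E2) :
    ∫ p, ‖scaleIntegrand (p, s)‖ ∂((udisc a lam).prod (udisc b lam)) =
      if 1 < s then (1 - smK lam s a b) / s else smK lam s a b / s := by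
  have := isProbabilityMeasure_udisc hl a
  have := isProbabilityMeasure_udisc hl b
  split_ifs with h
  · have h1 : ∀ p : E2 × E2, ‖scaleIntegrand (p, s)‖ = (1 - lensK s p.1 p.2) / s := by
      intro p
      simp only [scaleIntegrand, stepOne, h, if_true]
      rw [norm_div, Real.norm_of_nonneg hs.le, Real.norm_eq_abs, abs_sub_comm,
        abs_of_nonneg (by linarith [lensK_le_one hs p.1 p.2])]
    simp only [h1]
    rw [integral_div, integral_sub (integrable_const 1) (integrable_lensK_udisc hl hs a b)]
    simp [smK]
  · have h1 : ∀ p : E2 × E2, ‖scaleIntegrand (p, s)‖ = lensK s p.1 p.2 / s := by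
      intro p
      simp only [scaleIntegrand, stepOne, h, if_false, sub_zero]
      rw [Real.norm_of_nonneg (div_nonneg (lensK_nonneg _ _ _) hs.le)]
    simp only [h1]
    rw [integral_div]
    rfl

lemma integrable_scaleIntegrand (a b : E2) :
    Integrable scaleIntegrand
      (((udisc a lam).prod (udisc b lam)).prod (volume.restrict (Set.Ioi (0 : ℝ)))) := by
  have := isProbabilityMeasure_udisc hl a
  have := isProbabilityMeasure_udisc hl b
  rw [integrable_prod_iff' measurable_scaleIntegrand.aestronglyMeasurable]
  constructor
  · refine (ae_restrict_iff' measurableSet_Ioi).2 (Filter.Eventually.of_forall fun s hs => ?_)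
    exact ((integrable_lensK_udisc hl hs a b).sub (integrable_const (stepOne s))).div_const s
  · have hm : AEStronglyMeasurable
        (fun s : ℝ => ∫ p, ‖scaleIntegrand (p, s)‖ ∂((udisc a lam).prod (udisc b lam)))
        (volume.restrict (Set.Ioi (0 : ℝ))) :=
      measurable_scaleIntegrand.norm.stronglyMeasurable.integral_prod_left'.aestronglyMeasurable
    have h1 : Set.Ioi (0 : ℝ) = Set.Ioc 0 1 ∪ Set.Ioi 1 :=
      (Set.Ioc_union_Ioi_eq_Ioi zero_le_one).symm
    have hint : IntegrableOn
        (fun s : ℝ => ∫ p, ‖scaleIntegrand (p, s)‖ ∂((udisc a lam).prod (udisc b lam)))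
        (Set.Ioi (0 : ℝ)) := by
      rw [h1]
      rw [h1] at hm
      refine IntegrableOn.union ?_ ?_
      · refine Integrable.mono' (g := fun _ => 4 / lam ^ 2) (by simp)
          (hm.mono_measure (Measure.restrict_mono_set _ Set.subset_union_left)) ?_
        refine (ae_restrict_iff' measurableSet_Ioc).2 (Filter.Eventually.of_forall fun s hs => ?_)
        have hs0 : 0 < s := hs.1
        rw [integral_abs_scaleIntegrand hl hs0, if_neg (by linarith [hs.2]),
          Real.norm_of_nonneg (div_nonneg (smK_nonneg _ _ _) hs0.le), div_le_iff₀ hs0]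
        refine (smK_le hl hs0 a b).trans ?_
        rw [div_mul_eq_mul_div]
        gcongr
        nlinarith [hs.2]
      · refine Integrable.mono' (g := fun s : ℝ => 2 * (dist a b + 2 * lam) / s ^ 2)
          (integrableOn_inv_sq_Ioi one_pos _)
          (hm.mono_measure (Measure.restrict_mono_set _ Set.subset_union_right)) ?_
        refine (ae_restrict_iff' measurableSet_Ioi).2 (Filter.Eventually.of_forall fun s hs => ?_)
        have hs1 : 1 < s := hs
        have hs0 : 0 < s := by linarith
        rw [integral_abs_scaleIntegrand hl hs0, if_pos hs1,
          Real.norm_of_nonneg (div_nonneg (by linarith [smK_le_one hl hs0 a b]) hs0.le),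
          div_le_iff₀ hs0]
        refine (one_sub_smK_le hl hs0 a b).trans (le_of_eq ?_)
        field_simp
    exact hint

lemma integral_scaleIntegrand {s : ℝ} (hs : 0 < s) (a b : E2) :
    ∫ p, scaleIntegrand (p, s) ∂((udisc a lam).prod (udisc b lam)) =
      (smK lam s a b - stepOne s) / s := by
  have := isProbabilityMeasure_udisc hl a
  have := isProbabilityMeasure_udisc hl b
  simp only [scaleIntegrand]
  rw [integral_div, integral_sub (integrable_lensK_udisc hl hs a b) (integrable_const _)]
  simp [smK]

lemma smK_integrableOn (a b : E2) :
    IntegrableOn (fun s => (smK lam s a b - stepOne s) / s) (Set.Ioi 0) := by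
  have := isProbabilityMeasure_udisc hl a
  have := isProbabilityMeasure_udisc hl b
  have h : IntegrableOn (fun s => ∫ p, scaleIntegrand (p, s) ∂((udisc a lam).prod (udisc b lam)))
    (Set.Ioi 0) := (integrable_scaleIntegrand hl a b).integral_prod_right
  exact h.congr_fun (fun s hs => integral_scaleIntegrand hl hs a b) measurableSet_Ioi

lemma gsm_sub_eq (a b : E2) :
    gsm lam (a - b) = c0 + ∫ s in Set.Ioi (0 : ℝ), (smK lam s a b - stepOne s) / s := by
  have hp : ∀ c : E2, IsProbabilityMeasure (udisc c lam) := isProbabilityMeasure_udisc hl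
  have key : ∀ z : E2, gsm lam z =
      c0 + ∫ s in Set.Ioi (0 : ℝ), (smK lam s 0 z - stepOne s) / s := by
    intro z
    have := hp 0
    have := hp z
    have h1 := integrable_scaleIntegrand hl 0 z
    have e1 : ∀ x, ∫ y, gfun (x - y) ∂(udisc z lam) =
        ∫ y, (c0 + ∫ s in Set.Ioi (0 : ℝ), scaleIntegrand ((x, y), s)) ∂(udisc z lam) := by
      intro x
      refine integral_congr_ae ?_
      have : ∀ᵐ y ∂(udisc z lam), y ≠ x := by
        refine (udisc_absolutelyContinuous z lam).ae_le ?_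
        exact Measure.ae_ne volume x
      filter_upwards [this] with y hy
      exact log_kernel_eq_integral hy.symm
    have hG := h1.integral_prod_left
    unfold gsm
    simp only [e1]
    rw [← integral_prod (fun p : E2 × E2 =>
      c0 + ∫ s in Set.Ioi (0 : ℝ), scaleIntegrand (p, s)) ((integrable_const c0).add hG),
      integral_add (integrable_const c0) hG,
      integral_integral_swap (f := fun p s => scaleIntegrand (p, s)) h1]
    simp only [integral_const, probReal_univ, one_smul]
    congr 1
    exact setIntegral_congr_fun measurableSet_Ioi fun s hs => integral_scaleIntegrand hl hs 0 z
  rw [key]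
  congr 1
  refine setIntegral_congr_fun measurableSet_Ioi fun s _ => ?_
  have := smK_translate hl s 0 (a - b) b
  simp only [zero_add, sub_add_cancel] at this
  simp only [← this, smK_comm hl s b a]

end rep

lemma integral_inv_sq_tail {a : ℝ} (ha : 0 < a) (c : ℝ) :
    IntegrableOn ((Set.Ioi a).indicator fun s : ℝ => c / s ^ 2) (Set.Ioi 0) ∧
    ∫ s in Set.Ioi (0 : ℝ), (Set.Ioi a).indicator (fun s : ℝ => c / s ^ 2) s = c / a := by
  constructor
  · rw [IntegrableOn, integrable_indicator_iff measurableSet_Ioi, IntegrableOn,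
      Measure.restrict_restrict measurableSet_Ioi,
      Set.inter_eq_left.2 (Set.Ioi_subset_Ioi ha.le)]
    exact integrableOn_inv_sq_Ioi ha c
  · rw [setIntegral_indicator measurableSet_Ioi, Set.inter_eq_right.2 (Set.Ioi_subset_Ioi ha.le)]
    have h := integral_Ioi_rpow_of_lt (show (-2 : ℝ) < -1 by norm_num) ha
    have h2 : ∫ s in Set.Ioi a, c / s ^ 2 = ∫ s in Set.Ioi a, c * s ^ (-2 : ℝ) := by
      refine setIntegral_congr_fun measurableSet_Ioi fun s hs => ?_
      have hs' : 0 < s := lt_trans ha hs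
      simp only [Real.rpow_neg hs'.le, div_eq_mul_inv]
      norm_cast
    rw [h2, integral_const_mul, h]
    have : a ^ ((-2 : ℝ) + 1) = a⁻¹ := by
      rw [show (-2 : ℝ) + 1 = -1 by norm_num, Real.rpow_neg_one]
    rw [this]
    ring

/-- The scale function `4 s / lam² 1[s ≤ lam] + (1[s > m] - 1[s > 1]) / s`. -/
def selfScale (lam m s : ℝ) : ℝ :=
  (Set.Ioc 0 lam).indicator (fun s => 4 / lam ^ 2 * s) s - (stepOne s - stepOne (m⁻¹ * s)) / s

lemma selfScale_integral {lam m : ℝ} (hl : 0 < lam) (hm : 0 < m) :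
    IntegrableOn (selfScale lam m) (Set.Ioi 0) ∧
    ∫ s in Set.Ioi (0 : ℝ), selfScale lam m s = 2 - Real.log m := by
  have hm' : 0 < m⁻¹ := by positivity
  have h1 : IntegrableOn ((Set.Ioc 0 lam).indicator fun s : ℝ => 4 / lam ^ 2 * s) (Set.Ioi 0) := by
    rw [IntegrableOn, integrable_indicator_iff measurableSet_Ioc, IntegrableOn,
      Measure.restrict_restrict measurableSet_Ioc, Set.inter_eq_left.2 Set.Ioc_subset_Ioi_self]
    exact (Continuous.integrableOn_Ioc (by fun_prop))
  have h2 := (stepOne_sub_integrable hm').integrableOn (s := Set.Ioi 0)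
  refine ⟨h1.sub h2, ?_⟩
  unfold selfScale
  rw [integral_sub h1 h2, stepOne_sub_integral hm', setIntegral_indicator measurableSet_Ioc,
    Set.inter_eq_right.2 Set.Ioc_subset_Ioi_self, ← intervalIntegral.integral_of_le hl.le,
    intervalIntegral.integral_const_mul, integral_id, Real.log_inv]
  field_simp
  ring

lemma stepOne_nonneg (s : ℝ) : 0 ≤ stepOne s := by unfold stepOne; split_ifs <;> norm_num

lemma stepOne_eq_one {s : ℝ} (h : 1 < s) : stepOne s = 1 := if_pos h

lemma mul_selfScale_ge {lam m s : ℝ} (hs : 0 < s) :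
    -stepOne s ≤ s * selfScale lam m s := by
  unfold selfScale
  have h1 : 0 ≤ (Set.Ioc 0 lam).indicator (fun s => 4 / lam ^ 2 * s) s :=
    Set.indicator_nonneg (fun x hx => mul_nonneg (by positivity) hx.1.le) _
  have h2 := stepOne_nonneg (m⁻¹ * s)
  have h3 : s * ((stepOne s - stepOne (m⁻¹ * s)) / s) = stepOne s - stepOne (m⁻¹ * s) := by
    field_simp
  rw [mul_sub, h3]
  have := mul_nonneg hs.le h1
  linarith

lemma smK_sub_step_le_selfScale {lam m s : ℝ} (hl : 0 < lam) (hm : 0 < m) (hs : 0 < s)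
    (h : s ≤ lam ∨ m < s) (a b : E2) :
    smK lam s a b - stepOne s ≤ s * selfScale lam m s := by
  unfold selfScale
  have h3 : s * ((stepOne s - stepOne (m⁻¹ * s)) / s) = stepOne s - stepOne (m⁻¹ * s) := by
    field_simp
  rw [mul_sub, h3]
  rcases h with h | h
  · rw [Set.indicator_of_mem (show s ∈ Set.Ioc 0 lam from ⟨hs, h⟩)]
    have := smK_le hl hs a b
    have h2 := stepOne_nonneg (m⁻¹ * s)
    have : s * (4 / lam ^ 2 * s) = 4 * s ^ 2 / lam ^ 2 := by ring
    linarith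
  · have h1 : 0 ≤ (Set.Ioc 0 lam).indicator (fun s => 4 / lam ^ 2 * s) s :=
      Set.indicator_nonneg (fun x hx => mul_nonneg (by positivity) hx.1.le) _
    have h2 : stepOne (m⁻¹ * s) = 1 := stepOne_eq_one (by
      rw [inv_mul_eq_div, one_lt_div hm]; exact h)
    have := smK_le_one hl hs a b
    have := mul_nonneg hs.le h1
    linarith

lemma gsm_neg {lam : ℝ} (hl : 0 < lam) (z : E2) : gsm lam (-z) = gsm lam z := by
  have h1 := gsm_sub_eq hl 0 z
  have h2 := gsm_sub_eq hl z 0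
  rw [zero_sub] at h1
  rw [sub_zero] at h2
  rw [h1, h2]
  simp only [smK_comm hl _ 0 z]

lemma gsm_le {lam : ℝ} (hl : 0 < lam) (z : E2) : gsm lam z ≤ c0 + 2 - Real.log lam := by
  have h := gsm_sub_eq hl z 0
  rw [sub_zero] at h
  rw [h, add_sub_assoc, ← (selfScale_integral hl hl).2]
  refine add_le_add le_rfl ?_
  refine setIntegral_mono_on (smK_integrableOn hl z 0) (selfScale_integral hl hl).1
    measurableSet_Ioi fun s hs => ?_
  have hs0 : 0 < s := hs
  rw [div_le_iff₀ hs0, mul_comm]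
  exact smK_sub_step_le_selfScale hl hl hs0 (le_or_gt s lam) _ _

lemma gsm_ge {lam : ℝ} (hl : 0 < lam) (z : E2) :
    c0 - 1 - Real.log (2 * (‖z‖ + 2 * lam)) ≤ gsm lam z := by
  set D := 2 * (‖z‖ + 2 * lam) with hD
  have hD0 : 0 < D := by positivity
  have hD' : 0 < D⁻¹ := by positivity
  have h := gsm_sub_eq hl z 0
  rw [sub_zero] at h
  have h1 := integral_inv_sq_tail hD0 D
  have h2 := (stepOne_sub_integrable hD').integrableOn (s := Set.Ioi 0)
  have h3 : ∫ s in Set.Ioi (0 : ℝ), (-((stepOne s - stepOne (D⁻¹ * s)) / s) -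
      (Set.Ioi D).indicator (fun s : ℝ => D / s ^ 2) s) = -1 - Real.log D := by
    rw [integral_sub (f := fun s => -((stepOne s - stepOne (D⁻¹ * s)) / s)) h2.neg h1.1,
      integral_neg, h1.2, stepOne_sub_integral hD', Real.log_inv,
      div_self hD0.ne']
    ring
  have h4 : ∫ s in Set.Ioi (0 : ℝ), (-((stepOne s - stepOne (D⁻¹ * s)) / s) -
      (Set.Ioi D).indicator (fun s : ℝ => D / s ^ 2) s) ≤
      ∫ s in Set.Ioi (0 : ℝ), (smK lam s z 0 - stepOne s) / s := by
    refine setIntegral_mono_on (h2.neg.sub h1.1) (smK_integrableOn hl z 0)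
      measurableSet_Ioi fun s hs => ?_
    have hs0 : 0 < s := hs
    by_cases hsD : D < s
    · rw [Set.indicator_of_mem (show s ∈ Set.Ioi D from hsD),
        stepOne_eq_one (show 1 < D⁻¹ * s by rw [inv_mul_eq_div, one_lt_div hD0]; exact hsD)]
      have h5 := one_sub_smK_le hl hs0 z 0
      rw [dist_zero_right, ← hD] at h5
      have h6 : D / s ^ 2 = (D / s) / s := by rw [div_div, sq]
      rw [h6, ← neg_div, ← sub_div]
      refine div_le_div_of_nonneg_right ?_ hs0.le
      linarith
    · rw [Set.indicator_of_notMem (show s ∉ Set.Ioi D from hsD)]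
      have h7 : stepOne (D⁻¹ * s) = 0 := if_neg (by
        rw [inv_mul_eq_div, one_lt_div hD0]; exact hsD)
      rw [h7, sub_zero, sub_zero, ← neg_div]
      refine div_le_div_of_nonneg_right ?_ hs0.le
      linarith [smK_nonneg (lam := lam) s z 0]
  rw [h]
  linarith

/-- Twice the interaction energy of a charged configuration, without self-interactions. -/
def pairEnergy {ι : Type} [Fintype ι] (lam : ℝ) (d : ι → ℝ) (z : ι → E2) : ℝ :=
  ∑ v, ∑ w ∈ Finset.univ.erase v, d v * d w * gsm lam (z v - z w)

section energy
variable {ι : Type} [Fintype ι] {lam : ℝ} (hl : 0 < lam) {d : ι → ℝ} {z : ι → E2}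
  {p : ι → ι} {R : ι → ℝ} (hd : ∀ v, d v * d v = 1) (hsum : ∑ v, d v = 0)
  (hRp : ∀ v, R (p v) = R v)
  (hRpos : ∀ v, p v ≠ v → 0 < R v)
  (hR : ∀ v w, w ≠ v → w ≠ p v → R v = 0 ∨ 2 * R v + 2 * lam < dist (z v) (z w))

include hd hsum in
lemma sum_erase_mul : ∑ v, ∑ w ∈ Finset.univ.erase v, d v * d w = -(Fintype.card ι : ℝ) := by
  have h : ∀ v, ∑ w ∈ Finset.univ.erase v, d v * d w = -1 := by
    intro v
    rw [← Finset.mul_sum]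
    have := Finset.add_sum_erase Finset.univ d (Finset.mem_univ v)
    rw [hsum] at this
    have h2 : ∑ w ∈ Finset.univ.erase v, d w = -d v := by linarith
    rw [h2]
    linarith [hd v]
  simp [h]

/-- Contribution of a point to the scale-by-scale lower bound of the energy. -/
def pointScale (lam : ℝ) (d : ι → ℝ) (z : ι → E2) (p : ι → ι) (R : ι → ℝ) (v : ι) (s : ℝ) : ℝ :=
  if p v ≠ v ∧ d v * d (p v) = -1 then
    (smK lam s (z v) (z (p v)) - stepOne s) / s +
      (Set.Ioi (R v)).indicator (fun s : ℝ => 2 * (dist (z v) (z (p v)) + 2 * lam) / s ^ 2) s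
  else selfScale lam (max lam (R v)) s

/-- Contribution of a point to the lower bound of the energy. -/
def pointEnergy (lam : ℝ) (d : ι → ℝ) (z : ι → E2) (p : ι → ι) (R : ι → ℝ) (v : ι) : ℝ :=
  if p v ≠ v ∧ d v * d (p v) = -1 then
    gsm lam (z v - z (p v)) + 2 * (dist (z v) (z (p v)) + 2 * lam) / R v
  else c0 + 2 - Real.log (max lam (R v))

omit [Fintype ι] in
include hl hRpos in
lemma pointScale_integral (v : ι) :
    IntegrableOn (pointScale lam d z p R v) (Set.Ioi 0) ∧
    c0 + ∫ s in Set.Ioi (0 : ℝ), pointScale lam d z p R v s = pointEnergy lam d z p R v := by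
  unfold pointScale pointEnergy
  split_ifs with h
  · have h1 := integral_inv_sq_tail (hRpos v h.1) (2 * (dist (z v) (z (p v)) + 2 * lam))
    have h2 := smK_integrableOn hl (z v) (z (p v))
    refine ⟨h2.add h1.1, ?_⟩
    rw [integral_add h2 h1.1, h1.2, gsm_sub_eq hl]
    ring
  · have h1 := selfScale_integral hl (lt_max_of_lt_left hl : 0 < max lam (R v))
    refine ⟨h1.1, ?_⟩
    rw [h1.2]
    ring

omit [Fintype ι] in
include hl hd in
lemma pointScale_lower_bound {s : ℝ} (hs : 0 < s) (v : ι) :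
    -(pointScale lam d z p R v s) * s ≤ (if R v < s then -smK lam s (z v) (z v) else
      if p v ≠ v then d v * d (p v) * smK lam s (z v) (z (p v)) else 0) + stepOne s := by
  unfold pointScale
  split_ifs with h1 h2 h3 h4 h5
  · rw [Set.indicator_of_mem (show s ∈ Set.Ioi (R v) from h2)]
    have h6 := one_sub_smK_le hl hs (z v) (z (p v))
    have h7 := smK_le_one hl hs (z v) (z v)
    have h8 : -((smK lam s (z v) (z (p v)) - stepOne s) / s +
        2 * (dist (z v) (z (p v)) + 2 * lam) / s ^ 2) * s =
        -(smK lam s (z v) (z (p v)) - stepOne s) -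
          2 * (dist (z v) (z (p v)) + 2 * lam) / s := by
      field_simp
      ring
    rw [h8]
    linarith
  · rw [Set.indicator_of_notMem (show s ∉ Set.Ioi (R v) from h2), add_zero, h1.2, neg_mul,
      div_mul_cancel₀ _ hs.ne']
    linarith
  · exact absurd h1.1 h3
  · have := smK_sub_step_le_selfScale hl (lt_max_of_lt_left hl : 0 < max lam (R v)) hs
      (by
        rcases le_or_gt s lam with h | h
        · exact Or.inl h
        · exact Or.inr (max_lt h h4)) (z v) (z v)
    linarith
  · have h6 : d v * d (p v) = 1 := by
      have h7 : d v * d (p v) ≠ -1 := fun h => h1 ⟨h5, h⟩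
      have h8 : (d v * d (p v) - 1) * (d v * d (p v) + 1) = 0 := by
        have := hd v
        have := hd (p v)
        calc _ = (d v * d v) * (d (p v) * d (p v)) - 1 := by ring
          _ = 0 := by rw [hd, hd]; ring
      rcases mul_eq_zero.1 h8 with h | h
      · linarith
      · exact absurd (by linarith) h7
    have := mul_selfScale_ge (lam := lam) (m := max lam (R v)) hs
    have := smK_nonneg (lam := lam) s (z v) (z (p v))
    rw [h6]
    linarith
  · have := mul_selfScale_ge (lam := lam) (m := max lam (R v)) hs
    linarith

include hl hd hRp hR in
lemma scale_lower_bound {s : ℝ} (hs : 0 < s) :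
    -∑ v, pointScale lam d z p R v s ≤
      (∑ v, ∑ w ∈ Finset.univ.erase v, d v * d w * smK lam s (z v) (z w) +
        Fintype.card ι * stepOne s) / s := by
  rw [le_div_iff₀ hs, ← Finset.sum_neg_distrib, Finset.sum_mul]
  refine (Finset.sum_le_sum fun v _ =>
    pointScale_lower_bound (z := z) (p := p) hl hd hs v).trans ?_
  rw [Finset.sum_add_distrib]
  simp only [Finset.sum_const, Finset.card_univ, nsmul_eq_mul]
  refine add_le_add ?_ le_rfl
  set F := Finset.univ.filter fun v => R v < s with hF
  have hzero : ∀ v w, s ≤ R v → w ≠ v → w ≠ p v → smK lam s (z v) (z w) = 0 := by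
    intro v w h1 h2 h3
    refine smK_eq_zero hl ?_
    rcases hR v w h2 h3 with h | h
    · linarith
    · linarith
  rw [← Finset.sum_filter_add_sum_filter_not Finset.univ (fun v => R v < s),
    ← Finset.sum_filter_add_sum_filter_not Finset.univ (fun v => R v < s)
      (fun v => ∑ w ∈ Finset.univ.erase v, _)]
  refine add_le_add ?_ (Finset.sum_le_sum fun v hv => ?_)
  · have h1 : ∀ v ∈ F, ∑ w ∈ Finset.univ.erase v, d v * d w * smK lam s (z v) (z w) =
        ∑ w ∈ F, d v * d w * smK lam s (z v) (z w) - smK lam s (z v) (z v) := by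
      intro v hv
      have h2 : R v < s := (Finset.mem_filter.1 hv).2
      have h3 := Finset.add_sum_erase F (fun w => d v * d w * smK lam s (z v) (z w)) hv
      rw [← h3, hd, one_mul, add_sub_cancel_left]
      symm
      refine Finset.sum_subset (Finset.erase_subset_erase _ (Finset.subset_univ _)) ?_
      intro w hw hwF
      have hwv : w ≠ v := Finset.ne_of_mem_erase hw
      have hw2 : s ≤ R w := by
        by_contra hc
        exact hwF (Finset.mem_erase.2 ⟨hwv, Finset.mem_filter.2 ⟨Finset.mem_univ _, not_le.1 hc⟩⟩)
      have hvp : v ≠ p w := by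
        intro h
        rw [h, hRp] at h2
        linarith
      rw [smK_comm hl, hzero w v hw2 hwv.symm hvp, mul_zero]
    rw [Finset.sum_congr rfl h1, Finset.sum_sub_distrib]
    have h2 := smK_posDef hl s F d z
    have h3 : ∑ v ∈ F, (if R v < s then -smK lam s (z v) (z v) else
        if p v ≠ v then d v * d (p v) * smK lam s (z v) (z (p v)) else 0) =
        -∑ v ∈ F, smK lam s (z v) (z v) := by
      rw [← Finset.sum_neg_distrib]
      exact Finset.sum_congr rfl fun v hv => if_pos (Finset.mem_filter.1 hv).2
    rw [h3]
    linarith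
  · have h2 : ¬ R v < s := (Finset.mem_filter.1 hv).2
    rw [if_neg h2]
    split_ifs with h4
    · refine le_of_eq ?_
      symm
      refine Finset.sum_eq_single_of_mem (p v)
        (Finset.mem_erase.2 ⟨h4, Finset.mem_univ _⟩) fun w hw hwp => ?_
      rw [hzero v w (not_lt.1 h2) (Finset.ne_of_mem_erase hw) hwp, mul_zero]
    · refine le_of_eq ?_
      symm
      refine Finset.sum_eq_zero fun w hw => ?_
      have h5 : p v = v := not_not.1 h4
      have h6 := Finset.ne_of_mem_erase hw
      rw [hzero v w (not_lt.1 h2) h6 (by rwa [h5]), mul_zero]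

include hl hd hsum hRp hRpos hR in
lemma pairEnergy_lower_bound : -∑ v, pointEnergy lam d z p R v ≤ pairEnergy lam d z := by
  have h1 : pairEnergy lam d z = -(Fintype.card ι : ℝ) * c0 + ∫ s in Set.Ioi (0 : ℝ),
      ∑ v, ∑ w ∈ Finset.univ.erase v, d v * d w * ((smK lam s (z v) (z w) - stepOne s) / s) := by
    unfold pairEnergy
    rw [integral_finsetSum _ fun v _ => integrable_finsetSum _ fun w _ =>
      (smK_integrableOn hl (z v) (z w)).const_mul _, ← sum_erase_mul hd hsum, Finset.sum_mul,
      ← Finset.sum_add_distrib]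
    refine Finset.sum_congr rfl fun v _ => ?_
    rw [integral_finsetSum _ fun w _ => (smK_integrableOn hl (z v) (z w)).const_mul _,
      Finset.sum_mul, ← Finset.sum_add_distrib]
    refine Finset.sum_congr rfl fun w _ => ?_
    rw [gsm_sub_eq hl, integral_const_mul]
    ring
  have h2 : -∑ v, pointEnergy lam d z p R v = -(Fintype.card ι : ℝ) * c0 +
      ∫ s in Set.Ioi (0 : ℝ), -∑ v, pointScale lam d z p R v s := by
    rw [integral_neg, integral_finsetSum _ fun v _ => (pointScale_integral hl hRpos v).1]
    simp only [← (pointScale_integral hl hRpos _).2]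
    rw [Finset.sum_add_distrib]
    simp
    ring
  rw [h1, h2]
  refine add_le_add le_rfl ?_
  refine setIntegral_mono_on (integrable_finsetSum _ fun v _ =>
      (pointScale_integral hl hRpos v).1).neg
    (integrable_finsetSum _ fun v _ => integrable_finsetSum _ fun w _ =>
      (smK_integrableOn hl (z v) (z w)).const_mul _) measurableSet_Ioi fun s hs => ?_
  refine (scale_lower_bound hl hd hRp hR hs).trans (le_of_eq ?_)
  have h3 : (Fintype.card ι : ℝ) * stepOne s =
      -∑ v, ∑ w ∈ Finset.univ.erase v, d v * d w * stepOne s := by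
    simp only [← Finset.sum_mul]
    rw [sum_erase_mul hd hsum]
    ring
  rw [h3, ← sub_eq_add_neg, ← Finset.sum_sub_distrib, Finset.sum_div]
  refine Finset.sum_congr rfl fun v _ => ?_
  rw [← Finset.sum_sub_distrib, Finset.sum_div]
  refine Finset.sum_congr rfl fun w _ => ?_
  ring

end energy

section forest
variable {ι : Type} [Fintype ι]

/-- The factor attached to a vertex of a rooted forest: a weight `c v` at a root,
and a kernel `κ v` evaluated at the displacement from the parent otherwise. -/
def forestTerm (par : ι → Option ι) (c : ι → ℝ≥0∞) (κ : ι → E2 → ℝ≥0∞) (z : ι → E2) (v : ι) :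
    ℝ≥0∞ :=
  (par v).elim (c v) fun w => κ v (z v - z w)

/-- The integral bound of `forestTerm`, where `M` is the total mass of the reference measure. -/
def forestMass (par : ι → Option ι) (c : ι → ℝ≥0∞) (κ : ι → E2 → ℝ≥0∞) (M : ℝ≥0∞) (v : ι) :
    ℝ≥0∞ :=
  (par v).elim (c v * M) fun _ => ∫⁻ u, κ v u

variable {par : ι → Option ι} {c : ι → ℝ≥0∞} {κ : ι → E2 → ℝ≥0∞}

omit [Fintype ι] in
lemma measurable_forestTerm (hκ : ∀ v, Measurable (κ v)) (v : ι) :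
    Measurable fun z => forestTerm par c κ z v := by
  unfold forestTerm
  cases par v with
  | none => exact measurable_const
  | some w => exact (hκ v).comp ((measurable_pi_apply v).sub (measurable_pi_apply w))

omit [Fintype ι] in
lemma lintegral_forestTerm_update_le {rank : ι → ℕ}
    (hrank : ∀ v w, par v = some w → rank w < rank v) (B : Set E2) (z : ι → E2) (v : ι) :
    ∫⁻ x, forestTerm par c κ (Function.update z v x) v ∂(volume.restrict B) ≤
      forestMass par c κ (volume B) v := by
  unfold forestTerm forestMass
  cases h : par v with
  | none => simp
  | some w =>
    have hw : w ≠ v := by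
      rintro rfl
      exact lt_irrefl _ (hrank _ _ h)
    simp only [Option.elim_some, Function.update_self, Function.update_of_ne hw]
    calc _ ≤ ∫⁻ x, κ v (x - z w) := lintegral_mono' Measure.restrict_le_self le_rfl
      _ = _ := lintegral_sub_right_eq_self _ _

omit [Fintype ι] in
lemma lmarginal_forest_le {rank : ι → ℕ} (hrank : ∀ v w, par v = some w → rank w < rank v)
    (hκ : ∀ v, Measurable (κ v)) {B : Set E2} (hB : volume B ≠ ⊤) (n : ℕ) :
    ∀ A : Finset ι, A.card = n → ∀ z,
      (∫⋯∫⁻_A, (fun z => ∏ v ∈ A, forestTerm par c κ z v) ∂(fun _ => volume.restrict B)) z ≤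
        ∏ v ∈ A, forestMass par c κ (volume B) v := by
  have : Fact (volume B < ⊤) := ⟨hB.lt_top⟩
  induction n with
  | zero =>
    intro A hA z
    rw [Finset.card_eq_zero] at hA
    subst hA
    simp
  | succ n ih =>
    intro A hA z
    have hne : A.Nonempty := Finset.card_pos.1 (by omega)
    obtain ⟨v, hv, hmax⟩ := Finset.exists_max_image A rank hne
    have hm : ∀ A : Finset ι, Measurable fun z => ∏ v ∈ A, forestTerm par c κ z v := fun A =>
      Finset.measurable_fun_prod A fun v _ => measurable_forestTerm hκ v
    rw [lmarginal_erase' _ (hm A) hv, ← Finset.mul_prod_erase A _ hv]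
    have h1 : (fun x => ∫⁻ xi, (fun z => ∏ v ∈ A, forestTerm par c κ z v) (Function.update x v xi)
        ∂(volume.restrict B)) ≤ fun x => forestMass par c κ (volume B) v *
          ∏ w ∈ A.erase v, forestTerm par c κ x w := by
      intro x
      have h2 : ∀ xi, ∏ w ∈ A, forestTerm par c κ (Function.update x v xi) w =
          forestTerm par c κ (Function.update x v xi) v *
            ∏ w ∈ A.erase v, forestTerm par c κ x w := by
        intro xi
        rw [← Finset.mul_prod_erase A _ hv]
        congr 1
        refine Finset.prod_congr rfl fun w hw => ?_
        unfold forestTerm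
        cases hp : par w with
        | none => rfl
        | some u =>
          have hu : u ≠ v := by
            rintro rfl
            have := hrank _ _ hp
            have := hmax w (Finset.mem_of_mem_erase hw)
            omega
          simp only [Option.elim_some, Function.update_of_ne hu,
            Function.update_of_ne (Finset.ne_of_mem_erase hw)]
      simp only [h2]
      have hmm : Measurable fun xi => forestTerm par c κ (Function.update x v xi) v :=
        (measurable_forestTerm hκ v).comp (measurable_update x)
      rw [lintegral_mul_const _ hmm]
      gcongr
      exact lintegral_forestTerm_update_le hrank B x v
    refine (lmarginal_mono h1 z).trans ?_
    have h3 : (∫⋯∫⁻_A.erase v, (fun x => forestMass par c κ (volume B) v *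
          ∏ w ∈ A.erase v, forestTerm par c κ x w) ∂(fun _ => volume.restrict B)) z =
        forestMass par c κ (volume B) v * (∫⋯∫⁻_A.erase v, (fun x =>
          ∏ w ∈ A.erase v, forestTerm par c κ x w) ∂(fun _ => volume.restrict B)) z := by
      simp only [lmarginal]
      rw [lintegral_const_mul]
      exact (hm _).comp measurable_updateFinset
    rw [h3]
    gcongr
    exact ih _ (by rw [Finset.card_erase_of_mem hv, hA]; rfl) z

/-- Integrating a product of displacement kernels along a rooted forest. -/
lemma lintegral_forest_le {rank : ι → ℕ} (hrank : ∀ v w, par v = some w → rank w < rank v)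
    (hκ : ∀ v, Measurable (κ v)) {B : Set E2} (hB : volume B ≠ ⊤) :
    ∫⁻ z, ∏ v, forestTerm par c κ z v ∂(Measure.pi fun _ : ι => volume.restrict B) ≤
      ∏ v, forestMass par c κ (volume B) v := by
  have := lmarginal_forest_le (c := c) hrank hκ hB _ Finset.univ rfl (fun _ => 0)
  have hF : Fact (volume B < ⊤) := ⟨hB.lt_top⟩
  rwa [lmarginal_univ] at this

end forest

section nearest
variable {ι : Type} [Fintype ι]

/-- `φ` maps each index to its strict nearest neighbour in the configuration `z`. -/
def IsNearest (z : ι → E2) (φ : ι → ι) : Prop :=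
  ∀ v, φ v ≠ v ∧ ∀ w, w ≠ v → w ≠ φ v → dist (z v) (z (φ v)) < dist (z v) (z w)

/-- A mutual pair at distance less than `e₁`, with all other points at distance at least `e₂`. -/
def IsGap (z : ι → E2) (φ : ι → ι) (e₁ e₂ : ℝ) (v : ι) : Prop :=
  φ (φ v) = v ∧ dist (z v) (z (φ v)) < e₁ ∧
    ∀ w, w ≠ v → w ≠ φ v → e₂ ≤ dist (z v) (z w) ∧ e₂ ≤ dist (z (φ v)) (z w)

/-- No point outside `{v, φ v}` is mapped into this pair. -/
def IsIso (φ : ι → ι) (v : ι) : Prop := ∀ k, k ≠ v → k ≠ φ v → φ k ≠ v ∧ φ k ≠ φ v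

/-- A well separated isolated neutral pair. -/
def IsGoodDipole (z : ι → E2) (φ : ι → ι) (d : ι → ℝ) (e₁ e₂ : ℝ) (v : ι) : Prop :=
  IsGap z φ e₁ e₂ v ∧ d v * d (φ v) = -1 ∧ IsIso φ v

/-- A point without close neighbour, or a member of a well separated pair of equal charges. -/
def IsFar (z : ι → E2) (φ : ι → ι) (d : ι → ℝ) (e₁ e₂ : ℝ) (v : ι) : Prop :=
  e₁ ≤ dist (z v) (z (φ v)) ∨ (IsGap z φ e₁ e₂ v ∧ d v * d (φ v) ≠ -1)

variable {z : ι → E2} {φ : ι → ι} {d : ι → ℝ} {e₁ e₂ : ℝ}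

omit [Fintype ι]

lemma IsNearest.dist_lt (h : IsNearest z φ) {v : ι} (hv : φ (φ v) ≠ v) :
    dist (z (φ v)) (z (φ (φ v))) < dist (z v) (z (φ v)) := by
  have := (h (φ v)).2 v (h v).1.symm (Ne.symm hv)
  rwa [dist_comm (z (φ v)) (z v)] at this

lemma IsGap.symm {v : ι} (h : IsGap z φ e₁ e₂ v) : IsGap z φ e₁ e₂ (φ v) := by
  obtain ⟨h1, h2, h3⟩ := h
  refine ⟨by rw [h1], by rwa [h1, dist_comm], fun w hw hw' => ?_⟩
  rw [h1] at hw' ⊢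
  exact (h3 w hw' hw).symm

lemma isIso_symm {v : ι} (hv : φ (φ v) = v) (h : IsIso φ v) : IsIso φ (φ v) := by
  intro k hk hk'
  rw [hv] at hk' ⊢
  exact (h k hk' hk).symm

lemma IsGoodDipole.symm {v : ι} (h : IsGoodDipole z φ d e₁ e₂ v) :
    IsGoodDipole z φ d e₁ e₂ (φ v) := by
  refine ⟨h.1.symm, ?_, isIso_symm h.1.1 h.2.2⟩
  rw [h.1.1, mul_comm]
  exact h.2.1

lemma IsFar.symm {v : ι} (hv : φ (φ v) = v) (h : IsFar z φ d e₁ e₂ v) :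
    IsFar z φ d e₁ e₂ (φ v) := by
  rcases h with h | h
  · left
    rwa [hv, dist_comm]
  · right
    refine ⟨h.1.symm, ?_⟩
    rw [hv, mul_comm]
    exact h.2

lemma IsGoodDipole.not_isFar {v : ι} (h : IsGoodDipole z φ d e₁ e₂ v) :
    ¬ IsFar z φ d e₁ e₂ v := by
  rintro (h1 | h1)
  · exact absurd h.1.2.1 (not_lt.2 h1)
  · exact h1.2 h.2.1

/-- A bounded-degree covering: in a finite `φ`-closed family of pairs, each of which has a
`near` point outside itself, at least half of the pairs have a `near` point outside the half. -/
lemma exists_half_near [Fintype ι] (near : ι → ι → Prop) (C : Finset ι)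
    (hC : ∀ v ∈ C, φ v ∈ C) (hφ : ∀ v ∈ C, φ (φ v) = v)
    (hsymm : ∀ v w, near v w → near w v)
    (hnear : ∀ v ∈ C, ∃ m, m ≠ v ∧ m ≠ φ v ∧ (near v m ∨ near (φ v) m)) :
    ∃ U ⊆ C, (∀ v ∈ U, φ v ∈ U) ∧ C.card ≤ 2 * U.card ∧
      ∀ v ∈ U, ∃ m, m ∉ U ∧ (near v m ∨ near (φ v) m) := by
  let P : Finset ι → Prop := fun U => U ⊆ C ∧ (∀ v ∈ U, φ v ∈ U) ∧
    ∀ v ∈ U, ∀ m ∈ U, m ≠ v → m ≠ φ v → ¬ near v m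
  obtain ⟨U, hU, hmax⟩ : ∃ U, P U ∧ ∀ U', P U' → U'.card ≤ U.card := by
    obtain ⟨U, hU, hmax⟩ := Finset.exists_max_image (Finset.univ.filter P) Finset.card
      ⟨∅, by simp [P]⟩
    refine ⟨U, (Finset.mem_filter.1 hU).2, fun U' h => hmax _ (by simpa using h)⟩
  obtain ⟨hU1, hU2, hU3⟩ := hU
  rcases le_total C.card (2 * U.card) with h | h
  · refine ⟨U, hU1, hU2, h, fun v hv => ?_⟩
    obtain ⟨m, hm1, hm2, hm3⟩ := hnear v (hU1 hv)
    refine ⟨m, fun hm => ?_, hm3⟩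
    rcases hm3 with h3 | h3
    · exact hU3 v hv m hm hm1 hm2 h3
    · refine hU3 _ (hU2 v hv) m hm hm2 ?_ h3
      rwa [hφ v (hU1 hv)]
  · refine ⟨C \ U, Finset.sdiff_subset, ?_, ?_, ?_⟩
    · intro v hv
      rw [Finset.mem_sdiff] at hv ⊢
      refine ⟨hC v hv.1, fun h => hv.2 ?_⟩
      have := hU2 _ h
      rwa [hφ v hv.1] at this
    · have := Finset.card_sdiff_add_card_eq_card hU1
      omega
    · intro v hv
      rw [Finset.mem_sdiff] at hv
      by_contra! hcon
      have hφU : φ v ∉ U := fun h => hv.2 (by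
        have := hU2 _ h
        rwa [hφ v hv.1] at this)
      have hfree : ∀ m ∈ U, ¬ near v m ∧ ¬ near (φ v) m := fun m hm =>
        hcon m (by simp [hm])
      have hP : P (insert v (insert (φ v) U)) := by
        refine ⟨?_, ?_, ?_⟩
        · intro x hx
          simp only [Finset.mem_insert] at hx
          rcases hx with rfl | rfl | hx
          · exact hv.1
          · exact hC _ hv.1
          · exact hU1 hx
        · intro x hx
          simp only [Finset.mem_insert] at hx ⊢
          rcases hx with rfl | rfl | hx
          · simp
          · simp [hφ v hv.1]
          · exact Or.inr (Or.inr (hU2 x hx))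
        · intro x hx m hm h1 h2 h3
          simp only [Finset.mem_insert] at hx hm
          rcases hx with rfl | rfl | hx <;> rcases hm with rfl | rfl | hm
          · exact h1 rfl
          · exact h2 rfl
          · exact (hfree m hm).1 h3
          · exact h2 (hφ _ hv.1).symm
          · exact h1 rfl
          · exact (hfree m hm).2 h3
          · exact (hfree x hx).1 (hsymm _ _ h3)
          · exact (hfree x hx).2 (hsymm _ _ h3)
          · exact hU3 x hx m hm h1 h2 h3
      have := hmax _ hP
      have h4 : U.card < (insert v (insert (φ v) U)).card := by
        refine Finset.card_lt_card ⟨fun x hx => by simp [hx], fun h => hv.2 (h (by simp))⟩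
      omega

/-- A function constant on sums over pairs of an involution. -/
lemma two_mul_sum_involution (S : Finset ι) (hS : ∀ v ∈ S, φ v ∈ S)
    (hφ : ∀ v ∈ S, φ (φ v) = v) (e : ι → ℕ) (a : ℕ) (he : ∀ v ∈ S, e v + e (φ v) = a) :
    2 * ∑ v ∈ S, e v = a * S.card := by
  have h1 : ∑ v ∈ S, e (φ v) = ∑ v ∈ S, e v :=
    Finset.sum_nbij' φ φ hS hS hφ hφ (fun v _ => rfl)
  rw [two_mul]
  nth_rewrite 2 [← h1]
  rw [← Finset.sum_add_distrib, Finset.sum_congr rfl he]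
  simp [mul_comm]

/-- Redistributing the factors of an involution from selected to unselected points. -/
lemma prod_involution (S : Finset ι) (hS : ∀ v ∈ S, φ v ∈ S)
    (hφ : ∀ v ∈ S, φ (φ v) = v) (r : ι → Prop) (hr : ∀ v ∈ S, r v ↔ ¬ r (φ v))
    (a : ι → ℝ≥0∞) :
    ∏ v ∈ S, a v = ∏ v ∈ S, if r v then 1 else a v * a (φ v) := by
  have h1 : ∏ v ∈ S.filter r, a v = ∏ v ∈ S.filter (fun v => ¬ r v), a (φ v) := by
    refine Finset.prod_nbij' φ φ ?_ ?_ ?_ ?_ ?_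
    · intro v hv
      rw [Finset.mem_filter] at hv ⊢
      exact ⟨hS v hv.1, (hr v hv.1).1 hv.2⟩
    · intro v hv
      rw [Finset.mem_filter] at hv ⊢
      refine ⟨hS v hv.1, ?_⟩
      by_contra hc
      exact hv.2 ((hr v hv.1).2 hc)
    · exact fun v hv => hφ v (Finset.mem_filter.1 hv).1
    · exact fun v hv => hφ v (Finset.mem_filter.1 hv).1
    · intro v hv
      rw [hφ v (Finset.mem_filter.1 hv).1]
  rw [← Finset.prod_filter_mul_prod_filter_not S r a, h1, mul_comm, ← Finset.prod_mul_distrib,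
    Finset.prod_filter]
  refine Finset.prod_congr rfl fun v _ => ?_
  by_cases h : r v <;> simp [h]

/-- Any function into a linear order is ranked by natural numbers on a finite type. -/
lemma exists_rank [Fintype ι] {α : Type} [LinearOrder α] (key : ι → α) :
    ∃ rank : ι → ℕ, ∀ v w, key w < key v → rank w < rank v := by
  refine ⟨fun v => (Finset.univ.filter fun x => key x < key v).card, fun v w h => ?_⟩
  refine Finset.card_lt_card ⟨fun x hx => ?_, fun hc => ?_⟩
  · rw [Finset.mem_filter] at hx ⊢
    exact ⟨hx.1, hx.2.trans h⟩
  · have := hc (Finset.mem_filter.2 ⟨Finset.mem_univ w, h⟩)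
    exact lt_irrefl _ (Finset.mem_filter.1 this).2

end nearest

section roles
variable {ι : Type} [Fintype ι]

/-- The role of a vertex in a rooted forest: `inl` for a root (`true`: free, `false`: far),
`inr (k, w)` for a child of `w` attached through the kernel of index `k`. -/
abbrev Role (ι : Type) := Bool ⊕ (Fin 4 × ι)

/-- The factor contributed by a vertex with a given role. -/
def roleTerm (cf : ℝ≥0∞) (κ : Fin 4 → E2 → ℝ≥0∞) (z : ι → E2) (v : ι) : Role ι → ℝ≥0∞
  | .inl b => if b then 1 else cf
  | .inr q => κ q.1 (z v - z q.2)

/-- The exponent of the large parameter in the mass of a role. -/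
def roleLarge : Role ι → ℕ
  | .inl b => if b then 0 else 1
  | .inr q => if q.1 = 0 then 1 else if q.1 = 1 then 2 else 0

/-- The exponent of the small parameter in the mass of a role. -/
def roleSmall : Role ι → ℕ
  | .inl b => if b then 0 else 3
  | .inr q => if q.1 = 0 then 3 else if q.1 = 2 then 6 else 0

/-- The roles form a forest whose exponents on `W` are balanced. -/
def IsBalanced (s : ι → Role ι) (W : Finset ι) : Prop :=
  (∃ rank : ι → ℕ, ∀ v q, s v = .inr q → rank q.2 < rank v) ∧
    ∑ v ∈ W, roleLarge (s v) = W.card ∧ W.card ≤ ∑ v ∈ W, roleSmall (s v)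

variable {z : ι → E2} {φ : ι → ι} {d : ι → ℝ} {e₁ e₂ : ℝ}

/-- A choice of a set `U` of isolated close pairs, of a distinguished point (`rt`) in each mutual
pair, and of a close outer point `m v` for each distinguished point `v` of `U`. -/
structure IsSelection (z : ι → E2) (φ : ι → ι) (far good : ι → Prop) (e₂ : ℝ) (idx : ι → ℕ)
    (U : Finset ι) (rt : ι → Prop) (m : ι → ι) : Prop where
  mem : ∀ v ∈ U, φ (φ v) = v ∧ ¬ far v ∧ ¬ good v ∧ IsIso φ v
  closed : ∀ v ∈ U, φ v ∈ U
  card : (Finset.univ.filter fun v => φ (φ v) = v ∧ ¬ far v ∧ ¬ good v ∧ IsIso φ v).card ≤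
    2 * U.card
  rt_iff : ∀ v, φ (φ v) = v → (rt v ↔ ¬ rt (φ v))
  rt_good : ∀ v, good v → (rt v ↔ idx v < idx (φ v))
  near : ∀ v, v ∈ U → rt v → m v ∉ U ∧ dist (z v) (z (m v)) < e₂

lemma exists_isSelection (h : IsNearest z φ) (idx : ι → ℕ) (hidx : idx.Injective) :
    ∃ U rt m, IsSelection z φ (IsFar z φ d e₁ e₂) (IsGoodDipole z φ d e₁ e₂) e₂ idx U rt m := by
  obtain ⟨U, hUC, hUφ, hUcard, hUnear⟩ := exists_half_near (φ := φ)
    (fun v w => dist (z v) (z w) < e₂)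
    (Finset.univ.filter fun v => φ (φ v) = v ∧ ¬ IsFar z φ d e₁ e₂ v ∧
      ¬ IsGoodDipole z φ d e₁ e₂ v ∧ IsIso φ v)
    (fun v hv => by
      rw [Finset.mem_filter] at hv ⊢
      obtain ⟨-, h1, h2, h3, h4⟩ := hv
      refine ⟨Finset.mem_univ _, by rw [h1], fun hc => h2 ?_, fun hc => h3 ?_, isIso_symm h1 h4⟩
      · have := IsFar.symm (by rw [h1]) hc
        rwa [h1] at this
      · have := IsGoodDipole.symm hc
        rwa [h1] at this)
    (fun v hv => (Finset.mem_filter.1 hv).2.1)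
    (fun v w hvw => by rwa [dist_comm])
    (fun v hv => by
      obtain ⟨-, h1, h2, h3, h4⟩ := Finset.mem_filter.1 hv
      by_contra! hcon
      have hgap : IsGap z φ e₁ e₂ v := by
        refine ⟨h1, ?_, fun w hw hw' => hcon w hw hw'⟩
        by_contra hc
        exact h2 (Or.inl (not_lt.1 hc))
      refine h3 ⟨hgap, ?_, h4⟩
      by_contra hc
      exact h2 (Or.inr ⟨hgap, hc⟩))
  have hUmem : ∀ v ∈ U, φ (φ v) = v ∧ ¬ IsFar z φ d e₁ e₂ v ∧
      ¬ IsGoodDipole z φ d e₁ e₂ v ∧ IsIso φ v := fun v hv => (Finset.mem_filter.1 (hUC hv)).2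
  obtain ⟨pr, hpr⟩ : ∃ pr : ι → Prop, pr = fun v => v ∉ U ∨ ∃ m, m ∉ U ∧ dist (z v) (z m) < e₂ :=
    ⟨_, rfl⟩
  have hpr' : ∀ v, pr v ↔ v ∉ U ∨ ∃ m, m ∉ U ∧ dist (z v) (z m) < e₂ := by simp [hpr]
  have hm : ∀ v, ∃ m, v ∈ U → pr v → m ∉ U ∧ dist (z v) (z m) < e₂ := by
    intro v
    by_cases hv : v ∈ U ∧ pr v
    · obtain ⟨m, hm⟩ := ((hpr' v).1 hv.2).resolve_left (not_not.2 hv.1)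
      exact ⟨m, fun _ _ => hm⟩
    · exact ⟨v, fun h1 h2 => absurd ⟨h1, h2⟩ hv⟩
  choose m hm using hm
  refine ⟨U, fun v => pr v ∧ (¬ pr (φ v) ∨ idx v < idx (φ v)), m, hUmem, hUφ, hUcard, ?_, ?_,
    fun v hv hr => hm v hv hr.1⟩
  · intro v hv
    have h1 : pr v ∨ pr (φ v) := by
      by_cases hU : v ∈ U
      · obtain ⟨m, hm, hm' | hm'⟩ := hUnear v hU
        · exact Or.inl ((hpr' v).2 (Or.inr ⟨m, hm, hm'⟩))
        · exact Or.inr ((hpr' _).2 (Or.inr ⟨m, hm, hm'⟩))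
      · exact Or.inl ((hpr' v).2 (Or.inl hU))
    have h2 : idx v ≠ idx (φ v) := fun hc => (h v).1 (hidx hc).symm
    have h3 : idx v < idx (φ v) ↔ ¬ idx (φ v) < idx v := by omega
    rw [hv]
    tauto
  · intro v hv
    have h1 : ∀ v, IsGoodDipole z φ d e₁ e₂ v → pr v := fun v hv =>
      (hpr' v).2 (Or.inl fun hU => (hUmem v hU).2.2.1 hv)
    have h2 := h1 v hv
    have h3 := h1 _ (IsGoodDipole.symm hv)
    tauto

/-- The role determined by a selection. -/
def roleOf (φ : ι → ι) (far good : ι → Prop) (U : Finset ι) (rt : ι → Prop) (m : ι → ι) (v : ι) :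
    Role ι :=
  if far v then .inl false else if φ (φ v) ≠ v then .inr (0, φ v) else
    if rt v then (if v ∈ U then .inr (2, m v) else .inl true) else
    if good v then .inr (3, φ v) else .inr (1, φ v)

section selection
variable {far good : ι → Prop} {idx : ι → ℕ} {U : Finset ι} {rt : ι → Prop} {m : ι → ι}

omit [Fintype ι]

lemma roleOf_far {v : ι} (hv : far v) : roleOf φ far good U rt m v = .inl false := if_pos hv

lemma roleOf_leaf {v : ι} (hv : ¬ far v) (h : φ (φ v) ≠ v) :
    roleOf φ far good U rt m v = .inr (0, φ v) := by
  rw [roleOf, if_neg hv, if_pos h]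

lemma roleOf_mutual {v : ι} (hv : ¬ far v) (h : φ (φ v) = v) :
    roleOf φ far good U rt m v =
      if rt v then (if v ∈ U then .inr (2, m v) else .inl true) else
      if good v then .inr (3, φ v) else .inr (1, φ v) := by
  rw [roleOf, if_neg hv, if_neg (not_not.2 h)]

lemma IsSelection.exists_rank [Fintype ι] (hs : IsSelection z φ far good e₂ idx U rt m)
    (h : IsNearest z φ) :
    ∃ rank : ι → ℕ, ∀ v q, roleOf φ far good U rt m v = .inr q → rank q.2 < rank v := by
  obtain ⟨key, hkey⟩ : ∃ key : ι → ℕ ×ₗ (ℝ ×ₗ ℕ), ∀ v, key v =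
      toLex (if v ∈ U then 1 else 0, toLex (dist (z v) (z (φ v)), if rt v then 0 else 1)) :=
    ⟨_, fun v => rfl⟩
  obtain ⟨rank, hrank⟩ := _root_.exists_rank key
  refine ⟨rank, fun v q hq => hrank _ _ ?_⟩
  by_cases hv : far v
  · simp [roleOf_far hv] at hq
  by_cases hφ : φ (φ v) = v
  · have hUeq : φ v ∈ U ↔ v ∈ U := ⟨fun hc => by
      have := hs.closed _ hc
      rwa [hφ] at this, hs.closed v⟩
    have hpair : ¬ rt v → key (φ v) < key v := by
      intro hr
      have hr' : rt (φ v) := by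
        by_contra hc
        exact hr ((hs.rt_iff v hφ).2 hc)
      rw [hkey, hkey, Prod.Lex.toLex_lt_toLex]
      right
      refine ⟨by simp [hUeq], ?_⟩
      rw [Prod.Lex.toLex_lt_toLex]
      right
      refine ⟨by rw [hφ, dist_comm], ?_⟩
      simp [hr, hr']
    rw [roleOf_mutual hv hφ] at hq
    split_ifs at hq with h1 h2 h3
    · cases hq
      have := (hs.near v h2 h1).1
      rw [hkey, hkey, Prod.Lex.toLex_lt_toLex]
      left
      simp [this, h2]
    · cases hq
      exact hpair h1
    · cases hq
      exact hpair h1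
  · rw [roleOf_leaf hv hφ] at hq
    cases hq
    have hv1 : v ∉ U := fun hc => hφ (hs.mem v hc).1
    have hv2 : φ v ∉ U := fun hc =>
      ((hs.mem _ hc).2.2.2 v (h v).1.symm (fun hh => hφ hh.symm)).1 rfl
    rw [hkey, hkey, Prod.Lex.toLex_lt_toLex]
    right
    refine ⟨by simp [hv1, hv2], ?_⟩
    rw [Prod.Lex.toLex_lt_toLex]
    left
    exact h.dist_lt hφ

end selection

end roles

section balanced
variable {ι : Type} [Fintype ι] {z : ι → E2} {φ : ι → ι} {d : ι → ℝ} {e₁ e₂ : ℝ}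
  {idx : ι → ℕ} {U : Finset ι} {rt : ι → Prop} {m : ι → ι}

lemma IsSelection.isBalanced
    (hs : IsSelection z φ (IsFar z φ d e₁ e₂) (IsGoodDipole z φ d e₁ e₂) e₂ idx U rt m)
    (h : IsNearest z φ) :
    IsBalanced (roleOf φ (IsFar z φ d e₁ e₂) (IsGoodDipole z φ d e₁ e₂) U rt m)
      (Finset.univ.filter fun v => ¬ IsGoodDipole z φ d e₁ e₂ v) := by
  refine ⟨hs.exists_rank h, ?_⟩
  have hsym : ∀ v, φ (φ v) = v → ¬ IsFar z φ d e₁ e₂ v → ¬ IsFar z φ d e₁ e₂ (φ v) := by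
    intro v hv h1 hc
    have := IsFar.symm (by rw [hv]) hc
    rw [hv] at this
    exact h1 this
  have gsym : ∀ v, φ (φ v) = v → ¬ IsGoodDipole z φ d e₁ e₂ v →
      ¬ IsGoodDipole z φ d e₁ e₂ (φ v) := by
    intro v hv h1 hc
    have := IsGoodDipole.symm hc
    rw [hv] at this
    exact h1 this
  generalize hW : (Finset.univ.filter fun v => ¬ IsGoodDipole z φ d e₁ e₂ v) = W
  set s := roleOf φ (IsFar z φ d e₁ e₂) (IsGoodDipole z φ d e₁ e₂) U rt m with hsdef
  have hWm : ∀ v, v ∈ W ↔ ¬ IsGoodDipole z φ d e₁ e₂ v := fun v => by simp [← hW]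
  have hs1 : ∀ v, ¬ IsGoodDipole z φ d e₁ e₂ v → φ (φ v) = v → ¬ IsFar z φ d e₁ e₂ v → s v =
      if rt v then (if v ∈ U then .inr (2, m v) else .inl true) else .inr (1, φ v) := by
    intro v h1 h2 h3
    rw [hsdef, roleOf_mutual h3 h2, if_neg h1]
  obtain ⟨W₁, hW₁⟩ : ∃ W₁, W.filter (fun v => φ (φ v) = v ∧ ¬ IsFar z φ d e₁ e₂ v) = W₁ :=
    ⟨_, rfl⟩
  obtain ⟨W₂, hW₂⟩ : ∃ W₂, W.filter (fun v => ¬ (φ (φ v) = v ∧ ¬ IsFar z φ d e₁ e₂ v)) = W₂ :=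
    ⟨_, rfl⟩
  have hm1 : ∀ v, v ∈ W₁ ↔ ¬ IsGoodDipole z φ d e₁ e₂ v ∧ φ (φ v) = v ∧
      ¬ IsFar z φ d e₁ e₂ v := fun v => by rw [← hW₁, Finset.mem_filter, hWm]
  have hm2 : ∀ v, v ∈ W₂ ↔ ¬ IsGoodDipole z φ d e₁ e₂ v ∧ ¬ (φ (φ v) = v ∧
      ¬ IsFar z φ d e₁ e₂ v) := fun v => by rw [← hW₂, Finset.mem_filter, hWm]
  have hcard : W.card = W₁.card + W₂.card := by
    rw [← hW₁, ← hW₂, Finset.card_filter_add_card_filter_not]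
  have hsum : ∀ f : ι → ℕ, ∑ v ∈ W, f v = ∑ v ∈ W₁, f v + ∑ v ∈ W₂, f v := fun f => by
    rw [← hW₁, ← hW₂, Finset.sum_filter_add_sum_filter_not]
  have h2role : ∀ v ∈ W₂, roleLarge (s v) = 1 ∧ roleSmall (s v) = 3 := by
    intro v hv
    obtain ⟨h1, h2⟩ := (hm2 v).1 hv
    by_cases hf : IsFar z φ d e₁ e₂ v
    · rw [hsdef, roleOf_far hf]
      simp [roleLarge, roleSmall]
    · rw [hsdef, roleOf_leaf hf (fun hc => h2 ⟨hc, hf⟩)]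
      simp [roleLarge, roleSmall]
  have h1closed : ∀ v ∈ W₁, φ v ∈ W₁ := fun v hv => by
    obtain ⟨a, b, c⟩ := (hm1 v).1 hv
    exact (hm1 _).2 ⟨gsym v b a, by rw [b], hsym v b c⟩
  have hA := two_mul_sum_involution (φ := φ) W₁ h1closed (fun v hv => ((hm1 v).1 hv).2.1)
    (fun v => roleLarge (s v)) 2 (by
      intro v hv
      obtain ⟨a, b, c⟩ := (hm1 v).1 hv
      obtain ⟨a', b', c'⟩ := (hm1 _).1 (h1closed v hv)
      have hr := hs.rt_iff v b
      rw [hs1 v a b c, hs1 (φ v) a' b' c']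
      by_cases hr1 : rt v
      · have hr2 := hr.1 hr1
        split_ifs <;> simp [roleLarge]
      · have hr2 : rt (φ v) := by tauto
        rw [if_neg hr1, if_pos hr2]
        split_ifs <;> simp [roleLarge])
  have hB := two_mul_sum_involution (φ := φ) U hs.closed (fun v hv => (hs.mem v hv).1)
    (fun v => roleSmall (s v)) 6 (by
      intro v hv
      obtain ⟨b, c, a, -⟩ := hs.mem v hv
      obtain ⟨b', c', a', -⟩ := hs.mem _ (hs.closed v hv)
      have hr := hs.rt_iff v b
      rw [hs1 v a b c, hs1 (φ v) a' b' c', if_pos hv, if_pos (hs.closed v hv)]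
      by_cases hr1 : rt v
      · simp [roleSmall, hr1, hr.1 hr1]
      · have hr2 : rt (φ v) := by tauto
        simp [roleSmall, hr1, hr2])
  have hUW : U ⊆ W₁ := fun v hv => by
    obtain ⟨b, c, a, -⟩ := hs.mem v hv
    exact (hm1 v).2 ⟨a, b, c⟩
  have hC : ∑ v ∈ U, roleSmall (s v) ≤ ∑ v ∈ W₁, roleSmall (s v) :=
    Finset.sum_le_sum_of_subset hUW
  have hD : (W₁.filter fun v => ¬ IsIso φ v).card ≤ 2 * W₂.card := by
    have hk : ∀ v, ∃ k, v ∈ W₁ → ¬ IsIso φ v → k ∈ W₂ ∧ (v = φ k ∨ v = φ (φ k)) := by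
      intro v
      by_cases hv : v ∈ W₁ ∧ ¬ IsIso φ v
      · obtain ⟨hv, hi⟩ := hv
        obtain ⟨a, b, c⟩ := (hm1 v).1 hv
        unfold IsIso at hi
        push Not at hi
        obtain ⟨k, hk1, hk2, hk3⟩ := hi
        refine ⟨k, fun _ _ => ?_⟩
        have hk4 : φ k = v ∨ φ k = φ v := by tauto
        have hk5 : φ (φ k) ≠ k := by
          rcases hk4 with hk4 | hk4
          · rw [hk4]
            exact hk2.symm
          · rw [hk4, b]
            exact hk1.symm
        refine ⟨(hm2 k).2 ⟨fun hc => hk5 hc.1.1, fun hc => hk5 hc.1⟩, ?_⟩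
        rcases hk4 with hk4 | hk4
        · exact Or.inl hk4.symm
        · exact Or.inr (by rw [hk4, b])
      · exact ⟨v, fun h1 h2 => absurd ⟨h1, h2⟩ hv⟩
    choose k hk using hk
    refine Finset.card_le_mul_card_image_of_maps_to (f := k) ?_ 2 ?_
    · intro v hv
      rw [Finset.mem_filter] at hv
      exact (hk v hv.1 hv.2).1
    · intro b hb
      refine (Finset.card_le_card (t := {φ b, φ (φ b)}) ?_).trans Finset.card_le_two
      intro v hv
      rw [Finset.mem_filter, Finset.mem_filter] at hv
      obtain ⟨⟨h1, h2⟩, rfl⟩ := hv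
      have := (hk v h1 h2).2
      simpa using this
  have hE : (W₁.filter fun v => IsIso φ v).card ≤ 2 * U.card := by
    refine le_trans (Finset.card_le_card fun v hv => ?_) hs.card
    rw [Finset.mem_filter] at hv ⊢
    obtain ⟨a, b, c⟩ := (hm1 v).1 hv.1
    exact ⟨Finset.mem_univ _, b, c, a, hv.2⟩
  have hF := Finset.card_filter_add_card_filter_not (s := W₁) (fun v => IsIso φ v)
  have h3 : ∑ v ∈ W₂, roleLarge (s v) = W₂.card := by
    rw [Finset.sum_congr rfl fun v hv => (h2role v hv).1]
    simp
  have h4 : ∑ v ∈ W₂, roleSmall (s v) = 3 * W₂.card := by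
    rw [Finset.sum_congr rfl fun v hv => (h2role v hv).2]
    simp [mul_comm]
  rw [hsum, hsum, hcard, h3, h4]
  constructor <;> omega

lemma exists_roles (h : IsNearest z φ) (idx : ι → ℕ) (hidx : idx.Injective)
    (a : ι → ℝ≥0∞) (cf : ℝ≥0∞) (κ : Fin 4 → E2 → ℝ≥0∞)
    (hfar : ∀ v, IsFar z φ d e₁ e₂ v → a v ≤ cf)
    (hleaf : ∀ v, ¬ IsFar z φ d e₁ e₂ v → ¬ IsGoodDipole z φ d e₁ e₂ v →
      a v ≤ κ 0 (z v - z (φ v)))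
    (hcore : ∀ v, ¬ IsFar z φ d e₁ e₂ v → ¬ IsGoodDipole z φ d e₁ e₂ v → φ (φ v) = v →
      a v * a (φ v) ≤ κ 1 (z v - z (φ v)))
    (hnear : ∀ v m, dist (z v) (z m) < e₂ → 1 ≤ κ 2 (z v - z m))
    (hgood : ∀ v, IsGoodDipole z φ d e₁ e₂ v → a v * a (φ v) ≤ κ 3 (z v - z (φ v))) :
    ∃ s : ι → Role ι,
      (∀ v, IsGoodDipole z φ d e₁ e₂ v →
        s v = if idx v < idx (φ v) then .inl true else .inr (3, φ v)) ∧
      (∀ v, ¬ IsGoodDipole z φ d e₁ e₂ v → ∀ w, s v ≠ .inr (3, w)) ∧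
      IsBalanced s (Finset.univ.filter fun v => ¬ IsGoodDipole z φ d e₁ e₂ v) ∧
      ∏ v, a v ≤ ∏ v, roleTerm cf κ z v (s v) := by
  obtain ⟨U, rt, m, hs⟩ := exists_isSelection (d := d) (e₁ := e₁) (e₂ := e₂) h idx hidx
  refine ⟨_, ?_, ?_, hs.isBalanced h, ?_⟩
  · intro v hv
    rw [roleOf_mutual hv.not_isFar hv.1.1]
    have hU : v ∉ U := fun hc => (hs.mem v hc).2.2.1 hv
    simp only [hs.rt_good v hv, hU, hv, if_true, if_false]
  · intro v hv w
    unfold roleOf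
    split_ifs <;> simp
  · obtain ⟨S, hS⟩ : ∃ S, Finset.univ.filter
        (fun v => φ (φ v) = v ∧ ¬ IsFar z φ d e₁ e₂ v) = S := ⟨_, rfl⟩
    have hSm : ∀ v, v ∈ S ↔ φ (φ v) = v ∧ ¬ IsFar z φ d e₁ e₂ v := fun v => by simp [← hS]
    rw [← Finset.prod_mul_prod_compl S a, ← Finset.prod_mul_prod_compl S]
    refine mul_le_mul' ?_ (Finset.prod_le_prod' fun v hv => ?_)
    · rw [prod_involution (φ := φ) S ?_ (fun v hv => ((hSm v).1 hv).1) rt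
        (fun v hv => hs.rt_iff v ((hSm v).1 hv).1)]
      · refine Finset.prod_le_prod' fun v hv => ?_
        obtain ⟨h1, h2⟩ := (hSm v).1 hv
        rw [roleOf_mutual h2 h1]
        by_cases hr : rt v
        · by_cases hU : v ∈ U
          · simp only [hr, hU, if_true, roleTerm]
            exact hnear v (m v) (hs.near v hU hr).2
          · simp [hr, hU, roleTerm]
        · by_cases hg : IsGoodDipole z φ d e₁ e₂ v
          · simp only [hr, hg, if_true, if_false, roleTerm]
            exact hgood v hg
          · simp only [hr, hg, if_false, roleTerm]
            exact hcore v h2 hg h1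
      · intro v hv
        obtain ⟨h1, h2⟩ := (hSm v).1 hv
        refine (hSm _).2 ⟨by rw [h1], fun hc => h2 ?_⟩
        have := IsFar.symm (by rw [h1]) hc
        rwa [h1] at this
    · rw [Finset.mem_compl, hSm] at hv
      by_cases hf : IsFar z φ d e₁ e₂ v
      · rw [roleOf_far hf]
        simpa [roleTerm] using hfar v hf
      · have hφ : φ (φ v) ≠ v := fun hc => hv ⟨hc, hf⟩
        rw [roleOf_leaf hf hφ]
        exact hleaf v hf (fun hc => hφ hc.1.1)

end balanced

lemma measurable_gsm {lam : ℝ} (hl : 0 < lam) : Measurable (gsm lam) := by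
  have hp := isProbabilityMeasure_udisc hl (0 : E2)
  have h1 : gsm lam = fun z => ∫ x, (∫ y, gfun (x - (y + z)) ∂(udisc 0 lam)) ∂(udisc 0 lam) := by
    funext z
    unfold gsm
    refine integral_congr_ae (Filter.Eventually.of_forall fun x => ?_)
    have := integral_udisc_translate 0 lam z (fun y => gfun (x - y))
    simp only [zero_add] at this
    exact this
  have hg : Measurable gfun := (Real.measurable_log.comp measurable_norm).neg
  have h2 : StronglyMeasurable fun q : (E2 × E2) × E2 => gfun (q.1.2 - (q.2 + q.1.1)) :=
    (hg.comp (by fun_prop)).stronglyMeasurable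
  have h3 : StronglyMeasurable fun q : E2 × E2 => ∫ y, gfun (q.2 - (y + q.1)) ∂(udisc 0 lam) :=
    h2.integral_prod_right'
  rw [h1]
  exact (h3.integral_prod_right').measurable

section weights
variable {ι : Type} [Fintype ι]

/-- The Boltzmann weight of a point with a self-energy cutoff `r`. -/
def cutWeight (β r : ℝ) : ℝ≥0∞ := ENNReal.ofReal (Real.exp (β / 2 * (c0 + 2 - Real.log r)))

/-- The four displacement kernels: leaf, close pair, proximity, dipole. -/
def roleKernel (β lam e₁ e₂ : ℝ) (k : Fin 4) (u : E2) : ℝ≥0∞ :=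
  if k = 0 then (Metric.ball 0 e₁).indicator (fun u => cutWeight β (max lam (‖u‖ / 4))) u else
  if k = 1 then (Metric.ball 0 e₁).indicator (fun u => cutWeight β (max lam (‖u‖ / 4)) ^ 2) u else
  if k = 2 then (Metric.ball 0 e₂).indicator (fun _ => 1) u else
  (Metric.ball 0 e₁).indicator
    (fun u => ENNReal.ofReal (Real.exp (β * (12 * (e₁ / e₂)))) *
      ENNReal.ofReal (Real.exp (β * gsm lam u))) u

lemma measurable_cutWeight (β : ℝ) : Measurable (cutWeight β) := by
  unfold cutWeight
  fun_prop

lemma measurable_roleKernel {β lam e₁ e₂ : ℝ} (hl : 0 < lam) (k : Fin 4) :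
    Measurable (roleKernel β lam e₁ e₂ k) := by
  have h1 : Measurable fun u : E2 => cutWeight β (max lam (‖u‖ / 4)) :=
    (measurable_cutWeight β).comp (by fun_prop)
  have h2 := measurable_gsm hl
  unfold roleKernel
  by_cases hk0 : k = 0
  · simp only [hk0, if_true]
    exact h1.indicator measurableSet_ball
  by_cases hk1 : k = 1
  · simp only [hk1, if_true, if_neg (one_ne_zero : (1 : Fin 4) ≠ 0)]
    exact (h1.pow_const 2).indicator measurableSet_ball
  by_cases hk2 : k = 2
  · simp only [hk0, hk1, if_false, if_pos hk2]
    exact measurable_const.indicator measurableSet_ball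
  · simp only [hk0, hk1, if_false, if_neg hk2]
    refine Measurable.indicator ?_ measurableSet_ball
    fun_prop

variable {z : ι → E2} {φ : ι → ι} {d : ι → ℝ} {e₁ e₂ β lam : ℝ}

lemma exists_roles_energy (h : IsNearest z φ) (hl : 0 < lam) (hβ : 0 ≤ β) (h1 : 4 * lam < e₁)
    (h2 : e₁ ≤ e₂) (hd : ∀ v, d v * d v = 1) (hsum : ∑ v, d v = 0)
    (idx : ι → ℕ) (hidx : idx.Injective) :
    ∃ s : ι → Role ι,
      (∀ v, IsGoodDipole z φ d e₁ e₂ v →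
        s v = if idx v < idx (φ v) then .inl true else .inr (3, φ v)) ∧
      (∀ v, ¬ IsGoodDipole z φ d e₁ e₂ v → ∀ w, s v ≠ .inr (3, w)) ∧
      IsBalanced s (Finset.univ.filter fun v => ¬ IsGoodDipole z φ d e₁ e₂ v) ∧
      ENNReal.ofReal (Real.exp (-(β / 2) * pairEnergy lam d z)) ≤
        ∏ v, roleTerm (cutWeight β (e₁ / 4)) (roleKernel β lam e₁ e₂) z v (s v) := by
  have hd' : ∀ v w, d v * d w = -1 ∨ d v * d w = 1 := by
    intro v w
    have h8 : (d v * d w - 1) * (d v * d w + 1) = 0 := by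
      calc _ = (d v * d v) * (d w * d w) - 1 := by ring
        _ = 0 := by rw [hd, hd]; ring
    rcases mul_eq_zero.1 h8 with h | h
    · right; linarith
    · left; linarith
  let p : ι → ι := fun v => if IsGap z φ e₁ e₂ v ∧
    (IsGoodDipole z φ d e₁ e₂ v ∨ d v * d (φ v) ≠ -1) then φ v else v
  let R : ι → ℝ := fun v => if IsGap z φ e₁ e₂ v ∧
    (IsGoodDipole z φ d e₁ e₂ v ∨ d v * d (φ v) ≠ -1) then e₂ / 4 else
    if 4 * lam < dist (z v) (z (φ v)) then dist (z v) (z (φ v)) / 4 else 0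
  have hsp : ∀ v, IsGap z φ e₁ e₂ v ∧ (IsGoodDipole z φ d e₁ e₂ v ∨ d v * d (φ v) ≠ -1) →
      IsGap z φ e₁ e₂ (φ v) ∧
        (IsGoodDipole z φ d e₁ e₂ (φ v) ∨ d (φ v) * d (φ (φ v)) ≠ -1) := by
    rintro v ⟨ha, hb⟩
    refine ⟨ha.symm, ?_⟩
    rcases hb with hb | hb
    · exact Or.inl hb.symm
    · right
      rwa [ha.1, mul_comm]
  have hmain := pairEnergy_lower_bound (lam := lam) hl (d := d) (z := z) (p := p) (R := R) hd hsum
    (by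
      intro v
      by_cases hv : IsGap z φ e₁ e₂ v ∧ (IsGoodDipole z φ d e₁ e₂ v ∨ d v * d (φ v) ≠ -1)
      · simp only [p, if_pos hv]
        simp only [R, if_pos hv, if_pos (hsp v hv)]
      · simp only [p, if_neg hv])
    (by
      intro v hpv
      by_cases hv : IsGap z φ e₁ e₂ v ∧ (IsGoodDipole z φ d e₁ e₂ v ∨ d v * d (φ v) ≠ -1)
      · simp only [R, if_pos hv]
        linarith
      · simp only [p, if_neg hv] at hpv
        exact absurd rfl hpv)
    (by
      intro v w hw hwp
      by_cases hv : IsGap z φ e₁ e₂ v ∧ (IsGoodDipole z φ d e₁ e₂ v ∨ d v * d (φ v) ≠ -1)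
      · right
        simp only [p, if_pos hv] at hwp
        have := (hv.1.2.2 w hw hwp).1
        simp only [R, if_pos hv]
        linarith
      · simp only [R, if_neg hv]
        split_ifs with h5
        · right
          have : dist (z v) (z (φ v)) ≤ dist (z v) (z w) := by
            by_cases h6 : w = φ v
            · rw [h6]
            · exact ((h v).2 w hw h6).le
          linarith
        · left; rfl)
  obtain ⟨E, hE⟩ : ∃ E, E = pointEnergy lam d z p R := ⟨_, rfl⟩
  rw [← hE] at hmain
  have hfarE : ∀ v, IsFar z φ d e₁ e₂ v → E v ≤ c0 + 2 - Real.log (e₁ / 4) := by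
    intro v hv
    have key : E v = c0 + 2 - Real.log (max lam (R v)) ∧ e₁ / 4 ≤ R v := by
      rw [hE]
      unfold pointEnergy
      rcases hv with hv | ⟨hv1, hv2⟩
      · have hg : ¬ (IsGap z φ e₁ e₂ v ∧
          (IsGoodDipole z φ d e₁ e₂ v ∨ d v * d (φ v) ≠ -1)) := fun hc =>
          absurd hc.1.2.1 (not_lt.2 hv)
        have hp : p v = v := by simp only [p, if_neg hg]
        rw [if_neg (by rw [hp]; simp)]
        refine ⟨rfl, ?_⟩
        simp only [R, if_neg hg]
        rw [if_pos (by linarith)]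
        linarith
      · have hp : p v = φ v := by simp only [p, if_pos (And.intro hv1 (Or.inr hv2))]
        rw [if_neg (by rw [hp]; exact fun hc => hv2 hc.2)]
        refine ⟨rfl, ?_⟩
        simp only [R, if_pos (And.intro hv1 (Or.inr hv2))]
        linarith
    rw [key.1]
    have := Real.log_le_log (by linarith) (key.2.trans (le_max_right lam (R v)))
    linarith
  have hcutE : ∀ v, ¬ IsFar z φ d e₁ e₂ v → ¬ IsGoodDipole z φ d e₁ e₂ v →
      E v ≤ c0 + 2 - Real.log (max lam (‖z v - z (φ v)‖ / 4)) := by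
    intro v hv1 hv2
    have hg : ¬ (IsGap z φ e₁ e₂ v ∧
        (IsGoodDipole z φ d e₁ e₂ v ∨ d v * d (φ v) ≠ -1)) := fun hc =>
      hc.2.elim hv2 fun hc2 => hv1 (Or.inr ⟨hc.1, hc2⟩)
    have hp : p v = v := by simp only [p, if_neg hg]
    rw [hE]
    unfold pointEnergy
    rw [if_neg (by rw [hp]; simp)]
    simp only [R, if_neg hg, ← dist_eq_norm]
    split_ifs with h5
    · exact le_rfl
    · rw [max_eq_left hl.le, max_eq_left (by linarith)]
  have hgoodE : ∀ v, IsGoodDipole z φ d e₁ e₂ v →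
      E v ≤ gsm lam (z v - z (φ v)) + 12 * (e₁ / e₂) := by
    intro v hv
    have hg : IsGap z φ e₁ e₂ v ∧ (IsGoodDipole z φ d e₁ e₂ v ∨ d v * d (φ v) ≠ -1) :=
      ⟨hv.1, Or.inl hv⟩
    have hp : p v = φ v := by simp only [p, if_pos hg]
    have hR : R v = e₂ / 4 := by simp only [R, if_pos hg]
    have he2 : 0 < e₂ := by linarith
    rw [hE]
    unfold pointEnergy
    rw [hp, hR, if_pos ⟨(h v).1, hv.2.1⟩]
    have := hv.1.2.1
    refine add_le_add le_rfl ?_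
    rw [← mul_div_assoc, div_le_div_iff₀ (by linarith) he2]
    nlinarith
  clear_value p R
  clear hE
  obtain ⟨s, hs1, hs2, hs3, hs4⟩ := exists_roles (d := d) (e₁ := e₁) (e₂ := e₂) h idx hidx
    (fun v => ENNReal.ofReal (Real.exp (β / 2 * E v))) (cutWeight β (e₁ / 4))
    (roleKernel β lam e₁ e₂)
    (fun v hv => by
      unfold cutWeight
      have := hfarE v hv
      gcongr)
    (fun v hv hv' => by
      have h3 := hcutE v hv hv'
      have h4 : z v - z (φ v) ∈ Metric.ball 0 e₁ := by
        rw [mem_ball_zero_iff, ← dist_eq_norm]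
        by_contra hc
        exact hv (Or.inl (not_lt.1 hc))
      simp only [roleKernel, if_true, Set.indicator_of_mem h4]
      unfold cutWeight
      gcongr)
    (fun v hv hv' hm => by
      have h3 := hcutE v hv hv'
      have h3' := hcutE (φ v) (fun hc => hv (by
        have := IsFar.symm (by rw [hm]) hc
        rwa [hm] at this)) (fun hc => hv' (by
        have := IsGoodDipole.symm hc
        rwa [hm] at this))
      rw [hm, ← norm_neg, neg_sub] at h3'
      have h4 : z v - z (φ v) ∈ Metric.ball 0 e₁ := by
        rw [mem_ball_zero_iff, ← dist_eq_norm]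
        by_contra hc
        exact hv (Or.inl (not_lt.1 hc))
      simp only [roleKernel, if_true, if_neg (one_ne_zero : (1 : Fin 4) ≠ 0),
        Set.indicator_of_mem h4]
      unfold cutWeight
      rw [sq]
      gcongr)
    (fun v m hvm => by
      have h4 : z v - z m ∈ Metric.ball 0 e₂ := by
        rwa [mem_ball_zero_iff, ← dist_eq_norm]
      simp [roleKernel, Set.indicator_of_mem h4])
    (fun v hv => by
      have h3 := hgoodE v hv
      have h3' := hgoodE (φ v) hv.symm
      rw [hv.1.1, ← neg_sub, gsm_neg hl] at h3'
      have h4 : z v - z (φ v) ∈ Metric.ball 0 e₁ := by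
        rw [mem_ball_zero_iff, ← dist_eq_norm]
        exact hv.1.2.1
      have h5 : roleKernel β lam e₁ e₂ 3 (z v - z (φ v)) =
          ENNReal.ofReal (Real.exp (β * (12 * (e₁ / e₂)))) *
            ENNReal.ofReal (Real.exp (β * gsm lam (z v - z (φ v)))) := by
        simp [roleKernel, Set.indicator_of_mem h4]
      rw [h5, ← ENNReal.ofReal_mul (Real.exp_pos _).le, ← ENNReal.ofReal_mul (Real.exp_pos _).le,
        ← Real.exp_add, ← Real.exp_add]
      apply ENNReal.ofReal_le_ofReal
      apply Real.exp_le_exp.2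
      nlinarith)
  refine ⟨s, hs1, hs2, hs3, le_trans ?_ hs4⟩
  rw [← ENNReal.ofReal_prod_of_nonneg fun v _ => (Real.exp_pos _).le, ← Real.exp_sum,
    ← Finset.mul_sum]
  apply ENNReal.ofReal_le_ofReal
  apply Real.exp_le_exp.2
  nlinarith

end weights

section structures
variable {N : ℕ}

/-- The role imposed by a partial matching on the points of its dipoles. -/
def dipoleRole (I : Finset (Fin N)) (f : I ↪ Fin N) : Fin N ⊕ Fin N → Option (Role (Fin N ⊕ Fin N))
  | .inl i => if i ∈ I then some (.inl true) else none
  | .inr j => if h : ∃ i, f i = j then some (.inr (3, .inl h.choose.1)) else none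

/-- The points which do not belong to the dipoles of a partial matching. -/
def freePoints (I : Finset (Fin N)) (f : I ↪ Fin N) : Finset (Fin N ⊕ Fin N) :=
  Finset.univ.filter fun v => dipoleRole I f v = none

/-- The roles compatible with a partial matching. -/
def roleChoices (I : Finset (Fin N)) (f : I ↪ Fin N) (v : Fin N ⊕ Fin N) :
    Finset (Role (Fin N ⊕ Fin N)) :=
  (dipoleRole I f v).elim Finset.univ fun o => {o}

lemma charge_mul_self (v : Fin N ⊕ Fin N) : charge v * charge v = 1 := by
  cases v <;> simp [charge]

lemma sum_charge : ∑ v : Fin N ⊕ Fin N, charge v = 0 := by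
  simp [charge]

lemma exists_right_of_charge {i : Fin N} {v : Fin N ⊕ Fin N} (h : charge (.inl i) * charge v = -1) :
    ∃ j, v = .inr j := by
  cases v with
  | inl k => norm_num [charge] at h
  | inr j => exact ⟨j, rfl⟩

lemma exists_left_of_charge {i : Fin N} {v : Fin N ⊕ Fin N} (h : charge (.inr i) * charge v = -1) :
    ∃ j, v = .inl j := by
  cases v with
  | inr k => norm_num [charge] at h
  | inl j => exact ⟨j, rfl⟩

variable {z : Fin N ⊕ Fin N → E2} {e₁ e₂ β lam : ℝ}

lemma exists_matching_roles (h : IsNearest z (phi1 z)) (hl : 0 < lam) (hβ : 0 ≤ β)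
    (h1 : 4 * lam < e₁) (h2 : e₁ ≤ e₂) :
    ∃ (I : Finset (Fin N)) (f : I ↪ Fin N), I.card ≤ numIsolatedDipoles z ∧
      ∃ s ∈ Fintype.piFinset (roleChoices I f), IsBalanced s (freePoints I f) ∧
      (∀ v ∈ freePoints I f, ∀ w, s v ≠ .inr (3, w)) ∧
      ENNReal.ofReal (Real.exp (-(β / 2) * pairEnergy lam charge z)) ≤
        ∏ v, roleTerm (cutWeight β (e₁ / 4)) (roleKernel β lam e₁ e₂) z v (s v) := by
  set φ := phi1 z with hφ
  obtain ⟨good, hgood⟩ : ∃ good, good = IsGoodDipole z φ charge e₁ e₂ := ⟨_, rfl⟩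
  have hidx : Function.Injective
      (Sum.elim (fun i : Fin N => (i : ℕ)) fun j : Fin N => N + (j : ℕ)) := by
    rintro (i | i) (j | j) hij <;> simp at hij
    · exact congrArg _ (Fin.ext hij)
    · omega
    · omega
    · exact congrArg _ (Fin.ext hij)
  obtain ⟨s, hs1, hs2, hs3, hs4⟩ := exists_roles_energy (β := β) h hl hβ h1 h2 charge_mul_self
    sum_charge _ hidx
  rw [← hgood] at hs1 hs2 hs3
  have hg : ∀ v, good v → φ (φ v) = v ∧ charge v * charge (φ v) = -1 ∧ IsIso φ v ∧ good (φ v) := by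
    intro v hv
    rw [hgood] at hv ⊢
    exact ⟨hv.1.1, hv.2.1, hv.2.2, hv.symm⟩
  let I : Finset (Fin N) := Finset.univ.filter fun i => good (.inl i)
  have hI : ∀ i, i ∈ I ↔ good (.inl i) := fun i => by simp [I]
  have hex : ∀ i : I, ∃ j, φ (.inl i.1) = .inr j := fun i =>
    exists_right_of_charge (hg _ ((hI _).1 i.2)).2.1
  choose f hf using hex
  have hfinj : Function.Injective f := by
    intro i i' hii
    have h3 := hf i
    rw [hii, ← hf i'] at h3
    have h4 := (hg _ ((hI _).1 i.2)).1
    rw [h3, (hg _ ((hI _).1 i'.2)).1] at h4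
    exact Subtype.ext (Sum.inl_injective h4).symm
  have hchoose : ∀ j (i : I), f i = j → ∀ hh : ∃ i, f i = j, hh.choose = i := fun j i hi hh =>
    hfinj (hh.choose_spec.trans hi.symm)
  have hright : ∀ j, good (.inr j) → ∃ i : I, f i = j ∧ φ (.inr j) = .inl i.1 := by
    intro j hj
    obtain ⟨h3, h4, -, h5⟩ := hg _ hj
    obtain ⟨i, hi⟩ := exists_left_of_charge h4
    rw [hi] at h5 h3
    refine ⟨⟨i, (hI i).2 h5⟩, ?_, hi⟩
    have := hf ⟨i, (hI i).2 h5⟩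
    simp only at this
    rw [h3] at this
    exact (Sum.inr_injective this).symm
  have hright' : ∀ i : I, good (.inr (f i)) := by
    intro i
    rw [← hf i]
    exact (hg _ ((hI _).1 i.2)).2.2.2
  have hD1 : ∀ v, ¬ good v → dipoleRole I ⟨f, hfinj⟩ v = none := by
    rintro (i | j) hv
    · simp [dipoleRole, hI, hv]
    · simp only [dipoleRole, Function.Embedding.coeFn_mk]
      rw [dif_neg]
      rintro ⟨i, rfl⟩
      exact hv (hright' i)
  have hD2 : ∀ v, good v → dipoleRole I ⟨f, hfinj⟩ v = some (s v) := by
    rintro (i | j) hv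
    · rw [hs1 _ hv, hf ⟨i, (hI i).2 hv⟩, if_pos]
      · simp [dipoleRole, hI, hv]
      · simp only [Sum.elim_inl, Sum.elim_inr]
        omega
    · obtain ⟨i, hi1, hi2⟩ := hright j hv
      have hh : ∃ i, f i = j := ⟨i, hi1⟩
      rw [hs1 _ hv, hi2, if_neg]
      · simp only [dipoleRole, Function.Embedding.coeFn_mk]
        rw [dif_pos hh, hchoose j i hi1 hh]
      · simp only [Sum.elim_inl, Sum.elim_inr]
        omega
  have hW : freePoints I ⟨f, hfinj⟩ = Finset.univ.filter fun v => ¬ good v := by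
    ext v
    simp only [freePoints, Finset.mem_filter, Finset.mem_univ, true_and]
    constructor
    · intro h3 h4
      rw [hD2 v h4] at h3
      cases h3
    · exact hD1 v
  refine ⟨I, ⟨f, hfinj⟩, ?_, s, ?_, ?_, ?_, hs4⟩
  · unfold numIsolatedDipoles
    rw [Nat.le_div_iff_mul_le two_pos]
    let F : I ⊕ I → {q : (Fin N ⊕ Fin N) × (Fin N ⊕ Fin N) // isIsolatedDipolePair z q.1 q.2} :=
      Sum.elim
        (fun i => ⟨(.inl i.1, φ (.inl i.1)), by
          obtain ⟨h3, h4, h5, h6⟩ := hg _ ((hI _).1 i.2)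
          exact ⟨rfl, h3, h4, h5⟩⟩)
        (fun i => ⟨(φ (.inl i.1), .inl i.1), by
          obtain ⟨h3, h4, h5, h6⟩ := hg _ ((hI _).1 i.2)
          exact ⟨h3, rfl, by rwa [mul_comm], fun k hk hk' => (h5 k hk' hk).symm⟩⟩)
    have hF : Function.Injective F := by
      rintro (i | i) (j | j) hij <;> simp only [F, Sum.elim_inl, Sum.elim_inr, Subtype.mk.injEq,
        Prod.mk.injEq, Sum.inl.injEq] at hij
      · rw [Subtype.ext hij.1]
      · rw [hf j] at hij
        simp at hij
      · rw [hf i] at hij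
        simp at hij
      · rw [Subtype.ext hij.2]
    have := Nat.card_le_card_of_injective F hF
    rw [Nat.card_eq_fintype_card, Fintype.card_sum, Fintype.card_coe] at this
    omega
  · rw [Fintype.mem_piFinset]
    intro v
    unfold roleChoices
    by_cases hv : good v
    · rw [hD2 v hv]
      simp
    · rw [hD1 v hv]
      simp
  · rwa [hW]
  · intro v hv
    rw [hW, Finset.mem_filter] at hv
    exact hs2 v hv.2

end structures

section mass
variable {ι : Type} [Fintype ι]

/-- The integral bound attached to a role. -/
def roleMass (cf : ℝ≥0∞) (κ : Fin 4 → E2 → ℝ≥0∞) (M : ℝ≥0∞) : Role ι → ℝ≥0∞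
  | .inl b => (if b then 1 else cf) * M
  | .inr q => ∫⁻ u, κ q.1 u

/-- The bound per free point after redistribution of the exponents. -/
def roleBound (A M k h : ℝ≥0∞) : Role ι → ℝ≥0∞
  | .inl _ => A * M * k * h
  | .inr _ => A * k * h

omit [Fintype ι] in
lemma measurable_roleTerm {cf : ℝ≥0∞} {κ : Fin 4 → E2 → ℝ≥0∞} (hκ : ∀ k, Measurable (κ k))
    (v : ι) (o : Role ι) : Measurable fun z => roleTerm cf κ z v o := by
  cases o with
  | inl b => exact measurable_const
  | inr q => exact (hκ q.1).comp ((measurable_pi_apply v).sub (measurable_pi_apply q.2))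

lemma lintegral_roleTerm_le {cf : ℝ≥0∞} {κ : Fin 4 → E2 → ℝ≥0∞} (hκ : ∀ k, Measurable (κ k))
    {s : ι → Role ι} {rank : ι → ℕ} (hrank : ∀ v q, s v = .inr q → rank q.2 < rank v)
    {B : Set E2} (hB : volume B ≠ ⊤) :
    ∫⁻ z, ∏ v, roleTerm cf κ z v (s v) ∂(Measure.pi fun _ : ι => volume.restrict B) ≤
      ∏ v, roleMass cf κ (volume B) (s v) := by
  have h := lintegral_forest_le
    (par := fun v => (s v).elim (fun _ => none) fun q => some q.2)
    (c := fun v => (s v).elim (fun b => if b then 1 else cf) fun _ => 0)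
    (κ := fun v => (s v).elim (fun _ => 0) fun q => κ q.1) (rank := rank)
    (fun v w hvw => by
      cases hs : s v with
      | inl b => simp [hs] at hvw
      | inr q =>
        simp only [hs, Sum.elim_inr, Option.some.injEq] at hvw
        rw [← hvw]
        exact hrank v q hs)
    (fun v => by
      cases s v with
      | inl b => exact measurable_const
      | inr q => exact hκ q.1) hB
  have h1 : ∀ z v, roleTerm cf κ z v (s v) = forestTerm
      (fun v => (s v).elim (fun _ => none) fun q => some q.2)
      (fun v => (s v).elim (fun b => if b then 1 else cf) fun _ => 0)
      (fun v => (s v).elim (fun _ => 0) fun q => κ q.1) z v := by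
    intro z v
    unfold forestTerm
    cases hs : s v <;> simp [hs, roleTerm]
  have h2 : ∀ v, roleMass cf κ (volume B) (s v) = forestMass
      (fun v => (s v).elim (fun _ => none) fun q => some q.2)
      (fun v => (s v).elim (fun b => if b then 1 else cf) fun _ => 0)
      (fun v => (s v).elim (fun _ => 0) fun q => κ q.1) (volume B) v := by
    intro v
    unfold forestMass
    cases hs : s v <;> simp [hs, roleMass]
  simp only [h1, h2]
  exact h

/-- The kernel masses in terms of a large parameter `k` and a small parameter `h`. -/
structure MassBounds (cf : ℝ≥0∞) (κ : Fin 4 → E2 → ℝ≥0∞) (A k h : ℝ≥0∞) : Prop where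
  one_le : 1 ≤ A
  small : h ≤ 1
  far : cf ≤ A * k * h ^ 3
  leaf : ∫⁻ u, κ 0 u ≤ A * k * h ^ 3
  close : ∫⁻ u, κ 1 u ≤ A * k ^ 2
  near : ∫⁻ u, κ 2 u ≤ A * h ^ 6

variable {cf : ℝ≥0∞} {κ : Fin 4 → E2 → ℝ≥0∞} {A k h M : ℝ≥0∞}

omit [Fintype ι] in
lemma MassBounds.roleMass_le (hb : MassBounds cf κ A k h) (o : Role ι)
    (ho : ∀ w, o ≠ .inr (3, w)) :
    roleMass cf κ M o ≤ roleBound A M 1 1 o * (k ^ roleLarge o * h ^ roleSmall o) := by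
  rcases o with b | ⟨j, w⟩
  · cases b
    · simp only [roleMass, roleBound, roleLarge, roleSmall, Bool.false_eq_true, if_false]
      calc cf * M ≤ (A * k * h ^ 3) * M := by gcongr; exact hb.far
        _ = _ := by ring
    · simp only [roleMass, roleBound, roleLarge, roleSmall, if_true, one_mul, pow_zero, mul_one]
      exact le_mul_of_one_le_left' hb.one_le
  · simp only [roleMass, roleBound, roleLarge, roleSmall]
    fin_cases j
    · simp only [Fin.zero_eta, if_true, mul_one, pow_one]
      exact hb.leaf.trans (le_of_eq (by ring))
    · simpa using hb.close
    · simpa using hb.near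
    · exact absurd rfl (ho w)

omit [Fintype ι] in
lemma MassBounds.prod_roleMass_le (hb : MassBounds cf κ A k h) {s : ι → Role ι} {W : Finset ι}
    (hs : IsBalanced s W) (ho : ∀ v ∈ W, ∀ w, s v ≠ .inr (3, w)) :
    ∏ v ∈ W, roleMass cf κ M (s v) ≤ ∏ v ∈ W, roleBound A M k h (s v) := by
  calc ∏ v ∈ W, roleMass cf κ M (s v)
      ≤ ∏ v ∈ W, (roleBound A M 1 1 (s v) * (k ^ roleLarge (s v) * h ^ roleSmall (s v))) :=
        Finset.prod_le_prod' fun v hv => hb.roleMass_le _ (ho v hv)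
    _ = (∏ v ∈ W, roleBound A M 1 1 (s v)) *
          (k ^ W.card * h ^ (∑ v ∈ W, roleSmall (s v))) := by
        rw [Finset.prod_mul_distrib, Finset.prod_mul_distrib, Finset.prod_pow_eq_pow_sum,
          Finset.prod_pow_eq_pow_sum, hs.2.1]
    _ ≤ (∏ v ∈ W, roleBound A M 1 1 (s v)) * (k ^ W.card * h ^ W.card) := by
        gcongr _ * (_ * ?_)
        exact pow_le_pow_right_of_le_one' hb.small hs.2.2
    _ = ∏ v ∈ W, (roleBound A M 1 1 (s v) * (k * h)) := by
        rw [Finset.prod_mul_distrib, Finset.prod_const, mul_pow]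
    _ = _ := by
        refine Finset.prod_congr rfl fun v _ => ?_
        cases s v <;> simp only [roleBound] <;> ring

end mass

section structuresum
variable {N : ℕ} {cf : ℝ≥0∞} {κ : Fin 4 → E2 → ℝ≥0∞} {A k h : ℝ≥0∞}

lemma sum_roleBound_le :
    ∑ o : Role (Fin N ⊕ Fin N), roleBound A N k h o ≤ 10 * A * N * k * h := by
  rw [Fintype.sum_sum_type]
  simp only [roleBound, Finset.sum_const, Finset.card_univ, Fintype.card_bool, Fintype.card_prod,
    Fintype.card_fin, Fintype.card_sum, nsmul_eq_mul]
  push_cast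
  exact le_of_eq (by ring)

lemma card_freePoints (I : Finset (Fin N)) (f : I ↪ Fin N) :
    (freePoints I f).card = 2 * (N - I.card) := by
  have h1 : freePoints I f = (Finset.univ \ I).disjSum (Finset.univ \ Finset.univ.map f) := by
    ext v
    rcases v with i | j
    · simp [freePoints, dipoleRole]
    · simp [freePoints, dipoleRole]
  rw [h1, Finset.card_disjSum, Finset.card_sdiff_of_subset (Finset.subset_univ _),
    Finset.card_sdiff_of_subset (Finset.subset_univ _), Finset.card_map, Finset.card_univ,
    Finset.card_univ, Fintype.card_fin, Fintype.card_coe]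
  omega

lemma prod_compl_freePoints (I : Finset (Fin N)) (f : I ↪ Fin N) (M : ℝ≥0∞)
    {s : Fin N ⊕ Fin N → Role (Fin N ⊕ Fin N)} (hs : s ∈ Fintype.piFinset (roleChoices I f)) :
    ∏ v ∈ (freePoints I f)ᶜ, roleMass cf κ M (s v) = (M * ∫⁻ u, κ 3 u) ^ I.card := by
  have h1 : (freePoints I f)ᶜ = I.disjSum (Finset.univ.map f) := by
    ext v
    rcases v with i | j
    · simp [freePoints, dipoleRole]
    · simp [freePoints, dipoleRole]
  rw [Fintype.mem_piFinset] at hs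
  rw [h1, Finset.prod_disjSum]
  have h2 : ∀ i ∈ I, roleMass cf κ M (s (.inl i)) = M := by
    intro i hi
    have := hs (.inl i)
    simp only [roleChoices, dipoleRole, hi, if_true, Option.elim_some, Finset.mem_singleton] at this
    rw [this]
    simp [roleMass]
  have h3 : ∀ j ∈ Finset.univ.map f, roleMass cf κ M (s (.inr j)) = ∫⁻ u, κ 3 u := by
    intro j hj
    have hex : ∃ i, f i = j := by simpa using hj
    have := hs (.inr j)
    simp only [roleChoices, dipoleRole, dif_pos hex, Option.elim_some, Finset.mem_singleton] at this
    rw [this]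
    rfl
  rw [Finset.prod_congr rfl h2, Finset.prod_congr rfl h3, Finset.prod_const, Finset.prod_const,
    Finset.card_map, Finset.card_univ, Fintype.card_coe, mul_pow]

lemma sum_choices_le (hb : MassBounds cf κ A k h) (I : Finset (Fin N)) (f : I ↪ Fin N) :
    ∑ s ∈ (Fintype.piFinset (roleChoices I f)).filter (fun s => IsBalanced s (freePoints I f) ∧
      ∀ v ∈ freePoints I f, ∀ w, s v ≠ .inr (3, w)),
      ∏ v, roleMass cf κ N (s v) ≤
      (N * ∫⁻ u, κ 3 u) ^ I.card * (10 * A * N * k * h) ^ (2 * (N - I.card)) := by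
  have h1 : ∀ s ∈ (Fintype.piFinset (roleChoices I f)).filter (fun s =>
      IsBalanced s (freePoints I f) ∧ ∀ v ∈ freePoints I f, ∀ w, s v ≠ .inr (3, w)),
      ∏ v, roleMass cf κ N (s v) ≤ (N * ∫⁻ u, κ 3 u) ^ I.card *
        ∏ v, (if v ∈ freePoints I f then roleBound A N k h (s v) else 1) := by
    intro s hs
    rw [Finset.mem_filter] at hs
    rw [← Finset.prod_compl_mul_prod (freePoints I f), prod_compl_freePoints I f _ hs.1,
      Finset.prod_ite_mem, Finset.univ_inter]
    gcongr _ * ?_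
    exact hb.prod_roleMass_le hs.2.1 hs.2.2
  refine (Finset.sum_le_sum h1).trans ?_
  rw [← Finset.mul_sum]
  gcongr _ * ?_
  refine (Finset.sum_le_sum_of_subset (Finset.filter_subset _ _)).trans ?_
  rw [← Finset.prod_univ_sum (roleChoices I f)
    (fun v o => if v ∈ freePoints I f then roleBound A N k h o else 1), ← card_freePoints I f,
    ← Finset.prod_compl_mul_prod (freePoints I f)]
  have h2 : ∏ v ∈ (freePoints I f)ᶜ, ∑ o ∈ roleChoices I f v,
      (if v ∈ freePoints I f then roleBound A (N : ℝ≥0∞) k h o else 1) = 1 := by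
    refine Finset.prod_eq_one fun v hv => ?_
    rw [Finset.mem_compl] at hv
    simp only [hv, if_false]
    obtain ⟨o, ho⟩ := Option.ne_none_iff_exists'.1 (show dipoleRole I f v ≠ none from fun hc =>
      hv (by simp [freePoints, hc]))
    simp [roleChoices, ho]
  rw [h2, one_mul, ← Finset.prod_const]
  refine Finset.prod_le_prod' fun v hv => ?_
  simp only [hv, if_true]
  exact (Finset.sum_le_sum_of_subset (Finset.subset_univ _)).trans sum_roleBound_le

end structuresum

section numerator
variable {N : ℕ} {A k h : ℝ≥0∞} {β lam e₁ e₂ : ℝ}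

lemma setLIntegral_le_sum_structures (hl : 0 < lam) (hβ : 0 ≤ β) (h1 : 4 * lam < e₁)
    (h2 : e₁ ≤ e₂) (hb : MassBounds (cutWeight β (e₁ / 4)) (roleKernel β lam e₁ e₂) A k h)
    {B : Set E2} (hB : volume B = N) (p : ℕ) :
    ∫⁻ z in {z : Fin N ⊕ Fin N → E2 | IsNearest z (phi1 z) ∧ numIsolatedDipoles z ≤ p},
      ENNReal.ofReal (Real.exp (-(β / 2) * pairEnergy lam charge z))
        ∂(Measure.pi fun _ => volume.restrict B) ≤
      ∑ I : Finset (Fin N), ∑ _f : I ↪ Fin N, if I.card ≤ p then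
        (N * ∫⁻ u, roleKernel β lam e₁ e₂ 3 u) ^ I.card *
          (10 * A * N * k * h) ^ (2 * (N - I.card)) else 0 := by
  have hκ : ∀ k, Measurable (roleKernel β lam e₁ e₂ k) := measurable_roleKernel hl
  set G : (I : Finset (Fin N)) → (I ↪ Fin N) → (Fin N ⊕ Fin N → E2) → ℝ≥0∞ := fun I f z =>
    ∑ s ∈ (Fintype.piFinset (roleChoices I f)).filter (fun s => IsBalanced s (freePoints I f) ∧
      ∀ v ∈ freePoints I f, ∀ w, s v ≠ .inr (3, w)),
      ∏ v, roleTerm (cutWeight β (e₁ / 4)) (roleKernel β lam e₁ e₂) z v (s v) with hG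
  have hGm : ∀ I f, Measurable (G I f) := fun I f =>
    Finset.measurable_fun_sum _ fun s _ => Finset.measurable_fun_prod _ fun v _ =>
      measurable_roleTerm hκ v (s v)
  have hGm' : ∀ I f, Measurable fun z => if I.card ≤ p then G I f z else 0 := fun I f => by
    split_ifs
    · exact hGm I f
    · exact measurable_const
  calc _ ≤ ∫⁻ z in {z : Fin N ⊕ Fin N → E2 | IsNearest z (phi1 z) ∧ numIsolatedDipoles z ≤ p},
        ∑ I : Finset (Fin N), ∑ f : I ↪ Fin N, (if I.card ≤ p then G I f z else 0)
          ∂(Measure.pi fun _ => volume.restrict B) := by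
        refine setLIntegral_mono (Finset.measurable_fun_sum _ fun I _ =>
          Finset.measurable_fun_sum _ fun f _ => hGm' I f) fun z hz => ?_
        obtain ⟨I, f, hI, s, hs, hs', hs'', hle⟩ := exists_matching_roles hz.1 hl hβ h1 h2
        refine hle.trans ?_
        calc _ ≤ G I f z := Finset.single_le_sum
                (f := fun s : Fin N ⊕ Fin N → Role (Fin N ⊕ Fin N) =>
                  ∏ v, roleTerm (cutWeight β (e₁ / 4)) (roleKernel β lam e₁ e₂) z v (s v))
                (fun _ _ => zero_le) (Finset.mem_filter.2 ⟨hs, hs', hs''⟩)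
          _ = if I.card ≤ p then G I f z else 0 := (if_pos (hI.trans hz.2)).symm
          _ ≤ ∑ f : I ↪ Fin N, (if I.card ≤ p then G I f z else 0) :=
              Finset.single_le_sum (f := fun f : I ↪ Fin N => if I.card ≤ p then G I f z else 0)
                (fun _ _ => zero_le) (Finset.mem_univ f)
          _ ≤ _ := Finset.single_le_sum
              (f := fun I : Finset (Fin N) => ∑ f : I ↪ Fin N, if I.card ≤ p then G I f z else 0)
                (fun _ _ => zero_le) (Finset.mem_univ I)
    _ ≤ ∫⁻ z, ∑ I : Finset (Fin N), ∑ f : I ↪ Fin N, (if I.card ≤ p then G I f z else 0)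
          ∂(Measure.pi fun _ => volume.restrict B) := setLIntegral_le_lintegral _ _
    _ = ∑ I : Finset (Fin N), ∑ f : I ↪ Fin N, ∫⁻ z, (if I.card ≤ p then G I f z else 0)
          ∂(Measure.pi fun _ => volume.restrict B) := by
        rw [lintegral_finsetSum _ fun I _ => Finset.measurable_fun_sum _ fun f _ => hGm' I f]
        exact Finset.sum_congr rfl fun I _ => lintegral_finsetSum _ fun f _ => hGm' I f
    _ ≤ _ := by
        refine Finset.sum_le_sum fun I _ => Finset.sum_le_sum fun f _ => ?_
        split_ifs with hI
        · rw [lintegral_finsetSum _ fun s _ => Finset.measurable_fun_prod _ fun v _ =>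
            measurable_roleTerm hκ v (s v)]
          refine le_trans (Finset.sum_le_sum fun s hs => ?_) (sum_choices_le hb I f)
          obtain ⟨⟨rank, hrank⟩, -⟩ := (Finset.mem_filter.1 hs).2.1
          have := lintegral_roleTerm_le (cf := cutWeight β (e₁ / 4)) hκ hrank (B := B)
            (by rw [hB]; exact ENNReal.natCast_ne_top N)
          rwa [hB] at this
        · simp

lemma sum_finset_embedding (F : ℕ → ℝ≥0∞) :
    ∑ I : Finset (Fin N), ∑ _f : I ↪ Fin N, F I.card =
      ∑ m ∈ Finset.range (N + 1), (N.choose m * N.descFactorial m : ℕ) * F m := by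
  simp only [Finset.sum_const, Finset.card_univ, Fintype.card_embedding_eq, Fintype.card_fin,
    Fintype.card_coe]
  rw [← Finset.powerset_univ, Finset.sum_powerset_apply_card
    (fun m => N.descFactorial m • F m), Finset.card_univ, Fintype.card_fin]
  refine Finset.sum_congr rfl fun m _ => ?_
  simp only [nsmul_eq_mul]
  push_cast
  ring

end numerator

section constants
variable {β lam e h c : ℝ}

/-- The mass `∫_{|u| < e} e^{β g_lam(u)} du` of a dipole of size less than `e`. -/
def dipoleMass (β lam e : ℝ) : ℝ≥0∞ :=
  ∫⁻ u in Metric.ball (0 : E2) e, ENNReal.ofReal (Real.exp (β * gsm lam u))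

lemma volume_ball_E2 (x : E2) {s : ℝ} (hs : 0 ≤ s) :
    volume (Metric.ball x s) = ENNReal.ofReal (s ^ 2 * π) := by
  rw [EuclideanSpace.volume_ball_fin_two, ENNReal.ofReal_mul (by positivity),
    ENNReal.ofReal_pow hs]

lemma dipoleMass_ne_top (hl : 0 < lam) (hβ : 0 ≤ β) : dipoleMass β lam e ≠ ⊤ := by
  unfold dipoleMass
  have h1 : ∫⁻ u in Metric.ball (0 : E2) e, ENNReal.ofReal (Real.exp (β * gsm lam u)) ≤
      ∫⁻ u in Metric.ball (0 : E2) e, ENNReal.ofReal (Real.exp (β * (c0 + 2 - Real.log lam))) := by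
    refine lintegral_mono fun u => ENNReal.ofReal_le_ofReal (Real.exp_le_exp.2 ?_)
    exact mul_le_mul_of_nonneg_left (gsm_le hl u) hβ
  refine ne_top_of_le_ne_top ?_ h1
  rw [setLIntegral_const]
  exact ENNReal.mul_ne_top ENNReal.ofReal_ne_top measure_ball_lt_top.ne

lemma lintegral_roleKernel_three (e₂ : ℝ) (hl : 0 < lam) :
    ∫⁻ u, roleKernel β lam e e₂ 3 u =
      ENNReal.ofReal (Real.exp (β * (12 * (e / e₂)))) * dipoleMass β lam e := by
  have : roleKernel β lam e e₂ 3 = (Metric.ball 0 e).indicator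
    (fun u => ENNReal.ofReal (Real.exp (β * (12 * (e / e₂)))) *
      ENNReal.ofReal (Real.exp (β * gsm lam u))) := by
    ext u
    simp [roleKernel]
  rw [this, lintegral_indicator measurableSet_ball, lintegral_const_mul, dipoleMass]
  have := measurable_gsm hl
  fun_prop

lemma cutWeight_sq (r : ℝ) :
    cutWeight β r ^ 2 = ENNReal.ofReal (Real.exp (β * (c0 + 2 - Real.log r))) := by
  unfold cutWeight
  rw [← ENNReal.ofReal_pow (Real.exp_nonneg _), ← Real.exp_nat_mul]
  congr 2
  push_cast
  ring

lemma cutWeight_sq_le (hl : 0 < lam) (hβ : 0 ≤ β) (u : E2) :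
    cutWeight β (max lam (‖u‖ / 4)) ^ 2 ≤
      ENNReal.ofReal (Real.exp (β * (3 + Real.log 12))) *
        ENNReal.ofReal (Real.exp (β * gsm lam u)) := by
  have hm : 0 < max lam (‖u‖ / 4) := lt_max_of_lt_left hl
  have h1 : Real.log (2 * (‖u‖ + 2 * lam)) ≤ Real.log 12 + Real.log (max lam (‖u‖ / 4)) := by
    rw [← Real.log_mul (by norm_num) hm.ne']
    refine Real.log_le_log (by positivity) ?_
    have := le_max_left lam (‖u‖ / 4)
    have := le_max_right lam (‖u‖ / 4)
    linarith
  rw [cutWeight_sq, ← ENNReal.ofReal_mul (Real.exp_nonneg _), ← Real.exp_add, ← mul_add]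
  refine ENNReal.ofReal_le_ofReal (Real.exp_le_exp.2 (mul_le_mul_of_nonneg_left ?_ hβ))
  have := gsm_ge hl u
  linarith

lemma lintegral_roleKernel_one_le (e₂ : ℝ) (hl : 0 < lam) (hβ : 0 ≤ β) :
    ∫⁻ u, roleKernel β lam e e₂ 1 u ≤
      ENNReal.ofReal (Real.exp (β * (3 + Real.log 12))) * dipoleMass β lam e := by
  have : roleKernel β lam e e₂ 1 = (Metric.ball 0 e).indicator
      (fun u => cutWeight β (max lam (‖u‖ / 4)) ^ 2) := by
    ext u
    simp [roleKernel]
  rw [this, lintegral_indicator measurableSet_ball, dipoleMass, ← lintegral_const_mul]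
  · exact lintegral_mono fun u => cutWeight_sq_le hl hβ u
  · have := measurable_gsm hl
    fun_prop

lemma lintegral_roleKernel_two_le (lam e : ℝ) {e₂ : ℝ} (he₂ : 0 ≤ e₂) :
    ∫⁻ u, roleKernel β lam e e₂ 2 u ≤ ENNReal.ofReal (e₂ ^ 2 * π) := by
  have : roleKernel β lam e e₂ 2 = (Metric.ball 0 e₂).indicator (fun _ => 1) := by
    ext u
    simp [roleKernel]
  rw [this, lintegral_indicator measurableSet_ball, setLIntegral_one, volume_ball_E2 _ he₂]

lemma lintegral_roleKernel_zero_le (e₂ : ℝ) (hl : 0 < lam) (he : 0 ≤ e) {t : ℝ}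
    (ht : 0 < t) :
    ∫⁻ u, roleKernel β lam e e₂ 0 u ≤
      ENNReal.ofReal t * (∫⁻ u, roleKernel β lam e e₂ 1 u) +
        ENNReal.ofReal (1 / t) * ENNReal.ofReal (e ^ 2 * π) := by
  rw [← volume_ball_E2 (0 : E2) he, ← lintegral_const_mul _ (measurable_roleKernel hl 1),
    ← lintegral_indicator_const measurableSet_ball,
    ← lintegral_add_left ((measurable_roleKernel hl 1).const_mul _)]
  refine lintegral_mono fun u => ?_
  by_cases hu : u ∈ Metric.ball (0 : E2) e
  · simp only [roleKernel, if_true, one_ne_zero, if_false, Set.indicator_of_mem hu, cutWeight]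
    rw [← ENNReal.ofReal_pow (Real.exp_nonneg _), ← ENNReal.ofReal_mul ht.le,
      ← ENNReal.ofReal_add (by positivity) (by positivity)]
    refine ENNReal.ofReal_le_ofReal ?_
    generalize Real.exp _ = w
    rw [← sub_nonneg]
    have : t * w ^ 2 + 1 / t - w = ((t * w - 1 / 2) ^ 2 + 3 / 4) / t := by
      field_simp
      ring
    rw [this]
    positivity
  · simp [roleKernel, Set.indicator_of_notMem hu]

/-- The constant in the kernel mass bounds. -/
def massConst (β c : ℝ) : ℝ :=
  1 + Real.exp (β / 2 * (c0 + 2 + Real.log 4)) / √c + Real.exp (β * (3 + Real.log 12)) + π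

lemma massBounds (hβ : 0 ≤ β) (hl : 0 < lam) (hh : 0 < h) (hh1 : h ≤ 1)
    (hc : 0 < c) (hK : ENNReal.ofReal (c * h ^ (-(6 + 4 * β))) ≤ dipoleMass β lam (h ^ 4)) :
    MassBounds (cutWeight β (h ^ 4 / 4)) (roleKernel β lam (h ^ 4) (h ^ 3))
      (ENNReal.ofReal (massConst β c)) (ENNReal.ofReal √(dipoleMass β lam (h ^ 4)).toReal)
      (ENNReal.ofReal h) := by
  obtain ⟨K, hKdef⟩ : ∃ K, K = (dipoleMass β lam (h ^ 4)).toReal := ⟨_, rfl⟩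
  have hKE : dipoleMass β lam (h ^ 4) = ENNReal.ofReal K := by
    rw [hKdef, ENNReal.ofReal_toReal (dipoleMass_ne_top hl hβ)]
  have hKpos : 0 < c * h ^ (-(6 + 4 * β)) := by positivity
  have hKle : c * h ^ (-(6 + 4 * β)) ≤ K := by
    rw [hKE] at hK
    rcases ENNReal.ofReal_le_ofReal_iff'.1 hK with h1 | h1
    · exact h1
    · exact absurd h1 (not_le.2 hKpos)
  have hK0 : 0 < K := hKpos.trans_le hKle
  rw [← hKdef]
  have hk0 : 0 < √K := Real.sqrt_pos.2 hK0
  have hkK : √K ^ 2 = K := Real.sq_sqrt hK0.le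
  obtain ⟨a₁, ha₁⟩ : ∃ a, a = Real.exp (β / 2 * (c0 + 2 + Real.log 4)) / √c := ⟨_, rfl⟩
  obtain ⟨D, hD⟩ : ∃ D, D = Real.exp (β * (3 + Real.log 12)) := ⟨_, rfl⟩
  have ha₁0 : 0 < a₁ := by rw [ha₁]; positivity
  have hD0 : 0 < D := by rw [hD]; positivity
  have hA : massConst β c = 1 + a₁ + D + π := by rw [massConst, ← ha₁, ← hD]
  have hpi := Real.pi_pos
  have hA0 : 0 < massConst β c := by rw [hA]; positivity
  have hone : ∫⁻ u, roleKernel β lam (h ^ 4) (h ^ 3) 1 u ≤ ENNReal.ofReal (D * K) := by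
    refine (lintegral_roleKernel_one_le _ hl hβ).trans ?_
    rw [hKE, ← hD, ENNReal.ofReal_mul hD0.le]
  refine ⟨?_, ?_, ?_, ?_, ?_, ?_⟩
  · rw [← ENNReal.ofReal_one]
    exact ENNReal.ofReal_le_ofReal (by rw [hA]; linarith)
  · rw [← ENNReal.ofReal_one]
    exact ENNReal.ofReal_le_ofReal hh1
  · rw [← ENNReal.ofReal_pow hh.le, ← ENNReal.ofReal_mul hA0.le,
      ← ENNReal.ofReal_mul (by positivity)]
    refine ENNReal.ofReal_le_ofReal ?_
    have hk : √c * h ^ (-(3 + 2 * β)) ≤ √K := by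
      refine Real.le_sqrt_of_sq_le ?_
      rw [mul_pow, Real.sq_sqrt hc.le, ← Real.rpow_natCast (h ^ (-(3 + 2 * β))),
        ← Real.rpow_mul hh.le]
      refine le_of_eq_of_le ?_ hKle
      congr 2
      push_cast
      ring
    have h1 : Real.log (h ^ 4 / 4) = 4 * Real.log h - Real.log 4 := by
      rw [Real.log_div (by positivity) (by norm_num), Real.log_pow]
      norm_num
    calc Real.exp (β / 2 * (c0 + 2 - Real.log (h ^ 4 / 4)))
        = a₁ * (√c * h ^ (-(3 + 2 * β))) * h ^ 3 := by
          have h2 : h ^ (-(3 + 2 * β)) * h ^ 3 = Real.exp (-(2 * β) * Real.log h) := by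
            rw [← Real.rpow_natCast h 3, ← Real.rpow_add hh, Real.rpow_def_of_pos hh]
            congr 1
            push_cast
            ring
          rw [mul_assoc, mul_assoc, h2, ha₁, ← mul_assoc, div_mul_cancel₀ _ (by positivity),
            ← Real.exp_add, h1]
          congr 1
          ring
      _ ≤ massConst β c * √K * h ^ 3 := by
          gcongr
          rw [hA]
          linarith
  · rw [← ENNReal.ofReal_pow hh.le, ← ENNReal.ofReal_mul hA0.le,
      ← ENNReal.ofReal_mul (by positivity)]
    refine (lintegral_roleKernel_zero_le (h ^ 3) hl (by positivity)
      (t := h ^ 4 / √K) (by positivity)).trans ?_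
    refine (add_le_add (mul_le_mul_right hone _) le_rfl).trans ?_
    rw [← ENNReal.ofReal_mul (by positivity), ← ENNReal.ofReal_mul (by positivity),
      ← ENNReal.ofReal_add (by positivity) (by positivity)]
    refine ENNReal.ofReal_le_ofReal ?_
    calc h ^ 4 / √K * (D * K) + 1 / (h ^ 4 / √K) * ((h ^ 4) ^ 2 * π)
        = (D + π) * √K * (h * h ^ 3) := by
          nth_rewrite 2 [← hkK]
          field_simp
      _ ≤ massConst β c * √K * (1 * h ^ 3) := by
          gcongr
          rw [hA]
          linarith
      _ = _ := by ring
  · refine hone.trans ?_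
    rw [← ENNReal.ofReal_pow hk0.le, ← ENNReal.ofReal_mul hA0.le, hkK]
    refine ENNReal.ofReal_le_ofReal ?_
    gcongr
    rw [hA]
    linarith
  · refine (lintegral_roleKernel_two_le _ _ (by positivity)).trans ?_
    rw [← ENNReal.ofReal_pow hh.le, ← ENNReal.ofReal_mul hA0.le]
    refine ENNReal.ofReal_le_ofReal ?_
    calc (h ^ 3) ^ 2 * π = π * h ^ 6 := by ring
      _ ≤ _ := by
        gcongr
        rw [hA]
        linarith

end constants

section scale
variable {β lam e : ℝ}

/-- The small parameter of the expansion; the dipole cutoffs are its third and fourth powers. -/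
def dipoleScale (β lam : ℝ) : ℝ :=
  if β = 2 then |Real.log lam| ^ (-(1 : ℝ) / 14) else lam ^ ((β - 2) / (6 + 4 * β))

lemma le_setLIntegral_gsm (hl : 0 < lam) (hβ : 0 ≤ β) {r : ℝ} (hr : lam ≤ r) {S : Set E2}
    (hS : MeasurableSet S) (hSr : ∀ u ∈ S, ‖u‖ ≤ r) :
    ENNReal.ofReal (Real.exp (β * (c0 - 1 - Real.log 6)) * r ^ (-β)) * volume S ≤
      ∫⁻ u in S, ENNReal.ofReal (Real.exp (β * gsm lam u)) := by
  have hr0 : 0 < r := hl.trans_le hr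
  rw [← setLIntegral_const]
  refine setLIntegral_mono' hS fun u hu => ENNReal.ofReal_le_ofReal ?_
  rw [Real.rpow_def_of_pos hr0, ← Real.exp_add]
  refine Real.exp_le_exp.2 ?_
  have h1 : Real.log (2 * (‖u‖ + 2 * lam)) ≤ Real.log 6 + Real.log r := by
    rw [← Real.log_mul (by norm_num) hr0.ne']
    refine Real.log_le_log (by positivity) ?_
    have := hSr u hu
    linarith
  have h2 := gsm_ge hl u
  calc β * (c0 - 1 - Real.log 6) + Real.log r * -β = β * (c0 - 1 - (Real.log 6 + Real.log r)) := by
        ring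
    _ ≤ _ := mul_le_mul_of_nonneg_left (by linarith) hβ

lemma dipoleMass_ge_pow (hl : 0 < lam) (hβ : 0 ≤ β) (he : lam ≤ e) :
    ENNReal.ofReal (π * Real.exp (β * (c0 - 1 - Real.log 6)) * lam ^ (2 - β)) ≤
      dipoleMass β lam e := by
  have h1 := le_setLIntegral_gsm hl hβ le_rfl (S := Metric.ball (0 : E2) lam) measurableSet_ball
    (fun u hu => (mem_ball_zero_iff.1 hu).le)
  refine le_trans ?_ (h1.trans (lintegral_mono_set (Metric.ball_subset_ball he)))
  rw [volume_ball_E2 _ hl.le, ← ENNReal.ofReal_mul (by positivity),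
    show 2 - β = 2 + -β from sub_eq_add_neg _ _, Real.rpow_add hl, Real.rpow_two]
  refine ENNReal.ofReal_le_ofReal (le_of_eq ?_)
  ring

lemma dipoleMass_ge_log (hl : 0 < lam) (n : ℕ) (he : 2 ^ n * lam ≤ e) :
    ENNReal.ofReal (3 / 4 * π * Real.exp (2 * (c0 - 1 - Real.log 6)) * n) ≤
      dipoleMass 2 lam e := by
  have hsplit : ∀ n : ℕ, ENNReal.ofReal (3 / 4 * π * Real.exp (2 * (c0 - 1 - Real.log 6)) * n) ≤
      dipoleMass 2 lam (2 ^ n * lam) := by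
    intro n
    induction n with
    | zero => simp
    | succ n ih =>
      have hpos : 0 < 2 ^ n * lam := by positivity
      have hle : 2 ^ n * lam ≤ 2 ^ (n + 1) * lam := by rw [pow_succ]; nlinarith
      have hlam : lam ≤ 2 ^ (n + 1) * lam :=
        le_mul_of_one_le_left hl.le (one_le_pow₀ (by norm_num))
      have hsub := Metric.ball_subset_ball (x := (0 : E2)) hle
      obtain ⟨S, hS⟩ : ∃ S, S = Metric.ball (0 : E2) (2 ^ (n + 1) * lam) \
        Metric.ball (0 : E2) (2 ^ n * lam) := ⟨_, rfl⟩
      have hSm : MeasurableSet S := by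
        rw [hS]
        exact measurableSet_ball.diff measurableSet_ball
      have h1 := le_setLIntegral_gsm (β := 2) hl (by norm_num) hlam (S := S) hSm
        (fun u hu => by
          rw [hS] at hu
          exact (mem_ball_zero_iff.1 hu.1).le)
      have hvol : volume S = ENNReal.ofReal (3 * (2 ^ n * lam) ^ 2 * π) := by
        rw [hS, measure_sdiff hsub measurableSet_ball.nullMeasurableSet measure_ball_lt_top.ne,
          volume_ball_E2 _ (by positivity), volume_ball_E2 _ hpos.le,
          ← ENNReal.ofReal_sub _ (by positivity)]
        congr 1
        ring
      have h2 : dipoleMass 2 lam (2 ^ (n + 1) * lam) = dipoleMass 2 lam (2 ^ n * lam) +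
          ∫⁻ u in S, ENNReal.ofReal (Real.exp (2 * gsm lam u)) := by
        unfold dipoleMass
        rw [← lintegral_union hSm (by rw [hS]; exact Set.disjoint_sdiff_right), hS,
          Set.union_sdiff_cancel hsub]
      rw [h2, Nat.cast_succ, mul_add, mul_one,
        ENNReal.ofReal_add (by positivity) (by positivity)]
      refine add_le_add ih (le_trans ?_ h1)
      rw [hvol, ← ENNReal.ofReal_mul (by positivity)]
      refine ENNReal.ofReal_le_ofReal (le_of_eq ?_)
      rw [Real.rpow_neg (by positivity), Real.rpow_two]
      field_simp
      ring
  exact (hsplit n).trans (lintegral_mono_set (Metric.ball_subset_ball he))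

open Filter Topology in
lemma tendsto_dipoleScale (hβ : 2 ≤ β) : Tendsto (dipoleScale β) (𝓝[>] 0) (𝓝 0) := by
  unfold dipoleScale
  by_cases h2 : β = 2
  · simp only [h2, if_true]
    have h1 : Tendsto (fun lam : ℝ => |Real.log lam|) (𝓝[>] 0) atTop :=
      tendsto_abs_atBot_atTop.comp Real.tendsto_log_nhdsGT_zero
    have h3 := (tendsto_rpow_neg_atTop (y := 1 / 14) (by norm_num)).comp h1
    refine h3.congr fun x => ?_
    simp only [Function.comp]
    norm_num
  · simp only [h2, if_false]
    have h1 : 0 < (β - 2) / (6 + 4 * β) := by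
      have : 2 < β := lt_of_le_of_ne hβ (Ne.symm h2)
      exact div_pos (by linarith) (by linarith)
    have h3 := (Real.continuousAt_rpow_const 0 ((β - 2) / (6 + 4 * β)) (Or.inr h1.le)).tendsto
    rw [Real.zero_rpow h1.ne'] at h3
    exact h3.mono_left nhdsWithin_le_nhds

lemma dipoleScale_pos (hl : 0 < lam) (hl1 : lam < 1) : 0 < dipoleScale β lam := by
  unfold dipoleScale
  split_ifs
  · exact Real.rpow_pos_of_pos (abs_pos.2 (Real.log_neg hl hl1).ne) _
  · exact Real.rpow_pos_of_pos hl _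

lemma dipoleScale_le_omegaL (hβ : 2 ≤ β) (hl : 0 < lam) (hl1 : lam < Real.exp (-1)) :
    dipoleScale β lam ≤ omegaL β lam := by
  have hlog : 1 ≤ |Real.log lam| := by
    have := Real.log_lt_log hl hl1
    rw [Real.log_exp] at this
    rw [abs_of_neg (by linarith)]
    linarith
  have hlt1 : lam ≤ 1 := hl1.le.trans (Real.exp_le_one_iff.2 (by norm_num))
  unfold dipoleScale omegaL
  split_ifs with h1 h2 h3
  · exact Real.rpow_le_rpow_of_exponent_le hlog (by norm_num)
  · refine Real.rpow_le_rpow_of_exponent_ge hl hlt1 ?_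
    rw [div_le_div_iff₀ (by linarith) (by linarith)]
    nlinarith
  · subst h3
    calc lam ^ (((4 : ℝ) - 2) / (6 + 4 * 4)) ≤ lam ^ ((1 : ℝ) / (2 + 36)) :=
          Real.rpow_le_rpow_of_exponent_ge hl hlt1 (by norm_num)
      _ ≤ _ := Real.rpow_le_rpow hl.le (le_mul_of_one_le_right hl.le hlog) (by norm_num)
  · refine Real.rpow_le_rpow_of_exponent_ge hl hlt1 ?_
    rw [div_le_div_iff₀ (by linarith) (by linarith)]
    have : 4 ≤ β := not_lt.1 h2
    nlinarith

open Filter Topology in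
/-- The cutoffs are admissible and the dipole mass is large at small truncation. -/
lemma exists_dipoleScale_bounds (hβ : 2 ≤ β) : ∃ c > 0, ∀ᶠ lam in 𝓝[>] (0 : ℝ),
    4 * lam < dipoleScale β lam ^ 4 ∧
      ENNReal.ofReal (c * dipoleScale β lam ^ (-(6 + 4 * β))) ≤
        dipoleMass β lam (dipoleScale β lam ^ 4) := by
  rcases hβ.eq_or_lt with h2 | h2
  · subst h2
    refine ⟨3 / 16 * π * Real.exp (2 * (c0 - 1 - Real.log 6)), by positivity, ?_⟩
    have h1 : ∀ᶠ lam in 𝓝[>] (0 : ℝ), -1 < Real.log lam * lam ^ (1 / 2 : ℝ) :=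
      (tendsto_log_mul_rpow_nhdsGT_zero (by norm_num)).eventually (lt_mem_nhds (by norm_num))
    have h3 : ∀ᶠ lam in 𝓝[>] (0 : ℝ), Real.log lam < -4 :=
      Real.tendsto_log_nhdsGT_zero.eventually (eventually_lt_atBot _)
    filter_upwards [h1, h3, Ioo_mem_nhdsGT (show (0 : ℝ) < 1 / 16 by norm_num)] with
      lam h1 h3 h4
    have hl : 0 < lam := h4.1
    have habs : |Real.log lam| = -Real.log lam := abs_of_neg (by linarith)
    obtain ⟨L, hL⟩ : ∃ L, L = -Real.log lam := ⟨_, rfl⟩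
    have hL4 : 4 < L := by linarith
    have hscale : dipoleScale 2 lam = L ^ (-(1 : ℝ) / 14) := by
      simp [dipoleScale, habs, hL]
    have hpow : √lam ≤ dipoleScale 2 lam ^ 4 := by
      rw [← Real.sqrt_eq_rpow] at h1
      calc √lam ≤ L ^ (-1 : ℝ) := by
            rw [Real.rpow_neg_one, ← one_div, le_div_iff₀ (by linarith)]
            rw [hL]
            linarith
        _ ≤ L ^ ((-(1 : ℝ) / 14) * (4 : ℕ)) :=
            Real.rpow_le_rpow_of_exponent_le (by linarith) (by norm_num)
        _ = _ := by rw [hscale, Real.rpow_mul_natCast (by linarith)]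
    have hsq : √lam * √lam = lam := Real.mul_self_sqrt hl.le
    have hsq0 : 0 < √lam := Real.sqrt_pos.2 hl
    have hsq1 : √lam < 1 / 4 := by
      rw [Real.sqrt_lt' (by norm_num)]
      linarith [h4.2]
    refine ⟨by nlinarith, ?_⟩
    have hn : 2 ^ ⌊L / 2⌋₊ * lam ≤ dipoleScale 2 lam ^ 4 := by
      refine le_trans ?_ hpow
      have h5 : (2 : ℝ) ^ ⌊L / 2⌋₊ ≤ Real.exp (L / 2) := by
        calc (2 : ℝ) ^ ⌊L / 2⌋₊ ≤ Real.exp 1 ^ ⌊L / 2⌋₊ := by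
              gcongr
              have := Real.add_one_le_exp (1 : ℝ)
              linarith
          _ = Real.exp ⌊L / 2⌋₊ := by rw [← Real.exp_nat_mul, mul_one]
          _ ≤ _ := Real.exp_le_exp.2 (Nat.floor_le (by linarith))
      have h6 : Real.exp (L / 2) * √lam = 1 := by
        rw [Real.sqrt_eq_rpow, Real.rpow_def_of_pos hl, ← Real.exp_add, hL,
          Real.exp_eq_one_iff]
        ring
      calc 2 ^ ⌊L / 2⌋₊ * lam ≤ Real.exp (L / 2) * lam := by gcongr
        _ = (Real.exp (L / 2) * √lam) * √lam := by rw [mul_assoc, hsq]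
        _ = √lam := by rw [h6, one_mul]
    refine le_trans (ENNReal.ofReal_le_ofReal ?_) (dipoleMass_ge_log hl _ hn)
    have h7 : L / 4 ≤ (⌊L / 2⌋₊ : ℝ) := by
      have := Nat.lt_floor_add_one (L / 2)
      linarith
    have h8 : (L ^ (-(1 : ℝ) / 14)) ^ (-(6 + 4 * (2 : ℝ))) = L := by
      rw [← Real.rpow_mul (by linarith)]
      norm_num
    rw [hscale, h8]
    calc 3 / 16 * π * Real.exp (2 * (c0 - 1 - Real.log 6)) * L
        = 3 / 4 * π * Real.exp (2 * (c0 - 1 - Real.log 6)) * (L / 4) := by ring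
      _ ≤ _ := by gcongr
  · refine ⟨π * Real.exp (β * (c0 - 1 - Real.log 6)), by positivity, ?_⟩
    obtain ⟨γ, hγ⟩ : ∃ γ, γ = (β - 2) / (6 + 4 * β) := ⟨_, rfl⟩
    have hγ1 : γ * 4 < 1 := by
      rw [hγ, div_mul_eq_mul_div, div_lt_one (by linarith)]
      linarith
    have hγ2 : γ * -(6 + 4 * β) = 2 - β := by
      rw [hγ]
      field_simp
      ring
    have h3 := (Real.continuousAt_rpow_const 0 (1 - γ * 4) (Or.inr (by linarith))).tendsto
    rw [Real.zero_rpow (by linarith)] at h3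
    have h4 : ∀ᶠ lam in 𝓝[>] (0 : ℝ), lam ^ (1 - γ * 4) < 1 / 4 :=
      (h3.mono_left nhdsWithin_le_nhds).eventually (gt_mem_nhds (by norm_num))
    filter_upwards [h4, self_mem_nhdsWithin] with lam h4 hl
    have hl : 0 < lam := hl
    have hscale : dipoleScale β lam = lam ^ γ := by
      rw [dipoleScale, if_neg h2.ne', hγ]
    have h5 : 4 * lam < dipoleScale β lam ^ 4 := by
      rw [hscale, ← Real.rpow_mul_natCast hl.le]
      calc 4 * lam = 4 * lam ^ (1 - γ * 4) * lam ^ (γ * 4) := by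
            rw [mul_assoc, ← Real.rpow_add hl, sub_add_cancel, Real.rpow_one]
        _ < 1 * lam ^ (γ * 4) := by gcongr; linarith
        _ = _ := by norm_num
    refine ⟨h5, ?_⟩
    have h6 := dipoleMass_ge_pow hl (by linarith : (0 : ℝ) ≤ β)
      (show lam ≤ dipoleScale β lam ^ 4 by linarith)
    rw [← hγ2, Real.rpow_mul hl.le, ← hscale] at h6
    exact h6

end scale

section generic
variable {ι : Type} [Fintype ι]

lemma phi1_eq_of_nearest {z : ι → E2} {i j : ι} (hji : j ≠ i)
    (hj : ∀ k, k ≠ i → k ≠ j → dist (z i) (z j) < dist (z i) (z k)) : phi1 z i = j := by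
  have hex : ∃! j, j ≠ i ∧ ∀ k, k ≠ i → dist (z i) (z j) ≤ dist (z i) (z k) := by
    refine ⟨j, ⟨hji, fun k hk => ?_⟩, fun k hk => ?_⟩
    · by_cases hkj : k = j
      · rw [hkj]
      · exact (hj k hk hkj).le
    · by_contra hkj
      exact (hj k hk.1 hkj).not_ge (hk.2 j hji)
  unfold phi1
  rw [dif_pos hex]
  by_contra hc
  have h1 := hex.choose_spec.1
  exact (hj _ h1.1 hc).not_ge (h1.2 j hji)

lemma isNearest_phi1 [Nontrivial ι] {z : ι → E2}
    (hz : ∀ i j k, j ≠ i → k ≠ i → j ≠ k → dist (z i) (z j) ≠ dist (z i) (z k)) :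
    IsNearest z (phi1 z) := by
  intro i
  obtain ⟨j₀, hj₀⟩ := exists_ne i
  obtain ⟨j, hj, hmin⟩ := (Finset.univ.erase i).exists_min_image (fun j => dist (z i) (z j))
    ⟨j₀, Finset.mem_erase.2 ⟨hj₀, Finset.mem_univ _⟩⟩
  have hji : j ≠ i := Finset.ne_of_mem_erase hj
  have hlt : ∀ k, k ≠ i → k ≠ j → dist (z i) (z j) < dist (z i) (z k) := fun k hk hkj =>
    lt_of_le_of_ne (hmin k (Finset.mem_erase.2 ⟨hk, Finset.mem_univ _⟩)) (hz i j k hji hk hkj.symm)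
  rw [phi1_eq_of_nearest hji hlt]
  exact ⟨hji, hlt⟩

lemma volume_dist_eq {i j k : ι} (hk : k ≠ i) (hj : j ≠ k) :
    volume {z : ι → E2 | dist (z i) (z j) = dist (z i) (z k)} = 0 := by
  have hm : MeasurableSet {z : ι → E2 | dist (z i) (z j) = dist (z i) (z k)} :=
    measurableSet_eq_fun (by fun_prop) (by fun_prop)
  have hf : Measurable (Set.indicator {z : ι → E2 | dist (z i) (z j) = dist (z i) (z k)}
    (fun _ => (1 : ℝ≥0∞))) := measurable_const.indicator hm
  rw [← lintegral_indicator_one hm, volume_pi, lintegral_eq_lmarginal_univ (0 : ι → E2)]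
  change (∫⋯∫⁻_Finset.univ, Set.indicator {z : ι → E2 | dist (z i) (z j) = dist (z i) (z k)}
    (fun _ => (1 : ℝ≥0∞)) ∂fun _ => volume) 0 = 0
  rw [lmarginal_erase' _ hf (Finset.mem_univ k)]
  have h0 : (fun x : ι → E2 => ∫⁻ y, Set.indicator {z : ι → E2 |
      dist (z i) (z j) = dist (z i) (z k)} (fun _ => (1 : ℝ≥0∞)) (Function.update x k y)) =
      fun _ => 0 := by
    funext x
    have h1 : (fun y => Set.indicator {z : ι → E2 |
      dist (z i) (z j) = dist (z i) (z k)} (fun _ => (1 : ℝ≥0∞)) (Function.update x k y)) =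
      (Metric.sphere (x i) (dist (x i) (x j))).indicator (fun _ => 1) := by
      funext y
      simp only [Set.indicator, Set.mem_ofPred_eq, Function.update_self,
        Function.update_of_ne hk.symm, Function.update_of_ne hj, mem_sphere_iff_norm]
      rw [dist_comm (x i) y, dist_eq_norm y (x i)]
      simp only [eq_comm]
    rw [h1, lintegral_indicator_const Metric.isClosed_sphere.measurableSet,
      Measure.addHaar_sphere, mul_zero]
  rw [h0]
  simp [lmarginal]

lemma ae_isNearest [Nontrivial ι] : ∀ᵐ z : ι → E2, IsNearest z (phi1 z) := by
  have h : ∀ᵐ z : ι → E2, ∀ i j k, j ≠ i → k ≠ i → j ≠ k →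
      dist (z i) (z j) ≠ dist (z i) (z k) := by
    simp only [ae_all_iff]
    intro i j k _ hk hj
    rw [ae_iff]
    simpa using volume_dist_eq hk hj
  filter_upwards [h] with z hz
  exact isNearest_phi1 hz

end generic

section sequential
variable {ι : Type} [Fintype ι] [DecidableEq ι] {μ : Measure E2} [SigmaFinite μ]

omit [Fintype ι] in
lemma le_lmarginal_sequential {w : ι → (ι → E2) → ℝ≥0∞} (hw : ∀ v, Measurable (w v))
    {rank : ι → ℕ}
    (hdep : ∀ v u, v ≠ u → rank v ≤ rank u → ∀ z x, w v (Function.update z u x) = w v z)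
    {m : ι → ℝ≥0∞} (hm : ∀ v z, m v ≤ ∫⁻ x, w v (Function.update z v x) ∂μ) (n : ℕ) :
    ∀ A : Finset ι, A.card = n → ∀ z,
      ∏ v ∈ A, m v ≤ (∫⋯∫⁻_A, (fun z => ∏ v ∈ A, w v z) ∂(fun _ => μ)) z := by
  induction n with
  | zero =>
    intro A hA z
    rw [Finset.card_eq_zero] at hA
    subst hA
    simp
  | succ n ih =>
    intro A hA z
    obtain ⟨v, hv, hmax⟩ := Finset.exists_max_image A rank (Finset.card_pos.1 (by omega))
    have hm' : ∀ A : Finset ι, Measurable fun z => ∏ v ∈ A, w v z := fun A =>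
      Finset.measurable_fun_prod A fun v _ => hw v
    rw [lmarginal_erase' _ (hm' A) hv, ← Finset.mul_prod_erase A _ hv]
    have h1 : (fun x => m v * ∏ u ∈ A.erase v, w u x) ≤
        fun x => ∫⁻ xi, (fun z => ∏ v ∈ A, w v z) (Function.update x v xi) ∂μ := by
      intro x
      have h2 : ∀ xi, ∏ u ∈ A, w u (Function.update x v xi) =
          w v (Function.update x v xi) * ∏ u ∈ A.erase v, w u x := by
        intro xi
        rw [← Finset.mul_prod_erase A _ hv]
        congr 1
        exact Finset.prod_congr rfl fun u hu =>
          hdep u v (Finset.ne_of_mem_erase hu) (hmax u (Finset.mem_of_mem_erase hu)) _ _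
      simp only [h2]
      have h4 : Measurable fun xi => w v (Function.update x v xi) :=
        (hw v).comp (measurable_update x)
      rw [lintegral_mul_const _ h4]
      exact mul_le_mul_left (hm v x) _
    refine le_trans ?_ (lmarginal_mono h1 z)
    have h3 : (∫⋯∫⁻_A.erase v, (fun x => m v * ∏ u ∈ A.erase v, w u x) ∂(fun _ => μ)) z =
        m v * (∫⋯∫⁻_A.erase v, (fun x => ∏ u ∈ A.erase v, w u x) ∂(fun _ => μ)) z := by
      unfold lmarginal
      rw [lintegral_const_mul]
      exact (hm' _).comp measurable_updateFinset
    rw [h3]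
    gcongr _ * ?_
    exact ih _ (by rw [Finset.card_erase_of_mem hv]; omega) z

lemma le_lintegral_sequential {w : ι → (ι → E2) → ℝ≥0∞} (hw : ∀ v, Measurable (w v))
    {rank : ι → ℕ}
    (hdep : ∀ v u, v ≠ u → rank v ≤ rank u → ∀ z x, w v (Function.update z u x) = w v z)
    {m : ι → ℝ≥0∞} (hm : ∀ v z, m v ≤ ∫⁻ x, w v (Function.update z v x) ∂μ) :
    ∏ v, m v ≤ ∫⁻ z, ∏ v, w v z ∂(Measure.pi fun _ => μ) := by
  rw [lintegral_eq_lmarginal_univ (0 : ι → E2)]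
  exact le_lmarginal_sequential hw hdep hm _ Finset.univ rfl 0

end sequential

section box

lemma volume_square (a b : ℝ) :
    volume {x : E2 | ∀ i, x i ∈ Set.Icc a b} = ENNReal.ofReal (b - a) ^ 2 := by
  have h : {x : E2 | ∀ i, x i ∈ Set.Icc a b} =
      (WithLp.ofLp : E2 → Fin 2 → ℝ) ⁻¹' (Set.Icc (fun _ => a) (fun _ => b)) := by
    ext x
    simp only [Set.mem_ofPred_eq, Set.mem_preimage, Set.mem_Icc, Pi.le_def, forall_and]
  rw [h, (PiLp.volume_preserving_ofLp (Fin 2)).measure_preimage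
    measurableSet_Icc.nullMeasurableSet, Real.volume_Icc_pi]
  simp

lemma measurableSet_square (a b : ℝ) : MeasurableSet {x : E2 | ∀ i, x i ∈ Set.Icc a b} := by
  have h : IsClosed {x : E2 | ∀ i, x i ∈ Set.Icc a b} := by
    simp only [Set.ofPred_forall]
    exact isClosed_iInter fun i => isClosed_Icc.preimage (by fun_prop)
  exact h.measurableSet

lemma volume_LamBox (N : ℕ) : volume (LamBox N) = N := by
  unfold LamBox
  rw [volume_square, sub_zero, ← ENNReal.ofReal_pow (Real.sqrt_nonneg _),
    Real.sq_sqrt (Nat.cast_nonneg _), ENNReal.ofReal_natCast]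

end box

section paired
variable {N : ℕ} {β lam e : ℝ}

/-- The index of the pair containing a point. -/
def pairIndex : Fin N ⊕ Fin N → Fin N := Sum.elim id id

/-- Configurations in which `x_i` and `y_i` are close and distinct pairs are far apart. -/
def pairedSet (N : ℕ) (e : ℝ) : Set (Fin N ⊕ Fin N → E2) :=
  {z | (∀ i, dist (z (.inl i)) (z (.inr i)) < e) ∧
    ∀ v w, pairIndex v ≠ pairIndex w → e ≤ dist (z v) (z w)}

/-- The product of the dipole weights of a paired configuration. -/
def pairedWeight (β lam : ℝ) (z : Fin N ⊕ Fin N → E2) : ℝ≥0∞ :=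
  ∏ i, ENNReal.ofReal (Real.exp (β * gsm lam (z (.inl i) - z (.inr i))))

/-- The uniform measure on configurations in the box. -/
def boxMeasure (N : ℕ) : Measure (Fin N ⊕ Fin N → E2) :=
  Measure.pi fun _ => volume.restrict (LamBox N)

lemma boxMeasure_eq : boxMeasure N = volume.restrict (Set.univ.pi fun _ => LamBox N) := by
  rw [boxMeasure, volume_pi, Measure.restrict_pi_pi]

lemma measurableSet_LamBox : MeasurableSet (LamBox N) := measurableSet_square _ _

lemma measurableSet_pairedSet : MeasurableSet (pairedSet N e) := by
  unfold pairedSet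
  simp only [Set.ofPred_and, Set.ofPred_forall]
  refine MeasurableSet.inter (MeasurableSet.iInter fun i => ?_)
    (MeasurableSet.iInter fun v => MeasurableSet.iInter fun w => MeasurableSet.iInter fun _ => ?_)
  · exact measurableSet_lt (by fun_prop) measurable_const
  · exact measurableSet_le measurable_const (by fun_prop)

lemma measurable_pairedWeight (hl : 0 < lam) :
    Measurable (pairedWeight β lam : (Fin N ⊕ Fin N → E2) → ℝ≥0∞) := by
  have := measurable_gsm hl
  unfold pairedWeight
  fun_prop

/-- Successive placement constraints for the construction of well separated dipoles. -/
def placeSet (N : ℕ) (e : ℝ) : Fin N ⊕ Fin N → Set (Fin N ⊕ Fin N → E2)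
  | .inl i => {z | (∀ k, z (.inl i) k ∈ Set.Icc e (√N - e)) ∧
      ∀ j < i, 3 * e ≤ dist (z (.inl i)) (z (.inl j))}
  | .inr i => {z | dist (z (.inl i)) (z (.inr i)) < e}

/-- Sequential weights for the construction of well separated dipoles. -/
def placeWeight (N : ℕ) (β lam e : ℝ) : Fin N ⊕ Fin N → (Fin N ⊕ Fin N → E2) → ℝ≥0∞
  | .inl i => (placeSet N e (.inl i)).indicator 1
  | .inr i => (placeSet N e (.inr i)).indicator
      fun z => ENNReal.ofReal (Real.exp (β * gsm lam (z (.inl i) - z (.inr i))))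

lemma measurable_placeWeight (hl : 0 < lam) (v : Fin N ⊕ Fin N) :
    Measurable (placeWeight N β lam e v) := by
  rcases v with i | i
  · refine Measurable.indicator measurable_one ?_
    simp only [placeSet, Set.ofPred_and, Set.ofPred_forall]
    refine MeasurableSet.inter (MeasurableSet.iInter fun k => ?_)
      (MeasurableSet.iInter fun j => MeasurableSet.iInter fun _ => ?_)
    · exact measurableSet_Icc.preimage (by fun_prop)
    · exact measurableSet_le measurable_const (by fun_prop)
  · have := measurable_gsm hl
    refine Measurable.indicator (by fun_prop) ?_
    simp only [placeSet]
    exact measurableSet_lt (by fun_prop) measurable_const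

lemma placeWeight_update {v u : Fin N ⊕ Fin N} (hvu : v ≠ u)
    (hr : Sum.elim (fun i : Fin N => (i : ℕ)) (fun _ => N) v ≤
      Sum.elim (fun i : Fin N => (i : ℕ)) (fun _ => N) u) (z : Fin N ⊕ Fin N → E2) (x : E2) :
    placeWeight N β lam e v (Function.update z u x) = placeWeight N β lam e v z := by
  rcases v with i | i
  · have h1 : ∀ j ≤ i, (Sum.inl j : Fin N ⊕ Fin N) ≠ u := by
      rintro j hj rfl
      simp only [Sum.elim_inl] at hr
      have : j = i := le_antisymm hj hr
      exact hvu (by rw [this])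
    have h2 : Function.update z u x ∈ placeSet N e (.inl i) ↔ z ∈ placeSet N e (.inl i) := by
      simp only [placeSet, Set.mem_ofPred_eq, Function.update_of_ne (h1 i le_rfl)]
      refine and_congr Iff.rfl (forall₂_congr fun j hj => ?_)
      rw [Function.update_of_ne (h1 j hj.le)]
    simp only [placeWeight, Set.indicator, h2, Pi.one_apply]
  · have h1 : ∀ j, (Sum.inl j : Fin N ⊕ Fin N) ≠ u := by
      rintro j rfl
      simp only [Sum.elim_inl, Sum.elim_inr] at hr
      have := j.isLt
      omega
    have h2 : Function.update z u x ∈ placeSet N e (.inr i) ↔ z ∈ placeSet N e (.inr i) := by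
      simp only [placeSet, Set.mem_ofPred_eq, Function.update_of_ne hvu,
        Function.update_of_ne (h1 i)]
    simp only [placeWeight, Set.indicator, h2, Function.update_of_ne hvu,
      Function.update_of_ne (h1 i)]

lemma lintegral_placeWeight_inr (i : Fin N) (z : Fin N ⊕ Fin N → E2) :
    ∫⁻ x, placeWeight N β lam e (.inr i) (Function.update z (.inr i) x) =
      dipoleMass β lam e := by
  have h1 : ∀ x, placeWeight N β lam e (.inr i) (Function.update z (.inr i) x) =
      (Metric.ball (0 : E2) e).indicator
        (fun u => ENNReal.ofReal (Real.exp (β * gsm lam u))) (z (.inl i) - x) := by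
    intro x
    simp only [placeWeight, placeSet, Set.indicator, Set.mem_ofPred_eq, Function.update_self, ne_eq,
      reduceCtorEq, not_false_eq_true, Function.update_of_ne, mem_ball_zero_iff, dist_eq_norm]
  simp only [h1]
  rw [lintegral_sub_left_eq_self (fun u => (Metric.ball (0 : E2) e).indicator
        (fun u => ENNReal.ofReal (Real.exp (β * gsm lam u))) u),
    lintegral_indicator measurableSet_ball, dipoleMass]

lemma le_lintegral_placeWeight_inl (he : 0 ≤ e) (heN : 2 * e ≤ √N) {q : ℝ}
    (hq : N * q ≤ (√N - 2 * e) ^ 2 - 9 * π * e ^ 2 * N) (i : Fin N)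
    (z : Fin N ⊕ Fin N → E2) :
    ENNReal.ofReal (N * q) ≤
      ∫⁻ x, placeWeight N β lam e (.inl i) (Function.update z (.inl i) x) := by
  obtain ⟨S, hS⟩ : ∃ S, S = {x : E2 | ∀ k, x k ∈ Set.Icc e (√N - e)} := ⟨_, rfl⟩
  obtain ⟨U, hU⟩ : ∃ U, U = ⋃ j : Fin N, Metric.ball (z (.inl j)) (3 * e) := ⟨_, rfl⟩
  have hUm : MeasurableSet U := by
    rw [hU]
    exact MeasurableSet.iUnion fun j => measurableSet_ball
  have hSm : MeasurableSet S := by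
    rw [hS]
    exact measurableSet_square _ _
  have hUv : volume U ≤ ENNReal.ofReal (9 * π * e ^ 2 * N) := by
    rw [hU]
    refine (measure_iUnion_fintype_le _ _).trans ?_
    simp only [volume_ball_E2 _ (show 0 ≤ 3 * e by positivity), Finset.sum_const, Finset.card_univ,
      Fintype.card_fin, nsmul_eq_mul]
    rw [← ENNReal.ofReal_natCast, ← ENNReal.ofReal_mul (by positivity)]
    refine ENNReal.ofReal_le_ofReal (le_of_eq ?_)
    ring
  have hSv : volume S = ENNReal.ofReal ((√N - 2 * e) ^ 2) := by
    rw [hS, volume_square, ← ENNReal.ofReal_pow (by linarith)]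
    congr 2
    ring
  have h1 : ENNReal.ofReal (N * q) ≤ volume (S \ U) := by
    refine le_trans ?_ (le_measure_sdiff)
    rw [hSv]
    refine le_trans ?_ (tsub_le_tsub_left hUv _)
    rw [← ENNReal.ofReal_sub _ (by positivity)]
    exact ENNReal.ofReal_le_ofReal hq
  refine h1.trans ?_
  rw [← lintegral_indicator_one (hSm.diff hUm)]
  refine lintegral_mono fun x => ?_
  by_cases hx : x ∈ S \ U
  swap
  · rw [Set.indicator_of_notMem hx]
    exact zero_le
  rw [Set.indicator_of_mem hx, placeWeight, Set.indicator_of_mem (s := placeSet N e (.inl i))]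
  · exact le_rfl
  simp only [placeSet, Set.mem_ofPred_eq, Function.update_self]
  rw [hS, hU] at hx
  refine ⟨hx.1, fun j hj => ?_⟩
  have hne : (Sum.inl j : Fin N ⊕ Fin N) ≠ .inl i := by simpa using hj.ne
  rw [Function.update_of_ne hne]
  by_contra hc
  exact hx.2 (Set.mem_iUnion.2 ⟨j, Metric.mem_ball.2 (not_le.1 hc)⟩)

lemma prod_placeWeight_le (he : 0 < e) (z : Fin N ⊕ Fin N → E2) :
    ∏ v, placeWeight N β lam e v z ≤
      (pairedSet N e ∩ Set.univ.pi fun _ => LamBox N).indicator (pairedWeight β lam) z := by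
  by_cases h0 : ∃ v, placeWeight N β lam e v z = 0
  · obtain ⟨v, hv⟩ := h0
    rw [Finset.prod_eq_zero (Finset.mem_univ v) hv]
    exact zero_le
  push Not at h0
  have hx : ∀ i, (∀ k, z (.inl i) k ∈ Set.Icc e (√N - e)) ∧
      ∀ j < i, 3 * e ≤ dist (z (.inl i)) (z (.inl j)) := by
    intro i
    by_contra hc
    exact h0 (.inl i) (Set.indicator_of_notMem (s := placeSet N e (.inl i)) hc _)
  have hy : ∀ i, dist (z (.inl i)) (z (.inr i)) < e := by
    intro i
    by_contra hc
    refine h0 (.inr i) ?_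
    rw [placeWeight, Set.indicator_of_notMem (s := placeSet N e (.inr i)) hc]
  have hxx : ∀ i j, i ≠ j → 3 * e ≤ dist (z (.inl i)) (z (.inl j)) := by
    intro i j hij
    rcases lt_or_gt_of_ne hij with h | h
    · rw [dist_comm]
      exact (hx j).2 i h
    · exact (hx i).2 j h
  have hdist : ∀ v, dist (z (.inl (pairIndex v))) (z v) < e := by
    rintro (i | i)
    · simpa [pairIndex] using he
    · exact hy i
  have hmem : z ∈ pairedSet N e ∩ Set.univ.pi fun _ => LamBox N := by
    refine ⟨⟨hy, fun v w hvw => ?_⟩, fun v _ k => ?_⟩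
    · have h1 := hxx _ _ hvw
      have h2 := hdist v
      have h3 := hdist w
      have h4 := dist_triangle4 (z (.inl (pairIndex v))) (z v) (z w) (z (.inl (pairIndex w)))
      rw [dist_comm (z w)] at h4
      linarith
    · have h1 := (hx (pairIndex v)).1 k
      have h2 : |z (.inl (pairIndex v)) k - z v k| < e := by
        have h3 := PiLp.norm_apply_le (z (.inl (pairIndex v)) - z v) k
        have h4 := hdist v
        rw [dist_eq_norm] at h4
        exact lt_of_le_of_lt h3 h4
      rw [abs_lt] at h2
      rw [Set.mem_Icc] at h1 ⊢
      constructor <;> linarith [h1.1, h1.2, h2.1, h2.2]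
  rw [Set.indicator_of_mem hmem, Fintype.prod_sum_type, pairedWeight]
  have h1 : ∀ i, placeWeight N β lam e (.inl i) z = 1 := fun i =>
    Set.indicator_of_mem (s := placeSet N e (.inl i)) (hx i) _
  have h2 : ∀ i, placeWeight N β lam e (.inr i) z =
      ENNReal.ofReal (Real.exp (β * gsm lam (z (.inl i) - z (.inr i)))) := fun i => by
    rw [placeWeight, Set.indicator_of_mem (s := placeSet N e (.inr i)) (hy i)]
  simp only [h1, h2, Finset.prod_const_one, one_mul, le_refl]

lemma le_setLIntegral_pairedWeight (hl : 0 < lam) (he : 0 < e) (heN : 2 * e ≤ √N) {q : ℝ}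
    (hq : N * q ≤ (√N - 2 * e) ^ 2 - 9 * π * e ^ 2 * N) :
    (ENNReal.ofReal (N * q) * dipoleMass β lam e) ^ N ≤
      ∫⁻ z in pairedSet N e, pairedWeight β lam z ∂(boxMeasure N) := by
  have h1 := le_lintegral_sequential (μ := (volume : Measure E2))
    (w := placeWeight N β lam e) (measurable_placeWeight hl)
    (rank := Sum.elim (fun i : Fin N => (i : ℕ)) (fun _ => N))
    (fun v u hvu hr z x => placeWeight_update hvu hr z x)
    (m := Sum.elim (fun _ => ENNReal.ofReal (N * q)) (fun _ => dipoleMass β lam e))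
    (by
      rintro (i | i) z
      · exact le_lintegral_placeWeight_inl he.le heN hq i z
      · exact (lintegral_placeWeight_inr i z).ge)
  rw [Fintype.prod_sum_type] at h1
  simp only [Sum.elim_inl, Sum.elim_inr, Finset.prod_const, Finset.card_univ,
    Fintype.card_fin] at h1
  rw [← mul_pow] at h1
  refine h1.trans ((lintegral_mono (prod_placeWeight_le he)).trans (le_of_eq ?_))
  have hbox : MeasurableSet (Set.univ.pi fun _ : Fin N ⊕ Fin N => LamBox N) :=
    MeasurableSet.univ_pi fun _ => measurableSet_LamBox
  rw [lintegral_indicator (measurableSet_pairedSet.inter hbox), boxMeasure_eq,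
    Measure.restrict_restrict measurableSet_pairedSet, volume_pi]

end paired

section reindex
variable {ι : Type} [Fintype ι] {lam : ℝ}

lemma lintegral_pi_comp_perm (m : Measure E2) [SigmaFinite m] (e : Equiv.Perm ι)
    (F : (ι → E2) → ℝ≥0∞) :
    ∫⁻ z, F (fun v => z (e v)) ∂(Measure.pi fun _ : ι => m) =
      ∫⁻ z, F z ∂(Measure.pi fun _ : ι => m) := by
  have h := measurePreserving_piCongrLeft (α := fun _ : ι => E2) (fun _ => m) e
  rw [← h.lintegral_comp_emb (MeasurableEquiv.measurableEmbedding _)]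
  refine lintegral_congr fun z => ?_
  congr 1
  funext v
  exact MeasurableEquiv.piCongrLeft_apply_apply (β := fun _ : ι => E2) e z v

lemma pairEnergy_eq_sum_ite (d : ι → ℝ) (z : ι → E2) :
    pairEnergy lam d z =
      ∑ v, ∑ w, if w ≠ v then d v * d w * gsm lam (z v - z w) else 0 := by
  unfold pairEnergy
  refine Finset.sum_congr rfl fun v _ => ?_
  rw [← Finset.sum_filter]
  refine Finset.sum_congr ?_ fun _ _ => rfl
  ext w
  simp

lemma pairEnergy_comp_perm (e : Equiv.Perm ι) (d : ι → ℝ) (z : ι → E2) :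
    pairEnergy lam (fun v => d (e v)) (fun v => z (e v)) = pairEnergy lam d z := by
  rw [pairEnergy_eq_sum_ite, pairEnergy_eq_sum_ite]
  conv_rhs => rw [← Equiv.sum_comp e]
  refine Finset.sum_congr rfl fun v _ => ?_
  conv_rhs => rw [← Equiv.sum_comp e]
  refine Finset.sum_congr rfl fun w _ => ?_
  simp only [ne_eq, EmbeddingLike.apply_eq_iff_eq]

end reindex

section swap
variable {N : ℕ} {β lam e : ℝ}

/-- The Boltzmann weight without self-interactions. -/
def gibbsWeight (β lam : ℝ) (z : Fin N ⊕ Fin N → E2) : ℝ≥0∞ :=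
  ENNReal.ofReal (Real.exp (-(β / 2) * pairEnergy lam charge z))

lemma measurable_pairEnergy (hl : 0 < lam) (d : Fin N ⊕ Fin N → ℝ) :
    Measurable fun z : Fin N ⊕ Fin N → E2 => pairEnergy lam d z := by
  have := measurable_gsm hl
  unfold pairEnergy
  fun_prop

lemma measurable_gibbsWeight (hl : 0 < lam) :
    Measurable (gibbsWeight β lam : (Fin N ⊕ Fin N → E2) → ℝ≥0∞) := by
  have := measurable_pairEnergy (N := N) hl charge
  unfold gibbsWeight
  fun_prop

/-- Exchange the two points of each pair selected by `s`. -/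
def swapPerm (s : Fin N → Bool) : Equiv.Perm (Fin N ⊕ Fin N) where
  toFun v := bif s (pairIndex v) then v.swap else v
  invFun v := bif s (pairIndex v) then v.swap else v
  left_inv v := by
    rcases v with i | i <;> cases h : s i <;> simp [pairIndex, h]
  right_inv v := by
    rcases v with i | i <;> cases h : s i <;> simp [pairIndex, h]

/-- The sign attached to a choice. -/
def choiceSign (b : Bool) : ℝ := bif b then -1 else 1

lemma pairIndex_swapPerm (s : Fin N → Bool) (v : Fin N ⊕ Fin N) :
    pairIndex (swapPerm s v) = pairIndex v := by
  rcases v with i | i <;> cases h : s i <;> simp [swapPerm, pairIndex, h]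

lemma charge_swapPerm (s : Fin N → Bool) (v : Fin N ⊕ Fin N) :
    charge (swapPerm s v) = choiceSign (s (pairIndex v)) * charge v := by
  rcases v with i | i <;> cases h : s i <;> simp [swapPerm, pairIndex, choiceSign, charge, h]

lemma choiceSign_mul_self (b : Bool) : choiceSign b * choiceSign b = 1 := by
  cases b <;> simp [choiceSign]

lemma sum_choiceSign_mul (i j : Fin N) :
    ∑ s : Fin N → Bool, choiceSign (s i) * choiceSign (s j) = if i = j then 2 ^ N else 0 := by
  split_ifs with h
  · subst h
    simp [choiceSign_mul_self]
  · refine Finset.sum_involution (fun s _ => Function.update s i (!s i)) ?_ ?_ ?_ ?_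
    · intro s _
      rw [Function.update_self, Function.update_of_ne (Ne.symm h)]
      cases s i <;> simp [choiceSign]
    · intro s _ _ h2
      have := congrFun h2 i
      simp at this
    · intro s _
      exact Finset.mem_univ _
    · intro s _
      simp

lemma sum_pairEnergy_swapPerm (hl : 0 < lam) (z : Fin N ⊕ Fin N → E2) :
    ∑ s : Fin N → Bool, pairEnergy lam charge (fun v => z (swapPerm s v)) =
      2 ^ N * (-2 * ∑ i, gsm lam (z (.inl i) - z (.inr i))) := by
  have h1 : ∀ s : Fin N → Bool, pairEnergy lam charge (fun v => z (swapPerm s v)) =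
      ∑ v, ∑ w, if w ≠ v then choiceSign (s (pairIndex v)) * choiceSign (s (pairIndex w)) *
        (charge v * charge w * gsm lam (z v - z w)) else 0 := by
    intro s
    have h2 : (charge : Fin N ⊕ Fin N → ℝ) =
        fun v => (fun w => choiceSign (s (pairIndex w)) * charge w) (swapPerm s v) := by
      funext v
      simp only [charge_swapPerm, pairIndex_swapPerm]
      rw [← mul_assoc, choiceSign_mul_self, one_mul]
    conv_lhs => rw [h2]
    rw [pairEnergy_comp_perm (swapPerm s) fun w => choiceSign (s (pairIndex w)) * charge w,
      pairEnergy_eq_sum_ite]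
    refine Finset.sum_congr rfl fun v _ => Finset.sum_congr rfl fun w _ => ?_
    split_ifs
    · ring
    · rfl
  simp only [h1]
  rw [Finset.sum_comm]
  have h3 : ∀ v : Fin N ⊕ Fin N, ∑ s : Fin N → Bool, ∑ w, (if w ≠ v then
      choiceSign (s (pairIndex v)) * choiceSign (s (pairIndex w)) *
        (charge v * charge w * gsm lam (z v - z w)) else 0) =
      ∑ w, if w ≠ v ∧ pairIndex v = pairIndex w then
        2 ^ N * (charge v * charge w * gsm lam (z v - z w)) else 0 := by
    intro v
    rw [Finset.sum_comm]
    refine Finset.sum_congr rfl fun w _ => ?_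
    by_cases hw : w ≠ v
    · simp only [if_pos hw]
      rw [← Finset.sum_mul, sum_choiceSign_mul]
      by_cases hp : pairIndex v = pairIndex w
      · rw [if_pos hp, if_pos ⟨hw, hp⟩]
      · rw [if_neg hp, if_neg (fun h => hp h.2), zero_mul]
    · simp only [if_neg hw, Finset.sum_const_zero]
      rw [if_neg (fun h => hw h.1)]
  rw [Finset.sum_congr rfl fun v _ => h3 v]
  simp only [Fintype.sum_sum_type, pairIndex, charge, Sum.elim_inl, Sum.elim_inr, id_eq]
  have h4 : ∀ i j : Fin N, ¬ ((Sum.inl j : Fin N ⊕ Fin N) ≠ .inl i ∧ i = j) := by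
    rintro i j ⟨h, rfl⟩
    exact h rfl
  have h5 : ∀ i j : Fin N, ¬ ((Sum.inr j : Fin N ⊕ Fin N) ≠ .inr i ∧ i = j) := by
    rintro i j ⟨h, rfl⟩
    exact h rfl
  simp only [h4, h5, if_false, Finset.sum_const_zero, zero_add, add_zero, ne_eq, reduceCtorEq,
    not_false_eq_true, true_and, Finset.sum_ite_eq, Finset.mem_univ, if_true]
  have h6 : ∀ i : Fin N, gsm lam (z (.inr i) - z (.inl i)) = gsm lam (z (.inl i) - z (.inr i)) := by
    intro i
    rw [← gsm_neg hl, neg_sub]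
  simp only [h6]
  rw [← Finset.sum_add_distrib, Finset.mul_sum, Finset.mul_sum]
  refine Finset.sum_congr rfl fun i _ => ?_
  ring

lemma two_pow_mul_pairedWeight_le (hl : 0 < lam) (z : Fin N ⊕ Fin N → E2) :
    2 ^ N * pairedWeight β lam z ≤
      ∑ s : Fin N → Bool, gibbsWeight β lam (fun v => z (swapPerm s v)) := by
  unfold pairedWeight gibbsWeight
  rw [← ENNReal.ofReal_prod_of_nonneg (fun _ _ => (Real.exp_pos _).le), ← Real.exp_sum,
    ← ENNReal.ofReal_sum_of_nonneg (fun _ _ => (Real.exp_pos _).le),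
    show (2 : ℝ≥0∞) ^ N = ENNReal.ofReal 2 ^ N by simp, ← ENNReal.ofReal_pow (by norm_num),
    ← ENNReal.ofReal_mul (by positivity)]
  refine ENNReal.ofReal_le_ofReal ?_
  obtain ⟨A, hA⟩ : ∃ A, A = ∑ i, β * gsm lam (z (.inl i) - z (.inr i)) := ⟨_, rfl⟩
  rw [← hA]
  have h1 : ∀ s : Fin N → Bool,
      Real.exp A * (1 + (-(β / 2) * pairEnergy lam charge (fun v => z (swapPerm s v)) - A)) ≤
        Real.exp (-(β / 2) * pairEnergy lam charge (fun v => z (swapPerm s v))) := by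
    intro s
    have h2 := Real.add_one_le_exp
      (-(β / 2) * pairEnergy lam charge (fun v => z (swapPerm s v)) - A)
    rw [Real.exp_sub, le_div_iff₀ (Real.exp_pos A)] at h2
    linarith
  refine le_trans (le_of_eq ?_) (Finset.sum_le_sum fun s _ => h1 s)
  rw [← Finset.mul_sum, Finset.sum_add_distrib, Finset.sum_sub_distrib, ← Finset.mul_sum,
    sum_pairEnergy_swapPerm hl]
  rw [← Finset.mul_sum] at hA
  simp only [Finset.sum_const, Finset.card_univ, Fintype.card_pi, Fintype.card_bool,
    Finset.prod_const, Fintype.card_fin, nsmul_eq_mul, hA]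
  push_cast
  ring

lemma swapPerm_mem_pairedSet (s : Fin N → Bool) (z : Fin N ⊕ Fin N → E2) :
    (fun v => z (swapPerm s v)) ∈ pairedSet N e ↔ z ∈ pairedSet N e := by
  have h1 : ∀ (s : Fin N → Bool) (z : Fin N ⊕ Fin N → E2), z ∈ pairedSet N e →
      (fun v => z (swapPerm s v)) ∈ pairedSet N e := by
    rintro s z ⟨ha, hb⟩
    refine ⟨fun i => ?_, fun v w hvw => hb _ _ ?_⟩
    · cases h : s i
      · simpa [swapPerm, pairIndex, h] using ha i
      · simpa [swapPerm, pairIndex, h, dist_comm] using ha i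
    · rwa [pairIndex_swapPerm, pairIndex_swapPerm]
  refine ⟨fun h => ?_, h1 s z⟩
  have h2 := h1 s _ h
  have h3 : (fun v => z (swapPerm s (swapPerm s v))) = z := by
    funext v
    exact congrArg z ((swapPerm s).left_inv v)
  rwa [h3] at h2

lemma setLIntegral_pairedWeight_le (hl : 0 < lam) :
    ∫⁻ z in pairedSet N e, pairedWeight β lam z ∂(boxMeasure N) ≤
      ∫⁻ z in pairedSet N e, gibbsWeight β lam z ∂(boxMeasure N) := by
  have h0 : (2 : ℝ≥0∞) ^ N ≠ 0 := by simp
  have h0' : (2 : ℝ≥0∞) ^ N ≠ ∞ := by simp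
  rw [← ENNReal.mul_le_mul_iff_right h0 h0',
    ← lintegral_const_mul _ (measurable_pairedWeight hl)]
  refine (lintegral_mono fun z => two_pow_mul_pairedWeight_le hl z).trans ?_
  rw [lintegral_finsetSum]
  swap
  · intro s _
    have := measurable_gibbsWeight (N := N) (β := β) hl
    fun_prop
  have h1 : ∀ s : Fin N → Bool,
      ∫⁻ z in pairedSet N e, gibbsWeight β lam (fun v => z (swapPerm s v)) ∂(boxMeasure N) =
        ∫⁻ z in pairedSet N e, gibbsWeight β lam z ∂(boxMeasure N) := by
    intro s
    rw [← lintegral_indicator measurableSet_pairedSet,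
      ← lintegral_indicator measurableSet_pairedSet]
    conv_rhs => rw [boxMeasure, ← lintegral_pi_comp_perm _ (swapPerm s)]
    refine lintegral_congr fun z => ?_
    by_cases hz : z ∈ pairedSet N e
    · rw [Set.indicator_of_mem hz, Set.indicator_of_mem ((swapPerm_mem_pairedSet s z).2 hz)]
    · rw [Set.indicator_of_notMem hz,
        Set.indicator_of_notMem (fun h => hz ((swapPerm_mem_pairedSet s z).1 h))]
  simp only [h1, Finset.sum_const, Finset.card_univ, Fintype.card_pi, Fintype.card_bool,
    Finset.prod_const, Fintype.card_fin, nsmul_eq_mul]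
  push_cast
  exact le_rfl

/-- Permute the negative charges. -/
def permuteNegative (σ : Equiv.Perm (Fin N)) : Equiv.Perm (Fin N ⊕ Fin N) :=
  Equiv.sumCongr (Equiv.refl _) σ

lemma gibbsWeight_permuteNegative (σ : Equiv.Perm (Fin N)) (z : Fin N ⊕ Fin N → E2) :
    gibbsWeight β lam (fun v => z (permuteNegative σ v)) = gibbsWeight β lam z := by
  have h : (charge : Fin N ⊕ Fin N → ℝ) = fun v => charge (permuteNegative σ v) := by
    funext v
    rcases v with i | i <;> simp [charge, permuteNegative]
  unfold gibbsWeight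
  rw [← pairEnergy_comp_perm (permuteNegative σ) charge z, ← h]

lemma factorial_mul_setLIntegral_le :
    (N.factorial : ℝ≥0∞) * ∫⁻ z in pairedSet N e, gibbsWeight β lam z ∂(boxMeasure N) ≤
      ∫⁻ z, gibbsWeight β lam z ∂(boxMeasure N) := by
  obtain ⟨S, hS⟩ : ∃ S : Equiv.Perm (Fin N) → Set (Fin N ⊕ Fin N → E2),
      S = fun σ => (fun z v => z (permuteNegative σ v)) ⁻¹' pairedSet N e := ⟨_, rfl⟩
  have hmem : ∀ σ z, z ∈ S σ ↔ (fun v => z (permuteNegative σ v)) ∈ pairedSet N e := by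
    intro σ z
    rw [hS]
    exact Iff.rfl
  have hm : ∀ σ, MeasurableSet (S σ) := by
    intro σ
    rw [hS]
    exact measurableSet_pairedSet.preimage (by fun_prop)
  have hd : Pairwise (Function.onFun Disjoint S) := by
    intro σ τ hst
    rw [Function.onFun, Set.disjoint_left]
    intro z h1 h2
    rw [hmem] at h1 h2
    refine hst (Equiv.ext fun i => ?_)
    by_contra hne
    have h3 := h1.2 (.inl i) (.inr (σ.symm (τ i))) (by
      simp only [pairIndex, Sum.elim_inl, Sum.elim_inr, id_eq]
      intro h
      exact hne (by rw [← σ.apply_symm_apply (τ i), ← h]))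
    have h4 := h2.1 i
    simp only [permuteNegative, Equiv.sumCongr_apply, Sum.map_inl, Sum.map_inr, Equiv.refl_apply,
      Equiv.apply_symm_apply] at h3 h4
    linarith
  have h1 : ∀ σ, ∫⁻ z in S σ, gibbsWeight β lam z ∂(boxMeasure N) =
      ∫⁻ z in pairedSet N e, gibbsWeight β lam z ∂(boxMeasure N) := by
    intro σ
    rw [← lintegral_indicator (hm σ), ← lintegral_indicator measurableSet_pairedSet]
    conv_rhs => rw [boxMeasure, ← lintegral_pi_comp_perm _ (permuteNegative σ)]
    refine lintegral_congr fun z => ?_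
    by_cases hz : (fun v => z (permuteNegative σ v)) ∈ pairedSet N e
    · rw [Set.indicator_of_mem hz, Set.indicator_of_mem ((hmem σ z).2 hz),
        gibbsWeight_permuteNegative]
    · rw [Set.indicator_of_notMem hz, Set.indicator_of_notMem (mt (hmem σ z).1 hz)]
  refine le_trans (le_of_eq ?_) (setLIntegral_le_lintegral (⋃ σ, S σ) _)
  rw [lintegral_iUnion hm hd, tsum_fintype]
  simp only [h1, Finset.sum_const, Finset.card_univ, Fintype.card_perm, Fintype.card_fin,
    nsmul_eq_mul]

/-- Lower bound on the partition function by well separated dipoles. -/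
lemma le_lintegral_gibbsWeight (hl : 0 < lam) (he : 0 < e) (heN : 2 * e ≤ √N) {q : ℝ}
    (hq : N * q ≤ (√N - 2 * e) ^ 2 - 9 * π * e ^ 2 * N) :
    (N.factorial : ℝ≥0∞) * (ENNReal.ofReal (N * q) * dipoleMass β lam e) ^ N ≤
      ∫⁻ z, gibbsWeight β lam z ∂(boxMeasure N) :=
  (mul_le_mul_right ((le_setLIntegral_pairedWeight hl he heN hq).trans
    (setLIntegral_pairedWeight_le hl)) _).trans factorial_mul_setLIntegral_le

end swap

section gibbs
variable {N : ℕ} {β lam : ℝ}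

lemma norm_le_of_mem_LamBox {x : E2} (hx : x ∈ LamBox N) : ‖x‖ ≤ 2 * √N := by
  have h0 := hx 0
  have h1 := hx 1
  rw [Set.mem_Icc] at h0 h1
  rw [EuclideanSpace.norm_eq, Fin.sum_univ_two]
  refine Real.sqrt_le_iff.2 ⟨by positivity, ?_⟩
  simp only [Real.norm_eq_abs, sq_abs]
  nlinarith [h0.1, h0.2, h1.1, h1.2, Real.sqrt_nonneg (N : ℝ)]

lemma exists_gsm_bound (hl : 0 < lam) (N : ℕ) :
    ∃ M, ∀ x ∈ LamBox N, ∀ y ∈ LamBox N, |gsm lam (x - y)| ≤ M := by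
  refine ⟨max |c0 + 2 - Real.log lam| |c0 - 1 - Real.log (2 * (4 * √N + 2 * lam))|,
    fun x hx y hy => ?_⟩
  have h1 := gsm_le hl (x - y)
  have h2 := gsm_ge hl (x - y)
  have h3 : ‖x - y‖ ≤ 4 * √N := by
    have := norm_sub_le x y
    have := norm_le_of_mem_LamBox hx
    have := norm_le_of_mem_LamBox hy
    linarith
  have h4 : Real.log (2 * (‖x - y‖ + 2 * lam)) ≤ Real.log (2 * (4 * √N + 2 * lam)) :=
    Real.log_le_log (by positivity) (by linarith)
  rw [abs_le]
  constructor
  · have h5 := neg_abs_le (c0 - 1 - Real.log (2 * (4 * √N + 2 * lam)))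
    have h6 := le_max_right |c0 + 2 - Real.log lam| |c0 - 1 - Real.log (2 * (4 * √N + 2 * lam))|
    linarith
  · exact h1.trans ((le_abs_self _).trans (le_max_left _ _))

lemma exists_pairEnergy_bound (hl : 0 < lam) (N : ℕ) :
    ∃ M, ∀ z : Fin N ⊕ Fin N → E2, (∀ v, z v ∈ LamBox N) → |pairEnergy lam charge z| ≤ M := by
  obtain ⟨M, hM⟩ := exists_gsm_bound hl N
  refine ⟨∑ v : Fin N ⊕ Fin N, ∑ w : Fin N ⊕ Fin N, |M|, fun z hz => ?_⟩
  rw [pairEnergy_eq_sum_ite]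
  refine (Finset.abs_sum_le_sum_abs _ _).trans (Finset.sum_le_sum fun v _ => ?_)
  refine (Finset.abs_sum_le_sum_abs _ _).trans (Finset.sum_le_sum fun w _ => ?_)
  have h1 : ∀ v : Fin N ⊕ Fin N, |charge v| = 1 := by
    rintro (i | i) <;> simp [charge]
  split_ifs
  · rw [abs_mul, abs_mul, h1, h1, one_mul, one_mul]
    exact (hM _ (hz v) _ (hz w)).trans (le_abs_self M)
  · rw [abs_zero]
    exact abs_nonneg M

lemma ae_boxMeasure_mem : ∀ᵐ z ∂(boxMeasure N), ∀ v, z v ∈ LamBox N := by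
  rw [boxMeasure_eq]
  filter_upwards [ae_restrict_mem (MeasurableSet.univ_pi fun _ => measurableSet_LamBox)] with z hz v
  exact hz v (Set.mem_univ v)

lemma lintegral_gibbsWeight_ne_top (hl : 0 < lam) :
    ∫⁻ z, gibbsWeight β lam z ∂(boxMeasure N) ≠ ∞ := by
  obtain ⟨M, hM⟩ := exists_pairEnergy_bound hl N
  have h1 : ∀ᵐ z ∂(boxMeasure N),
      gibbsWeight β lam z ≤ ENNReal.ofReal (Real.exp (|β / 2| * M)) := by
    filter_upwards [ae_boxMeasure_mem] with z hz
    refine ENNReal.ofReal_le_ofReal (Real.exp_le_exp.2 ?_)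
    refine (le_abs_self _).trans ?_
    rw [abs_mul, abs_neg]
    exact mul_le_mul_of_nonneg_left (hM z hz) (abs_nonneg _)
  refine ((lintegral_mono_ae h1).trans_lt ?_).ne
  rw [lintegral_const]
  refine ENNReal.mul_lt_top ENNReal.ofReal_lt_top ?_
  rw [boxMeasure, Measure.pi_univ]
  refine ENNReal.prod_lt_top fun _ _ => ?_
  rw [Measure.restrict_apply_univ, volume_LamBox]
  exact ENNReal.natCast_lt_top N

lemma Flam_eq (hl : 0 < lam) (X Y : Fin N → E2) :
    Flam N lam X Y = 1 / 2 * pairEnergy lam charge (zconf X Y) +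
      (N * gsm lam 0 - N * (-Real.log lam + kappa)) := by
  have h1 : ∑ v, ∑ w, charge v * charge w * gsm lam (zconf X Y v - zconf X Y w) =
      pairEnergy lam charge (zconf X Y) + 2 * N * gsm lam 0 := by
    have h2 : ∀ v : Fin N ⊕ Fin N, ∑ w, charge v * charge w * gsm lam (zconf X Y v - zconf X Y w) =
        (∑ w, if w ≠ v then
          charge v * charge w * gsm lam (zconf X Y v - zconf X Y w) else 0) + gsm lam 0 := by
      intro v
      have h5 : gsm lam 0 = ∑ w, if w = v then
          charge v * charge w * gsm lam (zconf X Y v - zconf X Y w) else 0 := by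
        rw [Finset.sum_ite_eq' Finset.univ v, if_pos (Finset.mem_univ v), charge_mul_self, sub_self,
          one_mul]
      rw [h5, ← Finset.sum_add_distrib]
      refine Finset.sum_congr rfl fun w _ => ?_
      by_cases h : w = v
      · rw [if_neg (not_not.2 h), if_pos h, zero_add]
      · rw [if_pos h, if_neg h, add_zero]
    simp only [h2]
    rw [Finset.sum_add_distrib, pairEnergy_eq_sum_ite]
    simp only [Finset.sum_const, Finset.card_univ, Fintype.card_sum, Fintype.card_fin, nsmul_eq_mul]
    rw [show (((N + N : ℕ) : ℝ) * gsm lam 0) = 2 * N * gsm lam 0 by push_cast; ring]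
    refine congrArg (· + _) (Finset.sum_congr rfl fun v _ => Finset.sum_congr rfl fun w _ => ?_)
    split_ifs <;> rfl
  have h3 : ∑ v, ∑ w, charge v * charge w * gsm lam (zconf X Y v - zconf X Y w) =
      ∑ i : Fin N, ∑ j : Fin N,
        (gsm lam (X i - X j) + gsm lam (Y i - Y j) - 2 * gsm lam (X i - Y j)) := by
    simp only [Fintype.sum_sum_type, charge, zconf, Sum.elim_inl, Sum.elim_inr]
    simp only [Finset.sum_sub_distrib, Finset.sum_add_distrib, mul_one, one_mul, neg_mul, mul_neg,
      neg_neg, Finset.sum_neg_distrib, ← Finset.mul_sum]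
    have h4 : ∑ i : Fin N, ∑ j : Fin N, gsm lam (Y i - X j) =
        ∑ i : Fin N, ∑ j : Fin N, gsm lam (X i - Y j) := by
      rw [Finset.sum_comm]
      refine Finset.sum_congr rfl fun i _ => Finset.sum_congr rfl fun j _ => ?_
      rw [← gsm_neg hl, neg_sub]
    rw [h4]
    ring
  rw [Flam, ← h3, h1]
  ring

lemma setLIntegral_confSet (F : (Fin N ⊕ Fin N → E2) → ℝ≥0∞) (T : Set (Fin N ⊕ Fin N → E2)) :
    ∫⁻ P in {P : (Fin N → E2) × (Fin N → E2) | zconf P.1 P.2 ∈ T}, F (zconf P.1 P.2)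
      ∂(volume.restrict (confSet N)) = ∫⁻ z in T, F z ∂(boxMeasure N) := by
  have h1 : ∀ P : (Fin N → E2) × (Fin N → E2), zconf P.1 P.2 =
      (MeasurableEquiv.sumPiEquivProdPi (fun _ : Fin N ⊕ Fin N => E2)).symm P := by
    intro P
    funext v
    rcases v with i | i <;> rfl
  have h2 := volume_measurePreserving_sumPiEquivProdPi_symm (fun _ : Fin N ⊕ Fin N => E2)
  have h3 := h2.restrict_preimage_emb (MeasurableEquiv.measurableEmbedding _)
    (Set.univ.pi fun _ => LamBox N)
  have h4 : (MeasurableEquiv.sumPiEquivProdPi (fun _ : Fin N ⊕ Fin N => E2)).symm ⁻¹'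
      (Set.univ.pi fun _ => LamBox N) = confSet N := by
    ext P
    rw [Set.mem_preimage, ← h1, Set.mem_univ_pi, Sum.forall]
    rfl
  rw [h4] at h3
  rw [boxMeasure_eq, ← h3.setLIntegral_comp_preimage_emb (MeasurableEquiv.measurableEmbedding _)]
  simp only [h1]
  rfl

lemma Gibbs_apply (hl : 0 < lam) (T : Set (Fin N ⊕ Fin N → E2)) :
    Gibbs N β lam {P | zconf P.1 P.2 ∈ T} =
      (∫⁻ z in T, gibbsWeight β lam z ∂(boxMeasure N)) /
        ∫⁻ z, gibbsWeight β lam z ∂(boxMeasure N) := by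
  obtain ⟨c, hc⟩ : ∃ c, c = ENNReal.ofReal
    (Real.exp (-β * (N * gsm lam 0 - N * (-Real.log lam + kappa)))) := ⟨_, rfl⟩
  have hc0 : c ≠ 0 := by
    rw [hc]
    exact (ENNReal.ofReal_pos.2 (Real.exp_pos _)).ne'
  have hct : c ≠ ∞ := by
    rw [hc]
    exact ENNReal.ofReal_ne_top
  have hF : ∀ P : (Fin N → E2) × (Fin N → E2),
      ENNReal.ofReal (Real.exp (-β * Flam N lam P.1 P.2)) =
        c * gibbsWeight β lam (zconf P.1 P.2) := by
    intro P
    rw [hc, gibbsWeight, ← ENNReal.ofReal_mul (Real.exp_pos _).le, ← Real.exp_add, Flam_eq hl]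
    congr 2
    ring
  have hm := measurable_gibbsWeight (N := N) (β := β) hl
  have hT : ∀ T : Set (Fin N ⊕ Fin N → E2),
      ∫⁻ P in {P : (Fin N → E2) × (Fin N → E2) | zconf P.1 P.2 ∈ T},
        ENNReal.ofReal (Real.exp (-β * Flam N lam P.1 P.2)) ∂(volume.restrict (confSet N)) =
      c * ∫⁻ z in T, gibbsWeight β lam z ∂(boxMeasure N) := by
    intro T
    simp only [hF]
    rw [setLIntegral_confSet (fun z => c * gibbsWeight β lam z), lintegral_const_mul _ hm]
  have hU := hT Set.univ
  simp only [Set.mem_univ, Set.ofPred_true, Measure.restrict_univ] at hU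
  have hZ : ENNReal.ofReal (Zpart N β lam) = c * ∫⁻ z, gibbsWeight β lam z ∂(boxMeasure N) := by
    rw [← hU, Zpart, integral_eq_lintegral_of_nonneg_ae, ENNReal.ofReal_toReal]
    · rw [hU]
      exact ENNReal.mul_ne_top hct (lintegral_gibbsWeight_ne_top hl)
    · exact Filter.Eventually.of_forall fun _ => (Real.exp_pos _).le
    · have hz : Measurable fun P : (Fin N → E2) × (Fin N → E2) => zconf P.1 P.2 := by
        refine measurable_pi_iff.2 fun v => ?_
        rcases v with i | i <;> simp only [zconf, Sum.elim_inl, Sum.elim_inr] <;> fun_prop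
      have hp := (measurable_pairEnergy (N := N) hl charge).comp hz
      simp only [Flam_eq hl]
      refine Measurable.aestronglyMeasurable ?_
      exact Real.measurable_exp.comp (((hp.const_mul _).add_const _).const_mul _)
  have : SFinite (volume : Measure ((Fin N → E2) × (Fin N → E2))) := by
    have : SigmaFinite (volume : Measure (Fin N → E2)) := by
      rw [volume_pi]
      infer_instance
    rw [Measure.volume_eq_prod]
    infer_instance
  rw [Gibbs, Measure.smul_apply, withDensity_apply', hT, hZ, smul_eq_mul, mul_comm,
    ← div_eq_mul_inv,
    ENNReal.mul_div_mul_left _ _ hc0 hct]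

end gibbs

section realization
variable {N p : ℕ}

/-- Gaps of a line of points starting with `p` well separated pairs, followed by a chain. -/
def lineGap (p n : ℕ) : ℝ :=
  if n < 2 * p then (if n % 2 = 0 then 1 else 3) else (n : ℝ) - 2 * p + 1

/-- Positions on a line starting with `p` well separated pairs, followed by a chain. -/
def linePos (p n : ℕ) : ℝ := ∑ m ∈ Finset.range n, lineGap p m

lemma lineGap_pos (p n : ℕ) : 0 < lineGap p n := by
  unfold lineGap
  split_ifs with h1 h2
  · norm_num
  · norm_num
  · have : (2 * p : ℝ) ≤ n := by exact_mod_cast not_lt.1 h1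
    linarith

lemma linePos_succ (p n : ℕ) : linePos p (n + 1) = linePos p n + lineGap p n :=
  Finset.sum_range_succ _ _

lemma strictMono_linePos (p : ℕ) : StrictMono (linePos p) :=
  strictMono_nat_of_lt_succ fun n => by
    rw [linePos_succ]
    linarith [lineGap_pos p n]

lemma linePos_nonneg (p n : ℕ) : 0 ≤ linePos p n :=
  Finset.sum_nonneg fun m _ => (lineGap_pos p m).le

lemma lineGap_even_lt_odd {k : ℕ} : lineGap p (2 * k) < lineGap p (2 * k + 1) := by
  unfold lineGap
  by_cases h : k < p
  · rw [if_pos (by omega), if_pos (by omega), if_pos (by omega), if_neg (by omega)]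
    norm_num
  · rw [if_neg (by omega), if_neg (by omega)]
    push_cast
    linarith

lemma lineGap_even_lt_odd_pred {k : ℕ} (h : k + 1 ≤ p) :
    lineGap p (2 * (k + 1)) < lineGap p (2 * k + 1) := by
  unfold lineGap
  rw [if_pos (show 2 * k + 1 < 2 * p by omega), if_neg (show ¬ (2 * k + 1) % 2 = 0 by omega)]
  by_cases h2 : k + 1 < p
  · rw [if_pos (by omega), if_pos (by omega)]
    norm_num
  · rw [if_neg (by omega)]
    have : p = k + 1 := by omega
    subst this
    push_cast
    linarith

lemma lineGap_odd_lt_even {k : ℕ} (h : p ≤ k) :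
    lineGap p (2 * k + 1) < lineGap p (2 * (k + 1)) := by
  unfold lineGap
  rw [if_neg (by omega), if_neg (by omega)]
  push_cast
  linarith

lemma abs_linePos_lt_right {n k : ℕ} (h : ∀ m, m + 1 = n → lineGap p n < lineGap p m)
    (hk : k ≠ n) (hk' : k ≠ n + 1) :
    |linePos p n - linePos p (n + 1)| < |linePos p n - linePos p k| := by
  rw [linePos_succ, sub_add_cancel_left, abs_neg, abs_of_pos (lineGap_pos p n)]
  rcases lt_or_gt_of_ne hk with h1 | h1
  · obtain ⟨m, rfl⟩ : ∃ m, n = m + 1 := ⟨n - 1, by omega⟩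
    have h2 := (strictMono_linePos p).monotone (show k ≤ m by omega)
    have h3 := h m rfl
    have h4 := linePos_succ p m
    rw [lt_abs]
    left
    linarith
  · have h2 := (strictMono_linePos p) (show n + 1 < k by omega)
    rw [linePos_succ] at h2
    rw [lt_abs]
    right
    linarith

lemma abs_linePos_lt_left {n k : ℕ} (h : lineGap p n < lineGap p (n + 1))
    (hk : k ≠ n + 1) (hk' : k ≠ n) :
    |linePos p (n + 1) - linePos p n| < |linePos p (n + 1) - linePos p k| := by
  have h0 := linePos_succ p n
  have h0' := linePos_succ p (n + 1)
  rw [h0, add_sub_cancel_left, abs_of_pos (lineGap_pos p n), ← h0]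
  rcases lt_or_gt_of_ne hk with h1 | h1
  · have h2 := (strictMono_linePos p) (show k < n by omega)
    rw [lt_abs]
    left
    linarith
  · have h2 := (strictMono_linePos p).monotone (show n + 1 + 1 ≤ k by omega)
    rw [lt_abs]
    right
    linarith

/-- The rank on the line of a labelled point. -/
def lineRank : Fin N ⊕ Fin N → ℕ := Sum.elim (fun i => 2 * i) (fun i => 2 * i + 1)

/-- The nearest neighbor map of the points on the line. -/
def lineNext (p : ℕ) : Fin N ⊕ Fin N → Fin N ⊕ Fin N :=
  Sum.elim (fun i => .inr (if (i : ℕ) ≤ p then i else ⟨i - 1, by omega⟩)) .inl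

lemma lineRank_injective : Function.Injective (lineRank : Fin N ⊕ Fin N → ℕ) := by
  rintro (i | i) (j | j) h <;> simp only [lineRank, Sum.elim_inl, Sum.elim_inr] at h
  · congr 1
    ext
    omega
  · omega
  · omega
  · congr 1
    ext
    omega

lemma lineNext_ne (v : Fin N ⊕ Fin N) : lineNext p v ≠ v := by
  rcases v with i | i <;> simp [lineNext]

lemma abs_linePos_lt {v w : Fin N ⊕ Fin N} (hw : w ≠ v) (hw' : w ≠ lineNext p v) :
    |linePos p (lineRank v) - linePos p (lineRank (lineNext p v))| <
      |linePos p (lineRank v) - linePos p (lineRank w)| := by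
  have h1 : lineRank w ≠ lineRank v := fun h => hw (lineRank_injective h)
  have h2 : lineRank w ≠ lineRank (lineNext p v) := fun h => hw' (lineRank_injective h)
  rcases v with i | i
  · by_cases hi : (i : ℕ) ≤ p
    · simp only [lineNext, Sum.elim_inl, if_pos hi] at h2 ⊢
      refine abs_linePos_lt_right (fun m hm => ?_) h1 h2
      obtain ⟨k, hk⟩ : ∃ k, (i : ℕ) = k + 1 := ⟨i - 1, by simp [lineRank] at hm; omega⟩
      have hm' : m = 2 * k + 1 := by
        simp only [lineRank, Sum.elim_inl] at hm
        omega
      simp only [lineRank, Sum.elim_inl]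
      rw [hm', hk]
      exact lineGap_even_lt_odd_pred (by omega)
    · simp only [lineNext, Sum.elim_inl, if_neg hi] at h2 ⊢
      obtain ⟨k, hk⟩ : ∃ k, (i : ℕ) = k + 1 := ⟨i - 1, by omega⟩
      have h3 : lineRank (.inl i : Fin N ⊕ Fin N) = 2 * k + 1 + 1 := by
        simp only [lineRank, Sum.elim_inl]
        omega
      have h4 : lineRank (.inr ⟨i - 1, by omega⟩ : Fin N ⊕ Fin N) = 2 * k + 1 := by
        simp only [lineRank, Sum.elim_inr]
        omega
      rw [h3] at h1 ⊢
      rw [h4] at h2 ⊢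
      exact abs_linePos_lt_left (lineGap_odd_lt_even (by omega)) h1 h2
  · exact abs_linePos_lt_left lineGap_even_lt_odd h1 h2

lemma numIsolatedDipoles_eq_of_phi1 (hp : p + 2 ≤ N) {z : Fin N ⊕ Fin N → E2}
    (hz : phi1 z = lineNext p) : numIsolatedDipoles z = p := by
  have hl : ∀ i : Fin p, (i : ℕ) < N := fun i => by omega
  have hch : ∀ i : Fin p, isIsolatedDipolePair z (.inl ⟨i, hl i⟩) (.inr ⟨i, hl i⟩) ∧
      isIsolatedDipolePair z (.inr ⟨i, hl i⟩) (.inl ⟨i, hl i⟩) := by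
    intro i
    have h0 : (i : ℕ) ≤ p := i.isLt.le
    have h1 : ∀ k : Fin N ⊕ Fin N, k ≠ .inl ⟨i, hl i⟩ → k ≠ .inr ⟨i, hl i⟩ →
        lineNext p k ≠ .inl ⟨i, hl i⟩ ∧ lineNext p k ≠ .inr ⟨i, hl i⟩ := by
      rintro (k | k) ha hb
      · refine ⟨by simp [lineNext], fun h => ha ?_⟩
        have h2 := i.isLt
        simp only [lineNext, Sum.elim_inl, Sum.inr.injEq, Fin.ext_iff] at h
        simp only [Sum.inl.injEq, Fin.ext_iff]
        split_ifs at h with h3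
        · exact h
        · simp only at h
          omega
      · refine ⟨fun h => hb ?_, by simp [lineNext]⟩
        simpa [lineNext] using h
    refine ⟨⟨?_, ?_, ?_, fun k ha hb => ?_⟩, ⟨?_, ?_, ?_, fun k ha hb => ?_⟩⟩
    · simp [hz, lineNext, h0]
    · simp [hz, lineNext]
    · simp [charge]
    · rw [hz]
      exact h1 k ha hb
    · simp [hz, lineNext]
    · simp [hz, lineNext, h0]
    · simp [charge]
    · rw [hz]
      exact (h1 k hb ha).symm
  have hlt : ∀ i : Fin N, isIsolatedDipolePair z (.inl i) (.inr i) ∨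
      isIsolatedDipolePair z (.inr i) (.inl i) → (i : ℕ) < p := by
    intro i h
    have h1 : phi1 z (.inl i) = .inr i ∧ ∀ k : Fin N ⊕ Fin N, k ≠ .inl i → k ≠ .inr i →
        phi1 z k ≠ .inr i := by
      rcases h with h | h
      · exact ⟨h.1, fun k ha hb => (h.2.2.2 k ha hb).2⟩
      · exact ⟨h.2.1, fun k ha hb => (h.2.2.2 k hb ha).1⟩
    rw [hz] at h1
    by_contra hc
    have h2 : (i : ℕ) = p := by
      by_contra hne
      have h3 := h1.1
      simp only [lineNext, Sum.elim_inl, Sum.inr.injEq, Fin.ext_iff] at h3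
      rw [if_neg (by omega)] at h3
      simp only at h3
      omega
    refine h1.2 (.inl ⟨p + 1, by omega⟩) ?_ (by simp) ?_
    · simp only [ne_eq, Sum.inl.injEq, Fin.ext_iff]
      omega
    · simp only [lineNext, Sum.elim_inl, Sum.inr.injEq, Fin.ext_iff]
      rw [if_neg (by simp)]
      simp only
      omega
  have hcard : Nat.card {q : (Fin N ⊕ Fin N) × (Fin N ⊕ Fin N) //
      isIsolatedDipolePair z q.1 q.2} = p + p := by
    have h1 : Nat.card (Fin p ⊕ Fin p) = p + p := by simp
    rw [← h1]
    refine (Nat.card_eq_of_bijective (fun v : Fin p ⊕ Fin p => (Sum.elim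
      (fun i : Fin p => ⟨(.inl ⟨i, hl i⟩, .inr ⟨i, hl i⟩), (hch i).1⟩)
      (fun i : Fin p => ⟨(.inr ⟨i, hl i⟩, .inl ⟨i, hl i⟩), (hch i).2⟩) v :
        {q : (Fin N ⊕ Fin N) × (Fin N ⊕ Fin N) // isIsolatedDipolePair z q.1 q.2})) ⟨?_, ?_⟩).symm
    · rintro (i | i) (j | j) h <;> simp [Fin.ext_iff] at h ⊢ <;> exact h
    · rintro ⟨⟨v, w⟩, h⟩
      rcases v with i | i
      · rcases w with j | j
        · have := h.2.2.1
          norm_num [charge] at this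
        · have h2 : i = j := by
            have := h.2.1
            rw [hz] at this
            simpa [lineNext, eq_comm] using this
          subst h2
          exact ⟨.inl ⟨i, hlt i (.inl h)⟩, rfl⟩
      · rcases w with j | j
        · have h2 : i = j := by
            have := h.1
            rw [hz] at this
            simpa [lineNext] using this
          subst h2
          exact ⟨.inr ⟨i, hlt i (.inr h)⟩, rfl⟩
        · have := h.2.2.1
          norm_num [charge] at this
  rw [numIsolatedDipoles, hcard]
  omega

lemma boxMeasure_numIsolatedDipoles_pos (hp : p + 2 ≤ N) :
    ∃ O : Set (Fin N ⊕ Fin N → E2), O ⊆ {z | numIsolatedDipoles z = p} ∧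
      0 < boxMeasure N O := by
  obtain ⟨O, hO⟩ : ∃ O : Set (Fin N ⊕ Fin N → E2), O = {z | (∀ v k, 0 < z v k ∧ z v k < √N) ∧
      ∀ v w, w ≠ v → w ≠ lineNext p v → dist (z v) (z (lineNext p v)) < dist (z v) (z w)} :=
    ⟨_, rfl⟩
  have hopen : IsOpen O := by
    rw [hO]
    simp only [Set.ofPred_and, Set.ofPred_forall]
    refine IsOpen.inter (isOpen_iInter_of_finite fun v => isOpen_iInter_of_finite fun k => ?_)
      (isOpen_iInter_of_finite fun v => isOpen_iInter_of_finite fun w =>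
        isOpen_iInter_of_finite fun _ => isOpen_iInter_of_finite fun _ => ?_)
    · exact (isOpen_lt continuous_const (by fun_prop)).inter
        (isOpen_lt (by fun_prop) continuous_const)
    · exact isOpen_lt (by fun_prop) (by fun_prop)
  have hN : 0 < √(N : ℝ) := Real.sqrt_pos.2 (by exact_mod_cast (by omega : 0 < N))
  have hR := linePos_nonneg p (2 * N)
  have hne : O.Nonempty := by
    obtain ⟨s, hs⟩ : ∃ s, s = √N / (linePos p (2 * N) + 2) := ⟨_, rfl⟩
    have hs0 : 0 < s := by
      rw [hs]
      positivity
    have hsN : s * (linePos p (2 * N) + 2) = √N := by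
      rw [hs]
      field_simp
    refine ⟨fun v => !₂[s * (1 + linePos p (lineRank v)), √N / 2], ?_⟩
    have hdist : ∀ v w : Fin N ⊕ Fin N,
        dist (!₂[s * (1 + linePos p (lineRank v)), √N / 2] : E2)
          !₂[s * (1 + linePos p (lineRank w)), √N / 2] =
        s * |linePos p (lineRank v) - linePos p (lineRank w)| := by
      intro v w
      rw [EuclideanSpace.dist_eq, Fin.sum_univ_two]
      simp only [Matrix.cons_val_zero, Matrix.cons_val_one, dist_self, Real.dist_eq]
      rw [← mul_sub, add_sub_add_left_eq_sub, zero_pow two_ne_zero, add_zero,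
        Real.sqrt_sq (abs_nonneg _), abs_mul, abs_of_pos hs0]
    rw [hO]
    refine ⟨fun v k => ?_, fun v w h1 h2 => ?_⟩
    · have h1 := linePos_nonneg p (lineRank v)
      have h2 : linePos p (lineRank v) ≤ linePos p (2 * N) := by
        refine (strictMono_linePos p).monotone ?_
        rcases v with i | i <;> simp only [lineRank, Sum.elim_inl, Sum.elim_inr] <;> omega
      fin_cases k
      · simp only [Fin.zero_eta, Matrix.cons_val_zero]
        refine ⟨by positivity, ?_⟩
        rw [← hsN]
        exact mul_lt_mul_of_pos_left (by linarith) hs0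
      · simp only [Fin.mk_one, Matrix.cons_val_one, Matrix.cons_val_zero]
        constructor <;> linarith
    · rw [hdist, hdist]
      exact mul_lt_mul_of_pos_left (abs_linePos_lt h1 h2) hs0
  refine ⟨O, fun z hz => ?_, ?_⟩
  · rw [hO] at hz
    refine numIsolatedDipoles_eq_of_phi1 hp (funext fun v => ?_)
    exact phi1_eq_of_nearest (lineNext_ne v) fun k h1 h2 => hz.2 v k h1 h2
  · have hsub : O ⊆ Set.univ.pi fun _ => LamBox N := by
      intro z hz v _ k
      rw [hO] at hz
      exact ⟨(hz.1 v k).1.le, (hz.1 v k).2.le⟩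
    rw [boxMeasure_eq, Measure.restrict_apply hopen.measurableSet,
      Set.inter_eq_left.2 hsub]
    exact hopen.measure_pos _ hne

lemma setLIntegral_gibbsWeight_pos {β lam : ℝ} (hl : 0 < lam) (hp : p + 2 ≤ N) :
    0 < ∫⁻ z in {z | numIsolatedDipoles z = p}, gibbsWeight β lam z ∂(boxMeasure N) := by
  obtain ⟨O, hO, hpos⟩ := boxMeasure_numIsolatedDipoles_pos hp
  refine lt_of_lt_of_le ?_ (lintegral_mono_set hO)
  rw [setLIntegral_pos_iff (measurable_gibbsWeight hl)]
  have h1 : Function.support (gibbsWeight β lam : (Fin N ⊕ Fin N → E2) → ℝ≥0∞) = Set.univ := by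
    ext z
    simp [gibbsWeight, Real.exp_pos]
  rwa [h1, Set.univ_inter]

end realization

lemma pow_div_factorial_le_exp_neg {a : ℝ} (ha : 0 ≤ a) (n : ℕ) :
    a ^ n / (n.factorial : ℝ) ≤ Real.exp (Real.exp 1 * a - n) := by
  have h1 := Real.pow_div_factorial_le_exp (Real.exp 1 * a) (by positivity) n
  rw [mul_pow, ← Real.exp_nat_mul, mul_one, mul_div_assoc] at h1
  rw [Real.exp_sub, le_div_iff₀ (Real.exp_pos _)]
  linarith

lemma choose_mul_descFactorial_mul_le {N m : ℕ} (hm : m ≤ N) {A K q h γ : ℝ} (hA : 0 ≤ A)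
    (hK : 0 ≤ K) (hh : 0 ≤ h) (hγ : 0 ≤ γ) (hq : Real.exp (-10 * h) ≤ q) :
    (N.choose m : ℝ) * N.descFactorial m * ((N * (Real.exp (γ * h) * K)) ^ m *
        ((10 * A * N * h) ^ 2 * K) ^ (N - m)) ≤
      N.factorial * (N * q * K) ^ N *
        Real.exp ((γ + 10 + 20 * Real.exp 1 * A) * h * N - 2 * (N - m : ℕ)) := by
  obtain ⟨n, rfl⟩ : ∃ n, N = m + n := ⟨N - m, by omega⟩
  rw [Nat.add_sub_cancel_left]
  obtain ⟨M, hM⟩ : ∃ M : ℝ, M = ((m + n : ℕ) : ℝ) := ⟨_, rfl⟩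
  have hM0 : 0 ≤ M := by
    rw [hM]
    positivity
  have hf : (0 : ℝ) < n.factorial := by exact_mod_cast n.factorial_pos
  have h1 : ((m + n).choose m : ℝ) ≤ M ^ n / n.factorial := by
    rw [hM, Nat.choose_symm_add]
    exact Nat.choose_le_pow_div n (m + n)
  have h2 : ((m + n).descFactorial m : ℝ) = (m + n).factorial / n.factorial := by
    rw [eq_div_iff hf.ne', mul_comm]
    have h3 := Nat.factorial_mul_descFactorial (n := m + n) (k := m) (by omega)
    rw [Nat.add_sub_cancel_left] at h3
    exact_mod_cast h3
  have h4 := pow_div_factorial_le_exp_neg (a := 10 * A * M * h) (by positivity) n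
  have h5 : 1 ≤ q ^ (m + n) * Real.exp (10 * h * M) := by
    have h6 := pow_le_pow_left₀ (Real.exp_pos _).le hq (m + n)
    rw [← Real.exp_nat_mul, ← hM] at h6
    have h7 := mul_le_mul_of_nonneg_right h6 (Real.exp_pos (10 * h * M)).le
    rw [← Real.exp_add] at h7
    rw [show M * (-10 * h) + 10 * h * M = 0 by ring, Real.exp_zero] at h7
    exact h7
  have h8 : Real.exp (γ * h) ^ m ≤ Real.exp (γ * h * M) := by
    rw [← Real.exp_nat_mul]
    refine Real.exp_le_exp.2 ?_
    have : (m : ℝ) ≤ M := by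
      rw [hM]
      push_cast
      linarith [(Nat.cast_nonneg n : (0 : ℝ) ≤ n)]
    nlinarith [mul_nonneg hγ hh]
  have h9 : ((10 * A * M * h) ^ n / n.factorial) ^ 2 ≤
      Real.exp (20 * Real.exp 1 * A * h * M - 2 * n) := by
    refine (pow_le_pow_left₀ (by positivity) h4 2).trans (le_of_eq ?_)
    rw [← Real.exp_nat_mul]
    congr 1
    push_cast
    ring
  rw [← hM]
  calc _ ≤ M ^ n / n.factorial * ((m + n).factorial / n.factorial) *
        ((M * (Real.exp (γ * h) * K)) ^ m * ((10 * A * M * h) ^ 2 * K) ^ n) := by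
        rw [h2]
        gcongr
    _ = (m + n).factorial * (M * K) ^ (m + n) * (1 * Real.exp (γ * h) ^ m *
          ((10 * A * M * h) ^ n / n.factorial) ^ 2) := by
        generalize 10 * A * M * h = X
        generalize Real.exp (γ * h) = Y
        ring
    _ ≤ (m + n).factorial * (M * K) ^ (m + n) * (q ^ (m + n) * Real.exp (10 * h * M) *
          Real.exp (γ * h * M) * Real.exp (20 * Real.exp 1 * A * h * M - 2 * n)) := by
        gcongr
    _ = _ := by
        rw [mul_assoc (q ^ (m + n)), mul_assoc (q ^ (m + n)), ← Real.exp_add, ← Real.exp_add,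
          mul_right_comm M q K, mul_pow (M * K)]
        rw [show 10 * h * M + γ * h * M + (20 * Real.exp 1 * A * h * M - 2 * n) =
          (γ + 10 + 20 * Real.exp 1 * A) * h * M - 2 * n by ring]
        ring

section ratio
variable {N p : ℕ} {β lam c h : ℝ}

lemma setLIntegral_numIsolatedDipoles_le (hN : 2 ≤ N) (hβ : 0 ≤ β) (hl : 0 < lam) (hh : 0 < h)
    (hh1 : h ≤ 1) (hc : 0 < c) (h4 : 4 * lam < h ^ 4)
    (hK : ENNReal.ofReal (c * h ^ (-(6 + 4 * β))) ≤ dipoleMass β lam (h ^ 4)) :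
    ∫⁻ z in {z : Fin N ⊕ Fin N → E2 | numIsolatedDipoles z = p}, gibbsWeight β lam z
        ∂(boxMeasure N) ≤
      ∑ m ∈ Finset.range (N + 1), (N.choose m * N.descFactorial m : ℕ) *
        if m ≤ p then
          (N * (ENNReal.ofReal (Real.exp (β * (12 * h))) * dipoleMass β lam (h ^ 4))) ^ m *
            (10 * ENNReal.ofReal (massConst β c) * N *
              ENNReal.ofReal √(dipoleMass β lam (h ^ 4)).toReal * ENNReal.ofReal h) ^
                (2 * (N - m)) else 0 := by
  have : Nontrivial (Fin N ⊕ Fin N) :=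
    ⟨⟨.inl ⟨0, by omega⟩, .inr ⟨0, by omega⟩, by simp⟩⟩
  have h1 := setLIntegral_le_sum_structures (N := N) hl hβ h4
    (pow_le_pow_of_le_one hh.le hh1 (by norm_num : 3 ≤ 4))
    (massBounds hβ hl hh hh1 hc hK) (volume_LamBox N) p
  rw [lintegral_roleKernel_three (h ^ 3) hl, show h ^ 4 / h ^ 3 = h by field_simp] at h1
  have h2 := sum_finset_embedding (N := N) (fun m => if m ≤ p then
    (N * (ENNReal.ofReal (Real.exp (β * (12 * h))) * dipoleMass β lam (h ^ 4))) ^ m *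
      (10 * ENNReal.ofReal (massConst β c) * N *
        ENNReal.ofReal √(dipoleMass β lam (h ^ 4)).toReal * ENNReal.ofReal h) ^
          (2 * (N - m)) else 0)
  rw [← h2]
  refine le_trans ?_ h1
  refine lintegral_mono_set' ?_
  have h3 : ∀ᵐ z ∂(boxMeasure N), IsNearest z (phi1 z) := by
    rw [boxMeasure_eq]
    exact ae_restrict_of_ae ae_isNearest
  filter_upwards [h3] with z hz hp
  exact ⟨hz, le_of_eq hp⟩

lemma exp_neg_le_one_sub (hh : 0 ≤ h) (hh1 : h ≤ 1 / 100) :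
    Real.exp (-10 * h) ≤ 1 - 5 * h := by
  have h1 := Real.add_one_le_exp (10 * h)
  rw [neg_mul, Real.exp_neg, inv_le_comm₀ (Real.exp_pos _) (by linarith)]
  refine le_trans ?_ h1
  rw [inv_le_iff_one_le_mul₀ (by linarith)]
  nlinarith

lemma mul_one_sub_le (hN : 2 ≤ N) (hh : 0 < h) (hh1 : h ≤ 1 / 100) :
    2 * h ^ 4 ≤ √N ∧
      N * (1 - 5 * h) ≤ (√N - 2 * h ^ 4) ^ 2 - 9 * π * (h ^ 4) ^ 2 * N := by
  have hN' : (2 : ℝ) ≤ N := by exact_mod_cast hN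
  have hs : √(N : ℝ) ^ 2 = N := Real.sq_sqrt (by linarith)
  have hs1 : 1 ≤ √(N : ℝ) := Real.one_le_sqrt.2 (by linarith)
  have he : h ^ 4 ≤ h := by
    calc h ^ 4 ≤ h ^ 1 := pow_le_pow_of_le_one hh.le (by linarith) (by norm_num)
      _ = h := pow_one h
  have he0 : 0 < h ^ 4 := by positivity
  refine ⟨by linarith, ?_⟩
  have hsN : √(N : ℝ) ≤ N := by nlinarith
  have hπ := Real.pi_lt_d2
  have h1 : (h ^ 4) ^ 2 ≤ h / 100 := by nlinarith
  have h2 : h ^ 4 * √N ≤ h * N := mul_le_mul he hsN (by positivity) hh.le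
  have h3 : π * ((h ^ 4) ^ 2 * N) ≤ 3.15 * (h / 100 * N) := by gcongr
  have h4 : 0 ≤ h * N := by positivity
  have h5 : 0 ≤ (h ^ 4) ^ 2 := by positivity
  nlinarith

lemma Gibbs_numIsolatedDipoles_le (hN : 2 ≤ N) (hβ : 0 ≤ β) (hl : 0 < lam) (hh : 0 < h)
    (hh1 : h ≤ 1 / 100) (hc : 0 < c) (h4 : 4 * lam < h ^ 4)
    (hK : ENNReal.ofReal (c * h ^ (-(6 + 4 * β))) ≤ dipoleMass β lam (h ^ 4)) :
    Gibbs N β lam {P | numIsolatedDipoles (zconf P.1 P.2) = p} ≤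
      ENNReal.ofReal ((N + 1) * Real.exp
        ((12 * β + 10 + 20 * Real.exp 1 * massConst β c) * h * N - 2 * ((N : ℝ) - p))) := by
  obtain ⟨K, hKdef⟩ : ∃ K, K = (dipoleMass β lam (h ^ 4)).toReal := ⟨_, rfl⟩
  have hKE : dipoleMass β lam (h ^ 4) = ENNReal.ofReal K := by
    rw [hKdef, ENNReal.ofReal_toReal (dipoleMass_ne_top hl hβ)]
  have hK0 : 0 < K := by
    rw [hKE] at hK
    have h1 : 0 < c * h ^ (-(6 + 4 * β)) := by positivity
    exact ENNReal.ofReal_pos.1 (lt_of_lt_of_le (ENNReal.ofReal_pos.2 h1) hK)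
  have hA : 0 ≤ massConst β c := by
    unfold massConst
    positivity
  have hN' : (2 : ℝ) ≤ N := by exact_mod_cast hN
  obtain ⟨D, hD⟩ : ∃ D : ℝ, D = N.factorial * (N * (1 - 5 * h) * K) ^ N := ⟨_, rfl⟩
  have hq : 0 < 1 - 5 * h := by linarith
  have hD0 : 0 < D := by
    have h1 : (0 : ℝ) < N.factorial := by exact_mod_cast N.factorial_pos
    rw [hD]
    positivity
  have hden : ENNReal.ofReal D ≤ ∫⁻ z, gibbsWeight β lam z ∂(boxMeasure N) := by
    obtain ⟨h1, h2⟩ := mul_one_sub_le hN hh hh1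
    refine le_trans (le_of_eq ?_) (le_lintegral_gibbsWeight hl (by positivity) h1 h2)
    rw [hKE, ← ENNReal.ofReal_mul (by positivity), ← ENNReal.ofReal_pow (by positivity),
      ← ENNReal.ofReal_natCast, ← ENNReal.ofReal_mul (by positivity), hD]
  have h1 := Gibbs_apply (N := N) (β := β) hl {z | numIsolatedDipoles z = p}
  simp only [Set.mem_ofPred_eq] at h1
  rw [h1]
  refine ENNReal.div_le_of_le_mul ?_
  refine le_trans ?_ (mul_le_mul_right hden _)
  rw [← ENNReal.ofReal_mul (by positivity)]
  refine (setLIntegral_numIsolatedDipoles_le hN hβ hl hh (by linarith) hc h4 hK).trans ?_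
  have h2 : ∀ m ∈ Finset.range (N + 1), ((N.choose m * N.descFactorial m : ℕ) : ℝ≥0∞) *
      (if m ≤ p then
          (N * (ENNReal.ofReal (Real.exp (β * (12 * h))) * dipoleMass β lam (h ^ 4))) ^ m *
            (10 * ENNReal.ofReal (massConst β c) * N *
              ENNReal.ofReal √(dipoleMass β lam (h ^ 4)).toReal * ENNReal.ofReal h) ^
                (2 * (N - m)) else 0) ≤
      ENNReal.ofReal (D * Real.exp
        ((12 * β + 10 + 20 * Real.exp 1 * massConst β c) * h * N - 2 * ((N : ℝ) - p))) := by
    intro m hm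
    split_ifs with hmp
    swap
    · rw [mul_zero]
      exact zero_le
    have hmN : m ≤ N := by
      have := Finset.mem_range.1 hm
      omega
    rw [← hKdef, hKE, show (10 : ℝ≥0∞) = ENNReal.ofReal 10 by simp, ← ENNReal.ofReal_natCast N,
      ← ENNReal.ofReal_mul (by positivity), ← ENNReal.ofReal_mul (by positivity),
      ← ENNReal.ofReal_pow (by positivity), ← ENNReal.ofReal_mul (by positivity),
      ← ENNReal.ofReal_mul (by positivity), ← ENNReal.ofReal_mul (by positivity),
      ← ENNReal.ofReal_mul (by positivity), ← ENNReal.ofReal_pow (by positivity),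
      ← ENNReal.ofReal_mul (by positivity), ← ENNReal.ofReal_natCast,
      ← ENNReal.ofReal_mul (by positivity)]
    refine ENNReal.ofReal_le_ofReal ?_
    have h3 := choose_mul_descFactorial_mul_le (K := K) (q := 1 - 5 * h) (γ := 12 * β) hmN hA hK0.le
      hh.le (by positivity) (exp_neg_le_one_sub hh.le hh1)
    rw [← hD] at h3
    have h5 : (10 * massConst β c * N * √K * h) ^ (2 * (N - m)) =
        ((10 * massConst β c * N * h) ^ 2 * K) ^ (N - m) := by
      rw [pow_mul]
      congr 1
      rw [show 10 * massConst β c * N * √K * h = 10 * massConst β c * N * h * √K by ring, mul_pow,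
        Real.sq_sqrt hK0.le]
    rw [h5, show β * (12 * h) = 12 * β * h by ring]
    push_cast
    refine h3.trans (mul_le_mul_of_nonneg_left (Real.exp_le_exp.2 ?_) hD0.le)
    rw [Nat.cast_sub hmN]
    have : (m : ℝ) ≤ p := by exact_mod_cast hmp
    linarith
  refine (Finset.sum_le_sum h2).trans (le_of_eq ?_)
  rw [Finset.sum_const, Finset.card_range, nsmul_eq_mul, ← ENNReal.ofReal_natCast,
    ← ENNReal.ofReal_mul (by positivity)]
  congr 1
  push_cast
  ring

end ratio

lemma log_Gibbs_numIsolatedDipoles_nonpos {N p : ℕ} {β lam : ℝ} (hl : 0 < lam) :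
    Real.log ((Gibbs N β lam) {P | numIsolatedDipoles (zconf P.1 P.2) = p}).toReal ≤ 0 := by
  refine Real.log_nonpos ENNReal.toReal_nonneg ?_
  have h1 := Gibbs_apply (N := N) (β := β) hl {z | numIsolatedDipoles z = p}
  simp only [Set.mem_ofPred_eq] at h1
  rw [h1]
  refine ENNReal.toReal_le_of_le_ofReal zero_le_one ?_
  rw [ENNReal.ofReal_one]
  exact (ENNReal.div_le_div_right (setLIntegral_le_lintegral _ _) _).trans ENNReal.div_self_le_one

lemma log_Gibbs_numIsolatedDipoles_le {N p : ℕ} {β lam U : ℝ} (hl : 0 < lam) (hp : p + 2 ≤ N)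
    (hU : 0 ≤ U)
    (h : Gibbs N β lam {P | numIsolatedDipoles (zconf P.1 P.2) = p} ≤ ENNReal.ofReal U) :
    Real.log ((Gibbs N β lam) {P | numIsolatedDipoles (zconf P.1 P.2) = p}).toReal ≤
      Real.log U := by
  refine Real.log_le_log (ENNReal.toReal_pos ?_ (h.trans_lt ENNReal.ofReal_lt_top).ne)
    (ENNReal.toReal_le_of_le_ofReal hU h)
  have h1 := Gibbs_apply (N := N) (β := β) hl {z | numIsolatedDipoles z = p}
  simp only [Set.mem_ofPred_eq] at h1
  rw [h1]
  exact (ENNReal.div_pos (setLIntegral_gibbsWeight_pos hl hp).ne'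
    (lintegral_gibbsWeight_ne_top hl)).ne'

lemma mul_one_sub_div_sq_le {N p : ℕ} (hN : 0 < N) (hp : p ≤ N) :
    (N : ℝ) * (1 - (p : ℝ) / N) ^ 2 ≤ N - p := by
  have h1 : (0 : ℝ) < N := by exact_mod_cast hN
  have h2 : (p : ℝ) ≤ N := by exact_mod_cast hp
  have h3 : (p : ℝ) / N ≤ 1 := (div_le_one h1).2 h2
  have h4 : (0 : ℝ) ≤ p / N := by positivity
  have h5 : (N : ℝ) * (1 - (p : ℝ) / N) = N - p := by field_simp
  rw [sq, ← mul_assoc, h5]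
  nlinarith

lemma log_add_one_le_two_mul_log {N : ℕ} (hN : 2 ≤ N) :
    Real.log (N + 1) ≤ 2 * Real.log N := by
  have h1 : (2 : ℝ) ≤ N := by exact_mod_cast hN
  rw [show 2 * Real.log N = Real.log ((N : ℝ) ^ 2) by rw [Real.log_pow]; norm_num]
  exact Real.log_le_log (by positivity) (by nlinarith)

lemma massConst_nonneg (β c : ℝ) : 0 ≤ massConst β c := by
  unfold massConst
  positivity

lemma exists_small_lam_bounds {β : ℝ} (hβ : 2 ≤ β) : ∃ c lam0 : ℝ, 0 < c ∧ 0 < lam0 ∧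
    lam0 < 1 / 2 ∧ ∀ lam : ℝ, 0 < lam → lam < lam0 → lam < Real.exp (-1) ∧
      dipoleScale β lam ≤ 1 / 100 ∧ 4 * lam < dipoleScale β lam ^ 4 ∧
      ENNReal.ofReal (c * dipoleScale β lam ^ (-(6 + 4 * β))) ≤
        dipoleMass β lam (dipoleScale β lam ^ 4) := by
  obtain ⟨c, hc, h1⟩ := exists_dipoleScale_bounds hβ
  have h2 := (tendsto_dipoleScale hβ).eventually
    (ge_mem_nhds (show (0 : ℝ) < 1 / 100 by norm_num))
  obtain ⟨u, hu, h3⟩ := mem_nhdsGT_iff_exists_Ioo_subset.1 (h1.and h2)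
  refine ⟨c, min u (min (1 / 4) (Real.exp (-1))), hc,
    lt_min hu (lt_min (by norm_num) (Real.exp_pos _)),
    ((min_le_right _ _).trans (min_le_left _ _)).trans_lt (by norm_num), fun lam hl hl1 => ?_⟩
  obtain ⟨⟨h4, h5⟩, h6⟩ := h3 ⟨hl, hl1.trans_le (min_le_left _ _)⟩
  exact ⟨hl1.trans_le ((min_le_right _ _).trans (min_le_right _ _)), h6, h4, h5⟩

/-- Concentration on configurations made mostly of isolated dipoles
(Theorem 1, item (3), first bullet). -/
theorem statement2 (β : ℝ) (hβ : 2 ≤ β) :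
    ∃ c C lam0 : ℝ, 0 < c ∧ 0 < C ∧ 0 < lam0 ∧ lam0 < 1/2 ∧
      ∀ lam : ℝ, 0 < lam → lam < lam0 → ∀ N : ℕ, 2 ≤ N → ∀ p0 : ℕ, p0 ≤ N →
        Real.log ((Gibbs N β lam)
            {P | numIsolatedDipoles (zconf P.1 P.2) = p0}).toReal ≤
          -c * N * (1 - (p0 : ℝ) / N)^2 + C * (N * omegaL β lam + Real.log N) := by
  obtain ⟨c, lam0, hc, hlam0, hlam0', h⟩ := exists_small_lam_bounds hβ
  obtain ⟨D, hD⟩ : ∃ D, D = 12 * β + 10 + 20 * Real.exp 1 * massConst β c := ⟨_, rfl⟩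
  have hD0 : 0 ≤ D := by
    have := massConst_nonneg β c
    rw [hD]
    positivity
  refine ⟨1, D + 2, lam0, one_pos, by linarith, hlam0, hlam0', fun lam hl hl0 N hN p hp => ?_⟩
  obtain ⟨h1, h2, h3, h4⟩ := h lam hl hl0
  have hs : 0 < dipoleScale β lam :=
    dipoleScale_pos hl (h1.trans_le (Real.exp_le_one_iff.2 (by norm_num)))
  have hsω := dipoleScale_le_omegaL hβ hl h1
  have hN' : (2 : ℝ) ≤ N := by exact_mod_cast hN
  have hlog : Real.log 2 ≤ Real.log N := Real.log_le_log (by norm_num) hN'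
  have hlog2 := Real.log_two_gt_d9
  have hq := mul_one_sub_div_sq_le (by omega) hp
  have hDlog : 0 ≤ D * Real.log N := mul_nonneg hD0 (by linarith)
  have hNω : 0 ≤ (N : ℝ) * omegaL β lam := mul_nonneg (by linarith) (hs.le.trans hsω)
  have hDω : 0 ≤ D * (N * omegaL β lam) := mul_nonneg hD0 hNω
  rcases Nat.lt_or_ge N (p + 2) with hpN | hpN
  · refine (log_Gibbs_numIsolatedDipoles_nonpos hl).trans ?_
    have h5 : (N : ℝ) ≤ p + 1 := by exact_mod_cast Nat.lt_succ_iff.1 hpN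
    linarith
  · have h5 := Gibbs_numIsolatedDipoles_le (p := p) hN (by linarith) hl hs h2 hc h3 h4
    rw [← hD] at h5
    refine (log_Gibbs_numIsolatedDipoles_le hl hpN (by positivity) h5).trans ?_
    rw [Real.log_mul (by positivity) (Real.exp_pos _).ne', Real.log_exp]
    have h6 := log_add_one_le_two_mul_log hN
    have h7 : (p : ℝ) ≤ N := by exact_mod_cast hp
    have h8 : D * dipoleScale β lam * N ≤ D * (N * omegaL β lam) := by
      rw [mul_assoc, mul_comm _ (N : ℝ)]
      gcongr
    linarith
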